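/- There exist constants C > 0 and p > 0 such that, for every n ≥ 1 and every (h,ℓ) ∈ ℤ²_{≥0}, the random walk (S_k)_{k≥0} started at S_0 = (h,ℓ) with i.i.d. increments of law ←μ_Sb satisfies P(S_k ∈ ℤ²_{≥0} for all 0 ≤ k ≤ n−1 and S_{n−1} = (0,0)) ≤ C (1 + |(h,ℓ)|^p) n^{−p−1}, where |·| denotes the Euclidean norm. Moreover, with the same exponent p, for every fixed (h,ℓ) ∈ ℤ²_{≥0} there is a constant c > 0 such that P(S_k ∈ ℤ²_{≥0} for all 0 ≤ k ≤ n−1 and S_{n−1} = (0,0)) ≥ c · n^{−p−1} for all sufficiently large n. -/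

import Mathlib

attribute [local instance] Classical.propDecidable

noncomputable section

/-- `θ` as a polynomial in `γ`. -/
def sbθ (γ : ℝ) : ℝ := -7 + 18*γ - 14*γ^2 + 11*γ^3 - 3*γ^4

/-- `α` as a polynomial in `γ`. -/
def sbα (γ : ℝ) : ℝ := 36/11 - (83/11)*γ + (61/11)*γ^2 - 4*γ^3 + (12/11)*γ^4

/-- The reversed step distribution `←μ_Sb`:
`(i,0) ↦ αγ^i` for `i ≥ 1`, `(0,-1) ↦ αθ⁻¹` and `(-1,i) ↦ αγ⁻¹θ^i` for `i ≥ 0`. -/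
def revWSb (γ : ℝ) (d : ℤ × ℤ) : ℝ :=
  if 0 < d.1 ∧ d.2 = 0 then sbα γ * γ ^ d.1.toNat
  else if d = (0, -1) then sbα γ * (sbθ γ)⁻¹
  else if d.1 = -1 ∧ 0 ≤ d.2 then sbα γ * γ⁻¹ * (sbθ γ) ^ d.2.toNat
  else 0

/-- Extension of a finite tuple of increments by a dummy value. -/
def extFin {m : ℕ} (g : Fin m → ℤ × ℤ) : ℕ → ℤ × ℤ :=
  fun i => if h : i < m then g ⟨i, h⟩ else (0, 0)

/-- The walk started at `s` with increments `f`. -/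
def pathFrom (s : ℤ × ℤ) (f : ℕ → ℤ × ℤ) : ℕ → ℤ × ℤ
  | 0 => s
  | k + 1 => pathFrom s f k + f k

/-- The probability that the random walk started at `s` with i.i.d. increments of law
`←μ_Sb` has its first `n` points in the non-negative quadrant and its `n`-th point at
the origin. -/
def quadProbSb (γ : ℝ) (s : ℤ × ℤ) (n : ℕ) : ℝ :=
  ∑' g : Fin (n - 1) → ℤ × ℤ,
    if (∀ k, k ≤ n - 1 → 0 ≤ (pathFrom s (extFin g) k).1 ∧ 0 ≤ (pathFrom s (extFin g) k).2)
        ∧ pathFrom s (extFin g) (n - 1) = (0, 0)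
      then ∏ i, revWSb γ (g i) else 0

namespace SB

/-- A centered step law on `ℤ²` with covariance `(s11,s12,s22)` and all moments. -/
structure Law (μ : ℤ × ℤ → ℝ) (s11 s12 s22 : ℝ) : Prop where
  nonneg : ∀ d, 0 ≤ μ d
  mass : HasSum μ 1
  mean1 : HasSum (fun d => μ d * (d.1 : ℝ)) 0
  mean2 : HasSum (fun d => μ d * (d.2 : ℝ)) 0
  var1 : HasSum (fun d => μ d * (d.1 : ℝ) ^ 2) s11
  cov : HasSum (fun d => μ d * ((d.1 : ℝ) * (d.2 : ℝ))) s12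
  var2 : HasSum (fun d => μ d * (d.2 : ℝ) ^ 2) s22
  mom : ∀ N : ℕ, Summable (fun d => μ d * (|(d.1 : ℝ)| + |(d.2 : ℝ)|) ^ N)

theorem Law.neg {μ : ℤ × ℤ → ℝ} {s11 s12 s22 : ℝ} (h : Law μ s11 s12 s22) :
    Law (fun d => μ (-d)) s11 s12 s22 := by
  have key : ∀ (f : ℤ × ℤ → ℝ) (a : ℝ), HasSum (fun d => μ d * f d) a →
      HasSum (fun d => μ (-d) * f (-d)) a := fun f a hf =>
    (Equiv.neg (ℤ × ℤ)).hasSum_iff.2 hf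
  constructor
  · exact fun d => h.nonneg _
  · exact (Equiv.neg (ℤ × ℤ)).hasSum_iff.2 h.mass
  · have := (key _ _ h.mean1).neg
    simpa using this
  · have := (key _ _ h.mean2).neg
    simpa using this
  · simpa using key _ _ h.var1
  · simpa using key _ _ h.cov
  · simpa using key _ _ h.var2
  · intro N
    have := key _ _ (h.mom N).hasSum
    simpa using this.summable

/-- three family sum -/
theorem hasSum_three {F : ℤ × ℤ → ℝ} {A C : ℝ}
    (h0 : ∀ d : ℤ × ℤ, ¬ (0 < d.1 ∧ d.2 = 0) → d ≠ (0, -1) → ¬ (d.1 = -1 ∧ 0 ≤ d.2) → F d = 0)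
    (hA : HasSum (fun i : ℕ => F ((i : ℤ) + 1, 0)) A)
    (hC : HasSum (fun i : ℕ => F (-1, (i : ℤ))) C) : HasSum F (A + F (0, -1) + C) := by
  have i1 : Function.Injective (fun i : ℕ => (((i : ℤ) + 1, 0) : ℤ × ℤ)) := by
    intro a b h; simpa using h
  have i2 : Function.Injective (fun i : ℕ => ((-1, (i : ℤ)) : ℤ × ℤ)) := by
    intro a b h; simpa using h
  have H1 : HasSum (fun d : ℤ × ℤ => if 0 < d.1 ∧ d.2 = 0 then F d else 0) A := by
    rw [← i1.hasSum_iff]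
    · refine hA.congr_fun ?_ |> fun h => h
      intro i
      have : (0 : ℤ) < (i : ℤ) + 1 := by positivity
      simp [this]
    · rintro ⟨x, y⟩ hx
      rw [if_neg]
      rintro ⟨h1, h2⟩
      apply hx
      refine ⟨(x - 1).toNat, ?_⟩
      simp only at h1 h2
      ext
      · simp; omega
      · simp [h2]
  have H2 : HasSum (fun d : ℤ × ℤ => if d = (0, -1) then F d else 0) (F (0, -1)) := by
    have := hasSum_ite_eq ((0, -1) : ℤ × ℤ) (F (0, -1))
    refine this.congr_fun ?_ |> fun h => h
    intro d
    by_cases h : d = (0, -1) <;> simp [h]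
  have H3 : HasSum (fun d : ℤ × ℤ => if d.1 = -1 ∧ 0 ≤ d.2 then F d else 0) C := by
    rw [← i2.hasSum_iff]
    · refine hC.congr_fun ?_ |> fun h => h
      intro i
      simp
    · rintro ⟨x, y⟩ hx
      rw [if_neg]
      rintro ⟨h1, h2⟩
      apply hx
      refine ⟨y.toNat, ?_⟩
      simp only at h1 h2
      ext
      · simp [h1]
      · simp [h2]
  refine ((H1.add H2).add H3).congr_fun ?_ |> fun h => h
  rintro ⟨x, y⟩
  by_cases c1 : 0 < x ∧ y = 0
  · have : ¬ (x = -1 ∧ 0 ≤ y) := by omega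
    have h2 : ((x, y) : ℤ × ℤ) ≠ (0, -1) := by simp; omega
    simp [c1, this, h2]
    intro h; omega
  · by_cases c2 : ((x, y) : ℤ × ℤ) = (0, -1)
    · simp at c2
      simp [c2]
    · by_cases c3 : x = -1 ∧ 0 ≤ y
      · simp only [if_neg c1, if_neg c2, if_pos c3]; simp
      · simp only [if_neg c1, if_neg c2, if_neg c3]
        rw [h0 _ c1 c2 c3]; simp

end SB

namespace SB

theorem gam_bounds {γ : ℝ} (hγ : γ^3 - γ^2 + 2*γ - 1 = 0) : 14/25 < γ ∧ γ < 29/50 := by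
  constructor
  · by_contra h
    push Not at h
    nlinarith [sq_nonneg γ, sq_nonneg (γ - 14/25), sq_nonneg (γ + 14/25), mul_nonneg (sub_nonneg.2 h) (sq_nonneg (γ - 1/5))]
  · by_contra h
    push Not at h
    nlinarith [sq_nonneg γ, sq_nonneg (γ - 14/25), sq_nonneg (γ + 14/25), mul_nonneg (sub_nonneg.2 h) (sq_nonneg (γ - 1/5))]

theorem theta_eq {γ : ℝ} (hγ : γ^3 - γ^2 + 2*γ - 1 = 0) : sbθ γ = 1 - γ := by
  unfold sbθ
  linear_combination (-3 * γ + 8) * hγ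

theorem alpha_eq {γ : ℝ} (hγ : γ^3 - γ^2 + 2*γ - 1 = 0) :
    sbα γ = (4 - 7 * γ + 5 * γ^2) / 11 := by
  unfold sbα
  linear_combination (12/11 * γ - 32/11) * hγ

theorem alpha_pos {γ : ℝ} (hγ : γ^3 - γ^2 + 2*γ - 1 = 0) : 0 < sbα γ := by
  rw [alpha_eq hγ]
  nlinarith [sq_nonneg (γ - 7/10)]

theorem rev1 {γ : ℝ} (i : ℕ) : revWSb γ ((i : ℤ) + 1, 0) = sbα γ * γ ^ (i + 1) := by
  have : (0 : ℤ) < (i : ℤ) + 1 := by positivity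
  have h2 : ((i : ℤ) + 1).toNat = i + 1 := by omega
  simp [revWSb, this, h2]

theorem rev2 {γ : ℝ} : revWSb γ (0, -1) = sbα γ * (sbθ γ)⁻¹ := by
  simp [revWSb]

theorem rev3 {γ : ℝ} (i : ℕ) : revWSb γ (-1, (i : ℤ)) = sbα γ * γ⁻¹ * (sbθ γ) ^ i := by
  simp [revWSb]

theorem rev0 {γ : ℝ} (d : ℤ × ℤ) (h1 : ¬ (0 < d.1 ∧ d.2 = 0)) (h2 : d ≠ (0, -1))
    (h3 : ¬ (d.1 = -1 ∧ 0 ≤ d.2)) : revWSb γ d = 0 := by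
  rw [revWSb, if_neg h1, if_neg h2, if_neg h3]

theorem rev_nonneg {γ : ℝ} (hγ : γ^3 - γ^2 + 2*γ - 1 = 0) (d : ℤ × ℤ) : 0 ≤ revWSb γ d := by
  have h1 := gam_bounds hγ
  have h2 := alpha_pos hγ
  have h3 : 0 < sbθ γ := by rw [theta_eq hγ]; linarith
  have h4 : 0 < γ := by linarith
  unfold revWSb
  split_ifs <;> positivity

/-- sums against the step law -/
theorem hasSum_rev {γ : ℝ} {f : ℤ × ℤ → ℝ} {A C : ℝ}
    (hA : HasSum (fun i : ℕ => γ ^ (i + 1) * f ((i : ℤ) + 1, 0)) A)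
    (hC : HasSum (fun i : ℕ => (sbθ γ) ^ i * f (-1, (i : ℤ))) C) :
    HasSum (fun d => revWSb γ d * f d)
      (sbα γ * A + sbα γ * (sbθ γ)⁻¹ * f (0, -1) + sbα γ * γ⁻¹ * C) := by
  have := hasSum_three (F := fun d => revWSb γ d * f d) (A := sbα γ * A) (C := sbα γ * γ⁻¹ * C)
    (by intro d h1 h2 h3; simp [rev0 d h1 h2 h3])
    (by
      have := hA.mul_left (sbα γ)
      refine this.congr_fun ?_
      intro i; rw [rev1]; ring)
    (by
      have := hC.mul_left (sbα γ * γ⁻¹)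
      refine this.congr_fun ?_
      intro i; rw [rev3]; ring)
  rwa [rev2] at this

theorem geo {r : ℝ} (hr : ‖r‖ < 1) : HasSum (fun i : ℕ => r ^ i) (1 - r)⁻¹ :=
  hasSum_geometric_of_norm_lt_one hr

theorem geo1 {r : ℝ} (hr : ‖r‖ < 1) : HasSum (fun i : ℕ => r ^ i * (i : ℝ)) (r / (1 - r) ^ 2) := by
  have h := hasSum_coe_mul_geometric_of_norm_lt_one hr
  have e : (fun i : ℕ => r ^ i * (i : ℝ)) = fun i : ℕ => (i : ℝ) * r ^ i := by
    funext i; ring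
  rw [e]; exact h

theorem geoS {r : ℝ} (hr0 : 0 < r) (hr : ‖r‖ < 1) (N : ℕ) :
    Summable (fun i : ℕ => r ^ i * ((i : ℝ) + 1) ^ N) := by
  have h0 : Summable (fun i : ℕ => (i : ℝ) ^ N * r ^ i) :=
    summable_pow_mul_geometric_of_norm_lt_one N hr
  have h := (summable_nat_add_iff (f := fun i : ℕ => (i : ℝ) ^ N * r ^ i) 1).2 h0
  have h2 := h.mul_left r⁻¹
  have e : (fun i : ℕ => r ^ i * ((i : ℝ) + 1) ^ N)
      = fun i : ℕ => r⁻¹ * (((i + 1 : ℕ) : ℝ) ^ N * r ^ (i + 1)) := by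
    funext i
    push_cast
    have : r⁻¹ * r = 1 := inv_mul_cancel₀ hr0.ne'
    rw [pow_succ]
    linear_combination (- ((i : ℝ) + 1) ^ N * r ^ i) * this
  rw [e]; exact h2

theorem geoS' {r : ℝ} (hr0 : 0 < r) (hr : ‖r‖ < 1) (N : ℕ) :
    Summable (fun i : ℕ => r ^ (i + 1) * ((i : ℝ) + 1) ^ N) := by
  have e : (fun i : ℕ => r ^ (i + 1) * ((i : ℝ) + 1) ^ N)
      = fun i : ℕ => r * (r ^ i * ((i : ℝ) + 1) ^ N) := by
    funext i; ring
  rw [e]; exact (geoS hr0 hr N).mul_left r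

theorem geoS0 {r : ℝ} (hr : ‖r‖ < 1) (N : ℕ) : Summable (fun i : ℕ => r ^ i * (i : ℝ) ^ N) := by
  have e : (fun i : ℕ => r ^ i * (i : ℝ) ^ N) = fun i : ℕ => (i : ℝ) ^ N * r ^ i := by
    funext i; ring
  rw [e]; exact summable_pow_mul_geometric_of_norm_lt_one N hr

theorem geoA {r : ℝ} (hr : ‖r‖ < 1) : HasSum (fun i : ℕ => r ^ (i + 1)) (r * (1 - r)⁻¹) := by
  have e : (fun i : ℕ => r ^ (i + 1)) = fun i : ℕ => r * r ^ i := by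
    funext i; ring
  rw [e]; exact (geo hr).mul_left r

theorem geoA1 {r : ℝ} (hr : ‖r‖ < 1) :
    HasSum (fun i : ℕ => r ^ (i + 1) * ((i : ℝ) + 1)) (r / (1 - r) ^ 2) := by
  have h := (hasSum_nat_add_iff' (f := fun i : ℕ => r ^ i * (i : ℝ)) 1).2 (geo1 hr)
  simp only [Finset.sum_range_one, Nat.cast_zero, mul_zero, sub_zero] at h
  have e : (fun i : ℕ => r ^ (i + 1) * ((i : ℝ) + 1)) =
      fun i : ℕ => r ^ (i + 1) * (((i + 1 : ℕ)) : ℝ) := by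
    funext i; push_cast; ring
  rw [e]; exact h

set_option maxHeartbeats 1000000 in
theorem law_rev {γ : ℝ} (hγ : γ^3 - γ^2 + 2*γ - 1 = 0) :
    ∃ s11 s12 s22 : ℝ, Law (revWSb γ) s11 s12 s22 ∧ 0 < s11 ∧ 0 < s22 ∧ s12 < 0 ∧
      s12 ^ 2 < s11 * s22 := by
  obtain ⟨g1, g2⟩ := gam_bounds hγ
  have hα := alpha_pos hγ
  have hθ := theta_eq hγ
  have hθ0 : 0 < sbθ γ := by rw [hθ]; linarith
  have hθ1 : ‖sbθ γ‖ < 1 := by rw [Real.norm_of_nonneg hθ0.le, hθ]; linarith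
  have hγ0 : 0 < γ := by linarith
  have hγ1 : ‖γ‖ < 1 := by rw [Real.norm_of_nonneg hγ0.le]; linarith
  have h1γ : (1 - γ) ≠ 0 := by linarith
  -- second moments
  obtain ⟨A2, hA2⟩ := geoS' hγ0 hγ1 2
  obtain ⟨C2, hC2⟩ := geoS0 hθ1 2
  have A2nn : 0 ≤ A2 := hA2.nonneg (fun i => by positivity)
  have C2nn : 0 ≤ C2 := hC2.nonneg (fun i => by positivity)
  have v1 := hasSum_rev (γ := γ) (f := fun d => (d.1 : ℝ) ^ 2) (A := A2) (C := (1 - sbθ γ)⁻¹)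
    (by simpa using hA2) (by simpa using geo hθ1)
  have v2 := hasSum_rev (γ := γ) (f := fun d => (d.2 : ℝ) ^ 2) (A := 0) (C := C2)
    (by simpa using hasSum_zero) (by simpa using hC2)
  have cv := hasSum_rev (γ := γ) (f := fun d => (d.1 : ℝ) * (d.2 : ℝ)) (A := 0)
    (C := -(sbθ γ / (1 - sbθ γ) ^ 2))
    (by simpa using hasSum_zero) (by simpa using (geo1 hθ1).neg)
  refine ⟨_, _, _, ⟨rev_nonneg hγ, ?_, ?_, ?_, v1, cv, v2, ?_⟩, ?_, ?_, ?_, ?_⟩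
  · have := hasSum_rev (γ := γ) (f := fun _ => 1) (by simpa using geoA hγ1) (by simpa using geo hθ1)
    convert this using 1
    · simp
    · rw [hθ, alpha_eq hγ, sub_sub_cancel]; field_simp
      linear_combination -(5 * γ^2 + 3 * γ - 4) * hγ
  · have := hasSum_rev (γ := γ) (f := fun d => (d.1 : ℝ)) (by simpa using geoA1 hγ1)
      (by simpa using (geo hθ1).neg)
    convert this using 1
    rw [hθ, sub_sub_cancel]; simp; field_simp
    linear_combination -(sbα γ) * hγ
  · have := hasSum_rev (γ := γ) (f := fun d => (d.2 : ℝ)) (A := 0) (by simpa using hasSum_zero)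
      (by simpa using (geo1 hθ1))
    convert this using 1
    rw [hθ, sub_sub_cancel]; simp; field_simp
    linear_combination (sbα γ) * hγ
  · intro N
    obtain ⟨a, ha⟩ := geoS' hγ0 hγ1 N
    obtain ⟨c, hc⟩ := geoS hθ0 hθ1 N
    refine (hasSum_rev (γ := γ) (f := fun d => (|(d.1 : ℝ)| + |(d.2 : ℝ)|) ^ N) (A := a) (C := c) ?_ ?_).summable
    · refine ha.congr_fun ?_
      intro i
      have : (0 : ℝ) ≤ (i : ℝ) + 1 := by positivity
      simp [abs_of_nonneg this]
    · refine hc.congr_fun ?_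
      intro i
      simp [add_comm]
  · simp only [hθ] at *
    have : 0 < γ⁻¹ := by positivity
    have h2 : 0 < (1 - (1 - γ))⁻¹ := by rw [sub_sub_cancel]; exact this
    have : 0 < sbα γ * γ⁻¹ * (1 - (1 - γ))⁻¹ := by positivity
    simp
    positivity
  · simp
    positivity
  · rw [hθ]
    have : 0 < sbα γ * γ⁻¹ * ((1 - γ) / (1 - (1 - γ)) ^ 2) := by
      have : 0 < 1 - γ := by linarith
      rw [sub_sub_cancel]; positivity
    simp
    simp at this
    linarith
  · rw [hθ]
    have e1 : 0 < 1 - γ := by linarith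
    have key : (1 - γ)^3 < γ^4 := by
      nlinarith [sq_nonneg γ, sq_nonneg (γ-1), mul_pos hγ0 e1]
    simp
    have lo1 : sbα γ * γ⁻¹ * γ⁻¹ ≤ sbα γ * A2 + sbα γ * γ⁻¹ * γ⁻¹ := by
      have := mul_nonneg hα.le A2nn; linarith
    have lo2 : sbα γ * (1 - γ)⁻¹ ≤ sbα γ * (1 - γ)⁻¹ + sbα γ * γ⁻¹ * C2 := by
      have : 0 ≤ sbα γ * γ⁻¹ * C2 := by positivity
      linarith
    refine lt_of_lt_of_le ?_ (mul_le_mul lo1 lo2 (by positivity) (by positivity))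
    have e2 : (sbα γ * γ⁻¹ * ((1 - γ) / γ ^ 2)) ^ 2 = sbα γ ^ 2 * ((1 - γ)^3 / (γ^6 * (1 - γ))) := by
      field_simp
    have e3 : sbα γ * γ⁻¹ * γ⁻¹ * (sbα γ * (1 - γ)⁻¹) = sbα γ ^ 2 * (γ^4 / (γ^6 * (1 - γ))) := by
      field_simp
    rw [e2, e3]
    gcongr

end SB

namespace SB
open scoped ENNReal

/-- powers of a kernel -/
def pw {S : Type} (K : S → S → ℝ≥0∞) : ℕ → S → S → ℝ≥0∞
  | 0 => fun x y => if x = y then 1 else 0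
  | n + 1 => fun x y => ∑' z, K x z * pw K n z y

/-- expectation operator of the `n`-th power -/
def ex {S : Type} (K : S → S → ℝ≥0∞) (n : ℕ) (f : S → ℝ≥0∞) (x : S) : ℝ≥0∞ :=
  ∑' y, pw K n x y * f y

section
variable {S : Type} (K : S → S → ℝ≥0∞)

theorem tsum_ite_mul (x : S) (f : S → ℝ≥0∞) : ∑' y, (if x = y then (1 : ℝ≥0∞) else 0) * f y = f x := by
  rw [tsum_eq_single x]
  · simp
  · intro y hy; simp [hy.symm]

theorem ex_zero (f : S → ℝ≥0∞) (x : S) : ex K 0 f x = f x := tsum_ite_mul x f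

theorem ex_succ (n : ℕ) (f : S → ℝ≥0∞) (x : S) :
    ex K (n + 1) f x = ∑' z, K x z * ex K n f z := by
  unfold ex
  simp only [pw, ← ENNReal.tsum_mul_left, ← ENNReal.tsum_mul_right]
  rw [ENNReal.tsum_comm]
  simp only [mul_assoc]

theorem ex_one (f : S → ℝ≥0∞) (x : S) : ex K 1 f x = ∑' z, K x z * f z := by
  rw [ex_succ]; simp only [ex_zero]

theorem ex_add (m n : ℕ) (f : S → ℝ≥0∞) (x : S) : ex K (m + n) f x = ex K m (ex K n f) x := by
  induction m generalizing x with
  | zero => rw [ex_zero, Nat.zero_add]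
  | succ m ih =>
    rw [show m + 1 + n = (m + n) + 1 by ring, ex_succ, ex_succ]
    simp only [ih]

theorem pw_eq_ex (n : ℕ) (x y : S) : pw K n x y = ex K n (fun z => if y = z then 1 else 0) x := by
  unfold ex
  rw [tsum_eq_single y]
  · simp
  · intro z hz; simp [hz.symm]

theorem pw_add (m n : ℕ) (x y : S) : pw K (m + n) x y = ∑' z, pw K m x z * pw K n z y := by
  rw [pw_eq_ex, ex_add]
  unfold ex
  refine tsum_congr fun z => ?_
  rw [pw_eq_ex K n z y]; rfl

theorem pw_one (x y : S) : pw K 1 x y = K x y := by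
  rw [pw_eq_ex, ex_one, tsum_eq_single y]
  · simp
  · intro z hz; simp [hz.symm]

theorem pw_tr (n : ℕ) (x y : S) : pw (fun a b => K b a) n x y = pw K n y x := by
  induction n generalizing x y with
  | zero => simp [pw, eq_comm]
  | succ n ih =>
    rw [pw_add K n 1]
    simp only [pw, ih]
    refine tsum_congr fun z => ?_
    rw [← pw_one K z x, mul_comm]; rfl

theorem ex_mono (n : ℕ) {f g : S → ℝ≥0∞} (h : ∀ y, f y ≤ g y) (x : S) : ex K n f x ≤ ex K n g x :=
  ENNReal.tsum_le_tsum fun y => by gcongr; exact h y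

theorem ex_addf (n : ℕ) (f g : S → ℝ≥0∞) (x : S) :
    ex K n (fun y => f y + g y) x = ex K n f x + ex K n g x := by
  unfold ex; rw [← ENNReal.tsum_add]; simp only [mul_add]

theorem ex_mul (n : ℕ) (c : ℝ≥0∞) (f : S → ℝ≥0∞) (x : S) :
    ex K n (fun y => c * f y) x = c * ex K n f x := by
  unfold ex; rw [← ENNReal.tsum_mul_left]
  refine tsum_congr fun y => by ring

theorem ex_super {f : S → ℝ≥0∞} (h : ∀ x, ∑' z, K x z * f z ≤ f x) (n : ℕ) (x : S) :
    ex K n f x ≤ f x := by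
  induction n with
  | zero => rw [ex_zero]
  | succ n ih =>
    rw [ex_add]
    refine (ex_mono K n ?_ x).trans ih
    intro y; rw [ex_one]; exact h y

theorem ex_sub {f : S → ℝ≥0∞} (h : ∀ x, f x ≤ ∑' z, K x z * f z) (n : ℕ) (x : S) :
    f x ≤ ex K n f x := by
  induction n with
  | zero => rw [ex_zero]
  | succ n ih =>
    rw [ex_add]
    refine ih.trans (ex_mono K n ?_ x)
    intro y; rw [ex_one]; exact h y

/-- survival -/
def sv (n : ℕ) (x : S) : ℝ≥0∞ := ex K n (fun _ => 1) x

theorem sv_def (n : ℕ) (x : S) : sv K n x = ∑' y, pw K n x y := by simp [sv, ex]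

theorem sv_add (m n : ℕ) (x : S) : sv K (m + n) x = ex K m (sv K n) x := ex_add K m n _ x

theorem sv_le_one (h : ∀ x, ∑' z, K x z ≤ 1) (n : ℕ) (x : S) : sv K n x ≤ 1 :=
  ex_super K (by simpa using h) n x

theorem sv_anti (h : ∀ x, ∑' z, K x z ≤ 1) {m n : ℕ} (hmn : m ≤ n) (x : S) :
    sv K n x ≤ sv K m x := by
  obtain ⟨k, rfl⟩ := Nat.exists_eq_add_of_le hmn
  rw [sv_add]
  exact ex_mono K m (fun y => sv_le_one K h k y) x

theorem pw_le_sv (n : ℕ) (x y : S) : pw K n x y ≤ sv K n x := by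
  rw [sv_def]; exact ENNReal.le_tsum y

theorem pw_mono {K' : S → S → ℝ≥0∞} (h : ∀ x y, K x y ≤ K' x y) (n : ℕ) (x y : S) :
    pw K n x y ≤ pw K' n x y := by
  induction n generalizing x with
  | zero => exact le_rfl
  | succ n ih => exact ENNReal.tsum_le_tsum fun z => mul_le_mul' (h _ _) (ih _)

theorem pw_mul_le (m n : ℕ) (x y z : S) : pw K m x y * pw K n y z ≤ pw K (m + n) x z := by
  rw [pw_add]; exact ENNReal.le_tsum (f := fun y => pw K m x y * pw K n y z) y

end

/-- the quadrant -/
def Q : Set (ℤ × ℤ) := {x | 0 ≤ x.1 ∧ 0 ≤ x.2}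

/-- free kernel -/
def kf (μ : ℤ × ℤ → ℝ) (x y : ℤ × ℤ) : ℝ≥0∞ := ENNReal.ofReal (μ (y - x))

/-- killed kernel -/
def kq (μ : ℤ × ℤ → ℝ) (x y : ℤ × ℤ) : ℝ≥0∞ :=
  if x ∈ Q ∧ y ∈ Q then ENNReal.ofReal (μ (y - x)) else 0

theorem kq_le (μ : ℤ × ℤ → ℝ) (x y : ℤ × ℤ) : kq μ x y ≤ kf μ x y := by
  unfold kq kf; split_ifs <;> simp

theorem kq_tr (μ : ℤ × ℤ → ℝ) : kq (fun d => μ (-d)) = fun x y => kq μ y x := by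
  funext x y
  unfold kq
  simp only [neg_sub, and_comm]

theorem kf_tr (μ : ℤ × ℤ → ℝ) : kf (fun d => μ (-d)) = fun x y => kf μ y x := by
  funext x y
  unfold kf
  simp only [neg_sub]

theorem tsum_shift (x : ℤ × ℤ) (f : ℤ × ℤ → ℝ≥0∞) : ∑' z, f z = ∑' d, f (x + d) :=
  ((Equiv.addLeft x).tsum_eq f).symm

theorem kf_sum {μ : ℤ × ℤ → ℝ} {a b c : ℝ} (h : Law μ a b c) (x : ℤ × ℤ) : ∑' z, kf μ x z = 1 := by
  rw [tsum_shift x]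
  simp only [kf, add_sub_cancel_left]
  rw [← ENNReal.ofReal_tsum_of_nonneg h.nonneg h.mass.summable, h.mass.tsum_eq]
  simp

theorem kq_sum {μ : ℤ × ℤ → ℝ} {a b c : ℝ} (h : Law μ a b c) (x : ℤ × ℤ) : ∑' z, kq μ x z ≤ 1 := by
  rw [← kf_sum h x]
  exact ENNReal.tsum_le_tsum fun z => kq_le μ x z

/-- From real sums to killed kernel sums: upper bounds. -/
theorem kq_super {μ : ℤ × ℤ → ℝ} (h0 : ∀ d, 0 ≤ μ d) {x : ℤ × ℤ} (hx : x ∈ Q)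
    {f : ℤ × ℤ → ℝ} (hf : ∀ z ∈ Q, 0 ≤ f z) {B : ℝ}
    (h : HasSum (fun d => if x + d ∈ Q then μ d * f (x + d) else 0) B) :
    ∑' z, kq μ x z * ENNReal.ofReal (f z) = ENNReal.ofReal B := by
  rw [tsum_shift x, ← h.tsum_eq, ENNReal.ofReal_tsum_of_nonneg _ h.summable]
  · refine tsum_congr fun d => ?_
    unfold kq
    by_cases hd : x + d ∈ Q
    · simp [hx, hd, ENNReal.ofReal_mul (h0 d)]
    · simp [hd]
  · intro d
    split_ifs with hd
    · exact mul_nonneg (h0 d) (hf _ hd)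
    · exact le_rfl

theorem kq_out {μ : ℤ × ℤ → ℝ} {x : ℤ × ℤ} (hx : x ∉ Q) (f : ℤ × ℤ → ℝ≥0∞) :
    ∑' z, kq μ x z * f z = 0 := by
  simp [kq, hx]

theorem path_succ (s : ℤ × ℤ) (f : ℕ → ℤ × ℤ) (k : ℕ) :
    pathFrom s f (k + 1) = pathFrom (s + f 0) (fun i => f (i + 1)) k := by
  induction k with
  | zero => rfl
  | succ k ih => rw [pathFrom, ih, pathFrom]

theorem path_ext (s : ℤ × ℤ) {m : ℕ} (d : ℤ × ℤ) (g : Fin m → ℤ × ℤ) (k : ℕ) :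
    pathFrom s (extFin (Fin.cons d g : Fin (m + 1) → ℤ × ℤ)) (k + 1)
      = pathFrom (s + d) (extFin g) k := by
  rw [path_succ]
  congr 1
  funext i
  by_cases hi : i < m
  · have : i + 1 < m + 1 := by omega
    simp only [extFin, dif_pos hi, dif_pos this]
    exact Fin.cons_succ (α := fun _ => ℤ × ℤ) d g ⟨i, hi⟩
  · have : ¬ i + 1 < m + 1 := by omega
    simp only [extFin, dif_neg hi, dif_neg this]

theorem link_aux {μ : ℤ × ℤ → ℝ} (h0 : ∀ d, 0 ≤ μ d) (m : ℕ) (s : ℤ × ℤ) :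
    ∑' g : Fin m → ℤ × ℤ, ENNReal.ofReal (if (∀ k, k ≤ m → 0 ≤ (pathFrom s (extFin g) k).1
        ∧ 0 ≤ (pathFrom s (extFin g) k).2) ∧ pathFrom s (extFin g) m = (0, 0)
      then ∏ i, μ (g i) else 0) = if s ∈ Q then pw (kq μ) m s (0, 0) else 0 := by
  induction m generalizing s with
  | zero =>
    rw [tsum_eq_single default (by intro b hb; exact absurd (Subsingleton.elim _ _) hb)]
    simp only [pathFrom, nonpos_iff_eq_zero, forall_eq, pw]
    by_cases hs : s = (0, 0)
    · simp [hs, Q]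
    · simp [hs]
  | succ m ih =>
    rw [← (Fin.consEquiv (fun _ : Fin (m + 1) => ℤ × ℤ)).tsum_eq, ENNReal.tsum_prod']
    by_cases hs : s ∈ Q
    · rw [if_pos hs]
      simp only [pw]
      rw [tsum_shift s (fun z => kq μ s z * pw (kq μ) m z (0, 0))]
      refine tsum_congr fun d => ?_
      have e : kq μ s (s + d) * pw (kq μ) m (s + d) (0, 0)
          = ENNReal.ofReal (μ d) * (if s + d ∈ Q then pw (kq μ) m (s + d) (0, 0) else 0) := by
        unfold kq
        by_cases hd : s + d ∈ Q <;> simp [hs, hd]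
      rw [e, ← ih, ← ENNReal.tsum_mul_left]
      refine tsum_congr fun g => ?_
      rw [← ENNReal.ofReal_mul (h0 d)]
      congr 1
      simp only [Fin.consEquiv, Equiv.coe_fn_mk, path_ext, Fin.prod_univ_succ, Fin.cons_zero,
        Fin.cons_succ, mul_ite, mul_zero]
      congr 1
      apply propext
      refine and_congr_left fun _ => ?_
      constructor
      · intro H k hk
        have := H (k + 1) (by omega)
        rwa [path_ext] at this
      · intro H k hk
        rcases k with _ | k
        · exact hs
        · rw [path_ext]; exact H k (by omega)
    · rw [if_neg hs]
      simp only [ENNReal.tsum_eq_zero]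
      intro d g
      rw [if_neg]
      · simp
      · rintro ⟨H, _⟩
        exact hs (H 0 (by omega))

theorem link {γ : ℝ} (hγ : γ^3 - γ^2 + 2*γ - 1 = 0) (s : ℤ × ℤ) (hs : s ∈ Q) (n : ℕ) :
    quadProbSb γ s n = (pw (kq (revWSb γ)) (n - 1) s (0, 0)).toReal := by
  have := link_aux (rev_nonneg hγ) (n - 1) s
  rw [if_pos hs] at this
  rw [← this, ENNReal.tsum_toReal_eq (fun _ => ENNReal.ofReal_ne_top)]
  unfold quadProbSb
  refine tsum_congr fun g => ?_
  rw [ENNReal.toReal_ofReal]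
  split_ifs
  · exact Finset.prod_nonneg fun i _ => rev_nonneg hγ _
  · exact le_rfl

end SB

namespace SB
open Complex ComplexConjugate

theorem choose_two_C (a : ℂ) : Ring.choose a 2 = a * (a - 1) / 2 := by
  rw [Ring.choose_eq_smul, descPochhammer_succ_right, descPochhammer_one]
  simp [Polynomial.smeval_mul, Polynomial.smeval_sub, Polynomial.smeval_X, Polynomial.smeval_one]
  ring

theorem tay1 (s : ℝ) : ∃ C : ℝ, 0 < C ∧ ∀ η : ℂ, ‖η‖ ≤ 1/2 →
    ‖(1 + η) ^ (s : ℂ) - (1 + s * η + s * (s - 1) / 2 * η ^ 2)‖ ≤ C * ‖η‖ ^ 3 := by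
  have h := Complex.one_add_cpow_hasFPowerSeriesOnBall_zero (a := (s : ℂ))
  obtain ⟨a, ha, C, hC, H⟩ := h.uniform_geometric_approx' (r' := 3/4) (by
    rw [← ENNReal.coe_one, ENNReal.coe_lt_coe]
    rw [div_lt_one (by norm_num)]; norm_num)
  refine ⟨C * (4/3)^3, by positivity, fun η hη => ?_⟩
  have := H η (by
    rw [Metric.mem_ball, dist_zero_right]
    push_cast
    linarith) 3
  have e : (binomialSeries ℂ (s : ℂ)).partialSum 3 η = 1 + s * η + s * (s - 1) / 2 * η ^ 2 := by
    simp only [FormalMultilinearSeries.partialSum, Finset.sum_range_succ, Finset.sum_range_zero,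
      binomialSeries_apply, choose_two_C, Ring.choose_zero_right, Ring.choose_one_right,
      smul_eq_mul, List.ofFn_const, List.prod_replicate]
    ring
  rw [e, zero_add] at this
  refine this.trans ?_
  have e2 : a * (‖η‖ / ((3/4 : NNReal) : ℝ)) = a * (4/3) * ‖η‖ := by push_cast; ring
  rw [e2, mul_pow, mul_pow]
  have : a ^ 3 ≤ 1 := pow_le_one₀ ha.1.le ha.2.le
  have h3 : 0 ≤ C * (4/3)^3 * ‖η‖^3 := by positivity
  nlinarith

/-- quadratic Taylor polynomial -/
def TT (s t : ℝ) (η : ℂ) : ℂ :=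
  s * η + t * conj η + s * (s - 1) / 2 * η ^ 2 + t * (t - 1) / 2 * (conj η) ^ 2
    + s * t * (η * conj η)

theorem TT_le (s t : ℝ) : ∃ C : ℝ, 0 < C ∧ ∀ η : ℂ, ‖TT s t η‖ ≤ C * (‖η‖ + ‖η‖ ^ 2) := by
  refine ⟨|s| + |t| + ‖(s * (s - 1) / 2 : ℂ)‖ + ‖(t * (t - 1) / 2 : ℂ)‖ + |s * t| + 1, by positivity,
    fun η => ?_⟩
  have h1 : ‖(s : ℂ) * η‖ = |s| * ‖η‖ := by simp
  have h2 : ‖(t : ℂ) * conj η‖ = |t| * ‖η‖ := by simp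
  have h3 : ‖(s * (s - 1) / 2 : ℂ) * η ^ 2‖ = ‖(s * (s - 1) / 2 : ℂ)‖ * ‖η‖ ^ 2 := by
    rw [norm_mul, norm_pow]
  have h4 : ‖(t * (t - 1) / 2 : ℂ) * (conj η) ^ 2‖ = ‖(t * (t - 1) / 2 : ℂ)‖ * ‖η‖ ^ 2 := by
    rw [norm_mul, norm_pow, Complex.norm_conj]
  have h5 : ‖(s : ℂ) * t * (η * conj η)‖ = |s * t| * ‖η‖ ^ 2 := by
    rw [norm_mul, norm_mul, norm_mul, Complex.norm_conj, Complex.norm_real, Complex.norm_real, Real.norm_eq_abs, Real.norm_eq_abs, abs_mul]; ring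
  unfold TT
  refine (norm_add_le _ _).trans ?_
  refine (add_le_add_left (norm_add_le _ _) _).trans ?_
  refine (add_le_add_left (add_le_add_left (norm_add_le _ _) _) _).trans ?_
  refine (add_le_add_left (add_le_add_left (add_le_add_left (norm_add_le _ _) _) _) _).trans ?_
  rw [h1, h2, h3, h4, h5]
  have n0 := norm_nonneg η
  have n1 := abs_nonneg s
  have n2 := abs_nonneg t
  have n3 := norm_nonneg (s * (s - 1) / 2 : ℂ)
  have n4 := norm_nonneg (t * (t - 1) / 2 : ℂ)
  have n5 := abs_nonneg (s * t)
  have n6 : 0 ≤ ‖η‖ ^ 2 := by positivity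
  have := mul_nonneg n1 n6
  have := mul_nonneg n2 n6
  have := mul_nonneg n3 n0
  have := mul_nonneg n4 n0
  have := mul_nonneg n5 n0
  nlinarith

theorem tay2 (s t : ℝ) : ∃ C : ℝ, 0 < C ∧ ∀ η : ℂ, ‖η‖ ≤ 1/2 →
    ‖(1 + η) ^ (s : ℂ) * conj ((1 + η) ^ (t : ℂ)) - 1 - TT s t η‖ ≤ C * ‖η‖ ^ 3 := by
  obtain ⟨C1, hC1, H1⟩ := tay1 s
  obtain ⟨C2, hC2, H2⟩ := tay1 t
  set a1 : ℂ := (s : ℂ) with ha1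
  set a2 : ℂ := (s : ℂ) * (s - 1) / 2 with ha2
  set b1 : ℂ := (t : ℂ) with hb1
  set b2 : ℂ := (t : ℂ) * (t - 1) / 2 with hb2
  have cb1 : conj b1 = b1 := by simp [hb1]
  have cb2 : conj b2 = b2 := by
    have : b2 = ((t * (t - 1) / 2 : ℝ) : ℂ) := by rw [hb2]; push_cast; ring
    rw [this, Complex.conj_ofReal]
  refine ⟨‖a1 * b2‖ + ‖a2 * b1‖ + ‖a2 * b2‖ + (1 + ‖a1‖ + ‖a2‖) * C2 + C1 * (1 + ‖b1‖ + ‖b2‖) + C1 * C2,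
    by positivity, fun η hη => ?_⟩
  have h1 := H1 η hη
  have h2 := H2 η hη
  rw [← Complex.norm_conj, map_sub] at h2
  set A := (1 + η) ^ (s : ℂ)
  set B := conj ((1 + η) ^ (t : ℂ))
  set y := conj η with hy
  have ny : ‖y‖ = ‖η‖ := by simp [hy]
  have e1 : conj (1 + b1 * η + b2 * η ^ 2) = 1 + b1 * y + b2 * y ^ 2 := by
    simp [cb1, cb2, hy]
  rw [e1] at h2
  set Ra := A - (1 + a1 * η + a2 * η ^ 2) with hRa
  set Rb := B - (1 + b1 * y + b2 * y ^ 2) with hRb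
  have e : A * B - 1 - TT s t η = a1 * b2 * (η * y ^ 2) + a2 * b1 * (η ^ 2 * y)
      + a2 * b2 * (η ^ 2 * y ^ 2) + (1 + a1 * η + a2 * η ^ 2) * Rb
      + Ra * (1 + b1 * y + b2 * y ^ 2) + Ra * Rb := by
    unfold TT
    rw [hRa, hRb, ← ha1, ← ha2, ← hb1, ← hb2, ← hy]
    ring
  rw [e]
  have n0 := norm_nonneg η
  have hx1 : ‖η‖ ≤ 1 := by linarith
  have hx2 : ‖η‖ ^ 2 ≤ 1 := pow_le_one₀ n0 hx1
  have k1 : ‖a1 * b2 * (η * y ^ 2)‖ ≤ ‖a1 * b2‖ * ‖η‖ ^ 3 := by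
    rw [norm_mul (a1 * b2), norm_mul η, norm_pow, ny]; apply le_of_eq; ring
  have k2 : ‖a2 * b1 * (η ^ 2 * y)‖ ≤ ‖a2 * b1‖ * ‖η‖ ^ 3 := by
    rw [norm_mul (a2 * b1), norm_mul (η ^ 2), norm_pow, ny]; apply le_of_eq; ring
  have k3 : ‖a2 * b2 * (η ^ 2 * y ^ 2)‖ ≤ ‖a2 * b2‖ * ‖η‖ ^ 3 := by
    rw [norm_mul (a2 * b2), norm_mul (η ^ 2), norm_pow, norm_pow, ny]
    gcongr
    nlinarith [pow_nonneg n0 3]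
  have p1 : ‖1 + a1 * η + a2 * η ^ 2‖ ≤ 1 + ‖a1‖ + ‖a2‖ := by
    refine (norm_add₃_le).trans ?_
    rw [norm_one, norm_mul, norm_mul, norm_pow]
    gcongr
    · exact mul_le_of_le_one_right (norm_nonneg _) hx1
    · exact mul_le_of_le_one_right (norm_nonneg _) hx2
  have p2 : ‖1 + b1 * y + b2 * y ^ 2‖ ≤ 1 + ‖b1‖ + ‖b2‖ := by
    refine (norm_add₃_le).trans ?_
    rw [norm_one, norm_mul, norm_mul, norm_pow, ny]
    gcongr
    · exact mul_le_of_le_one_right (norm_nonneg _) hx1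
    · exact mul_le_of_le_one_right (norm_nonneg _) hx2
  have k4 : ‖(1 + a1 * η + a2 * η ^ 2) * Rb‖ ≤ (1 + ‖a1‖ + ‖a2‖) * C2 * ‖η‖ ^ 3 := by
    rw [norm_mul, mul_assoc]; gcongr
  have k5 : ‖Ra * (1 + b1 * y + b2 * y ^ 2)‖ ≤ C1 * (1 + ‖b1‖ + ‖b2‖) * ‖η‖ ^ 3 := by
    rw [norm_mul]
    calc _ ≤ (C1 * ‖η‖ ^ 3) * (1 + ‖b1‖ + ‖b2‖) := by gcongr
      _ = _ := by ring
  have k6 : ‖Ra * Rb‖ ≤ C1 * C2 * ‖η‖ ^ 3 := by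
    rw [norm_mul]
    calc _ ≤ (C1 * ‖η‖ ^ 3) * (C2 * ‖η‖ ^ 3) := by gcongr
      _ = C1 * C2 * ‖η‖ ^ 3 * ‖η‖ ^ 3 := by ring
      _ ≤ C1 * C2 * ‖η‖ ^ 3 * 1 := by
        gcongr; exact pow_le_one₀ n0 hx1
      _ = _ := by ring
  refine (norm_add_le _ _).trans ?_
  refine (add_le_add_left (norm_add_le _ _) _).trans ?_
  refine (add_le_add_left (add_le_add_left (norm_add_le _ _) _) _).trans ?_
  refine (add_le_add_left (add_le_add_left (add_le_add_left (norm_add₃_le) _) _) _).trans ?_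
  linarith

/-- the complex model function -/
def FF (s t : ℝ) (z : ℂ) : ℂ := z ^ (s : ℂ) * conj (z ^ (t : ℂ))

/-- the real model function -/
def G (q m : ℝ) (z : ℂ) : ℝ := ‖z‖ ^ q * Real.cos (m * arg z)

theorem FF_re {s t : ℝ} (hs : s ≠ 0) (hst : s + t ≠ 0) (z : ℂ) :
    (FF s t z).re = G (s + t) (s - t) z := by
  unfold FF G
  by_cases hz : z = 0
  · subst hz
    have : (s : ℂ) ≠ 0 := by exact_mod_cast hs
    rw [Complex.zero_cpow this]
    simp [Real.zero_rpow hst]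
  · rw [Complex.cpow_ofReal, Complex.cpow_ofReal, Real.rpow_add (norm_pos_iff.2 hz),
      show (s - t) * arg z = arg z * s - arg z * t by ring, Real.cos_sub]
    simp only [map_mul, map_add, Complex.conj_ofReal, Complex.conj_I]
    simp only [Complex.mul_re, Complex.add_re,
      Complex.ofReal_re, Complex.I_re, Complex.I_im, Complex.ofReal_im, Complex.mul_im,
      Complex.add_im, Complex.neg_re, Complex.neg_im]
    ring

theorem FF_norm {s t : ℝ} (hs : s ≠ 0) (hst : s + t ≠ 0) (z : ℂ) : ‖FF s t z‖ = ‖z‖ ^ (s + t) := by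
  unfold FF
  by_cases hz : z = 0
  · subst hz
    have : (s : ℂ) ≠ 0 := by exact_mod_cast hs
    rw [Complex.zero_cpow this]
    simp [Real.zero_rpow hst]
  · rw [norm_mul, Complex.norm_conj, Complex.norm_cpow_of_ne_zero hz,
      Complex.norm_cpow_of_ne_zero hz, Real.rpow_add (norm_pos_iff.2 hz)]
    simp

theorem cpow_mul_of {z w : ℂ} (hz : 0 < z.re) (hw : 0 < w.re) (s : ℂ) :
    (z * w) ^ s = z ^ s * w ^ s := by
  have hz0 : z ≠ 0 := by rintro rfl; simp at hz
  have hw0 : w ≠ 0 := by rintro rfl; simp at hw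
  have h1 := abs_lt.1 (Complex.abs_arg_lt_pi_div_two_iff.2 (Or.inl hz))
  have h2 := abs_lt.1 (Complex.abs_arg_lt_pi_div_two_iff.2 (Or.inl hw))
  rw [Complex.cpow_def_of_ne_zero (mul_ne_zero hz0 hw0), Complex.cpow_def_of_ne_zero hz0,
    Complex.cpow_def_of_ne_zero hw0, Complex.log_mul hz0 hw0 ⟨by linarith, by linarith⟩, add_mul,
    Complex.exp_add]

theorem FF_mul {s t : ℝ} {z w : ℂ} (hz : 0 < z.re) (hw : 0 < w.re) :
    FF s t (z * w) = FF s t z * FF s t w := by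
  unfold FF
  rw [cpow_mul_of hz hw, cpow_mul_of hz hw, map_mul]; ring

theorem one_add_re {η : ℂ} (h : ‖η‖ ≤ 1/2) : 0 < (1 + η).re := by
  have := Complex.abs_re_le_norm η
  have := abs_le.1 this
  simp; linarith

/-- pointwise Taylor bound -/
theorem tay3 {s t : ℝ} (hs : s ≠ 0) (hst : 0 < s + t) (N : ℕ) (hN : 2 ≤ N) (hN' : s + t ≤ N) :
    ∃ C : ℝ, 0 < C ∧ ∀ z η : ℂ, 0 < z.re →
      ‖FF s t (z * (1 + η)) - FF s t z * (1 + TT s t η)‖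
        ≤ C * ‖z‖ ^ (s + t) * (‖η‖ ^ 3 + ‖η‖ ^ N) := by
  obtain ⟨C1, hC1, H1⟩ := tay2 s t
  obtain ⟨C2, hC2, H2⟩ := TT_le s t
  have hst' : s + t ≠ 0 := hst.ne'
  refine ⟨C1 + (3 : ℝ) ^ (s + t) * 2 ^ N + 2 ^ N + C2 * 2 ^ N * 2, by positivity, fun z η hz => ?_⟩
  have n0 := norm_nonneg η
  have nz : 0 ≤ ‖z‖ ^ (s + t) := by positivity
  rcases le_or_gt ‖η‖ (1/2) with h | h
  · rw [FF_mul hz (one_add_re h), ← mul_sub, norm_mul, FF_norm hs hst']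
    have := H1 η h
    rw [show FF s t (1 + η) - (1 + TT s t η)
      = (1 + η) ^ (s : ℂ) * conj ((1 + η) ^ (t : ℂ)) - 1 - TT s t η by unfold FF; ring]
    calc _ ≤ ‖z‖ ^ (s + t) * (C1 * ‖η‖ ^ 3) := by gcongr
      _ = C1 * ‖z‖ ^ (s + t) * (‖η‖ ^ 3 + 0) := by ring
      _ ≤ _ := by
        gcongr
        · have : 0 ≤ (3 : ℝ) ^ (s + t) * 2 ^ N + 2 ^ N + C2 * 2 ^ N * 2 := by positivity
          linarith
        · positivity
  · set x := ‖η‖ with hx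
    have hx2 : 1 ≤ 2 * x := by linarith
    have hpow : ∀ k : ℕ, k ≤ N → x ^ k ≤ 2 ^ N * x ^ N := by
      intro k hk
      have h1 : (2 * x) ^ k ≤ (2 * x) ^ N := pow_le_pow_right₀ hx2 hk
      rw [mul_pow, mul_pow] at h1
      have : (1 : ℝ) ≤ 2 ^ k := one_le_pow₀ (by norm_num)
      have := pow_nonneg n0 k
      nlinarith
    have b1 : ‖FF s t (z * (1 + η))‖ ≤ ‖z‖ ^ (s + t) * ((3 : ℝ) ^ (s + t) * (2 ^ N * x ^ N)) := by
      rw [FF_norm hs hst', norm_mul, Real.mul_rpow (norm_nonneg _) (norm_nonneg _)]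
      gcongr
      have : ‖1 + η‖ ≤ 3 * x := by
        have := norm_add_le 1 η
        rw [norm_one] at this
        linarith
      calc ‖1 + η‖ ^ (s + t) ≤ (3 * x) ^ (s + t) := by gcongr
        _ = 3 ^ (s + t) * x ^ (s + t) := by rw [Real.mul_rpow (by norm_num) n0]
        _ ≤ 3 ^ (s + t) * (2 * x) ^ (s + t) := by gcongr; linarith
        _ ≤ 3 ^ (s + t) * (2 * x) ^ (N : ℝ) := by
          gcongr
        _ = _ := by rw [Real.rpow_natCast, mul_pow]
    have b2 : ‖FF s t z * (1 + TT s t η)‖ ≤ ‖z‖ ^ (s + t) * ((2 ^ N + C2 * 2 ^ N * 2) * x ^ N) := by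
      rw [norm_mul, FF_norm hs hst']
      gcongr
      calc ‖1 + TT s t η‖ ≤ ‖(1 : ℂ)‖ + ‖TT s t η‖ := norm_add_le _ _
        _ ≤ x ^ 0 + C2 * (x ^ 1 + x ^ 2) := by
          rw [norm_one, pow_zero, pow_one]; gcongr; exact H2 η
        _ ≤ (2 ^ N * x ^ N) + C2 * (2 ^ N * x ^ N + 2 ^ N * x ^ N) := by
          gcongr
          · exact hpow 0 (by omega)
          · exact hpow 1 (by omega)
          · exact hpow 2 (by omega)
        _ = _ := by ring
    refine (norm_sub_le _ _).trans ((add_le_add b1 b2).trans ?_)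
    calc _ = ((3 : ℝ) ^ (s + t) * 2 ^ N + 2 ^ N + C2 * 2 ^ N * 2) * ‖z‖ ^ (s + t) * (0 + x ^ N) := by ring
      _ ≤ _ := by
        gcongr
        · linarith
        · positivity

end SB

namespace SB
open Complex ComplexConjugate

/-- parameters of the linear change of coordinates -/
structure Par where
  ψ : ℝ
  r1 : ℝ
  r2 : ℝ
  hψ0 : 0 < ψ
  hψ1 : ψ < Real.pi / 2
  h1 : 0 < r1
  h2 : 0 < r2

/-- the cone exponent -/
def Par.p (P : Par) : ℝ := Real.pi / P.ψ

theorem Par.p_gt (P : Par) : 2 < P.p := by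
  unfold Par.p
  rw [lt_div_iff₀ P.hψ0]; linarith [P.hψ1]

theorem Par.p_mul (P : Par) : P.p * P.ψ = Real.pi := by
  unfold Par.p; field_simp [P.hψ0.ne']

/-- linear change of coordinates -/
def ZZ (P : Par) (X1 X2 : ℝ) : ℂ :=
  ⟨(X1 * P.r1 + X2 * P.r2) * Real.cos (P.ψ / 2), (X2 * P.r2 - X1 * P.r1) * Real.sin (P.ψ / 2)⟩

theorem ZZ_add (P : Par) (a b c d : ℝ) : ZZ P (a + c) (b + d) = ZZ P a b + ZZ P c d := by
  apply Complex.ext <;> simp [ZZ] <;> ring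

theorem ZZ_smul (P : Par) (c a b : ℝ) : ZZ P (c * a) (c * b) = c * ZZ P a b := by
  apply Complex.ext <;> simp [ZZ] <;> ring

theorem ZZ_normSq (P : Par) (a b : ℝ) :
    ‖ZZ P a b‖ ^ 2 = a ^ 2 * P.r1 ^ 2 + b ^ 2 * P.r2 ^ 2 + 2 * (a * b * P.r1 * P.r2) * Real.cos P.ψ := by
  have h := Real.cos_sq_add_sin_sq (P.ψ / 2)
  have h2 : Real.cos P.ψ = Real.cos (P.ψ / 2) ^ 2 - Real.sin (P.ψ / 2) ^ 2 := by
    have := Real.cos_two_mul' (P.ψ / 2)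
    rwa [show 2 * (P.ψ / 2) = P.ψ by ring] at this
  rw [Complex.sq_norm, Complex.normSq_apply, h2]
  simp only [ZZ]
  linear_combination (a ^ 2 * P.r1 ^ 2 + b ^ 2 * P.r2 ^ 2) * h

theorem ZZ_norm_le (P : Par) (a b : ℝ) : ‖ZZ P a b‖ ≤ |a| * P.r1 + |b| * P.r2 := by
  have h1 := P.h1
  have h2 := P.h2
  apply abs_le_of_sq_le_sq' _ (by positivity) |>.2
  rw [ZZ_normSq]
  have h3 : a * b * P.r1 * P.r2 * Real.cos P.ψ ≤ |a| * |b| * P.r1 * P.r2 := by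
    calc _ ≤ |a * b * P.r1 * P.r2 * Real.cos P.ψ| := le_abs_self _
      _ = |a| * |b| * P.r1 * P.r2 * |Real.cos P.ψ| := by
        rw [abs_mul, abs_mul, abs_mul, abs_mul, abs_of_pos h1, abs_of_pos h2]
      _ ≤ |a| * |b| * P.r1 * P.r2 * 1 := by gcongr; exact Real.abs_cos_le_one _
      _ = _ := by ring
  have := sq_abs a
  have := sq_abs b
  nlinarith

theorem hs_congr {E : Type*} [AddCommMonoid E] [TopologicalSpace E] {f g : ℤ × ℤ → E} {a b : E}
    (hf : HasSum f a) (h : ∀ d, g d = f d) (hab : b = a) : HasSum g b := by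
  rw [show g = f from funext h, hab]; exact hf

/-- a step law adapted to the parameters -/
structure Geo (μ : ℤ × ℤ → ℝ) (P : Par) (σ2 : ℝ) : Prop where
  nonneg : ∀ d, 0 ≤ μ d
  mass : HasSum μ 1
  σpos : 0 < σ2
  m1 : HasSum (fun d => (μ d : ℂ) * ZZ P d.1 d.2) 0
  m2 : HasSum (fun d => (μ d : ℂ) * ZZ P d.1 d.2 ^ 2) 0
  m3 : HasSum (fun d => μ d * ‖ZZ P d.1 d.2‖ ^ 2) σ2
  mom : ∀ N : ℕ, Summable (fun d => μ d * ‖ZZ P d.1 d.2‖ ^ N)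

theorem Law.geo {μ : ℤ × ℤ → ℝ} {s11 s12 s22 : ℝ} (h : Law μ s11 s12 s22) {P : Par}
    (e1 : P.r1 ^ 2 * s11 = 1) (e2 : P.r2 ^ 2 * s22 = 1) (e3 : P.r1 * P.r2 * s12 = - Real.cos P.ψ) :
    Geo μ P (2 * Real.sin P.ψ ^ 2) := by
  have c0 := Real.cos_sq_add_sin_sq (P.ψ / 2)
  have c2 : Real.cos P.ψ = Real.cos (P.ψ / 2) ^ 2 - Real.sin (P.ψ / 2) ^ 2 := by
    have := Real.cos_two_mul' (P.ψ / 2)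
    rwa [show 2 * (P.ψ / 2) = P.ψ by ring] at this
  refine ⟨h.nonneg, h.mass, ?_, ?_, ?_, ?_, ?_⟩
  · have := Real.sin_pos_of_pos_of_lt_pi P.hψ0 (by linarith [P.hψ1, Real.pi_pos])
    positivity
  · rw [Complex.hasSum_iff]
    constructor
    · have := (h.mean1.mul_left (P.r1 * Real.cos (P.ψ / 2))).add
        (h.mean2.mul_left (P.r2 * Real.cos (P.ψ / 2)))
      refine hs_congr this (fun d => ?_) ?_
      · simp [ZZ]; ring
      · simp
    · have := (h.mean2.mul_left (P.r2 * Real.sin (P.ψ / 2))).sub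
        (h.mean1.mul_left (P.r1 * Real.sin (P.ψ / 2)))
      refine hs_congr this (fun d => ?_) ?_
      · simp [ZZ]; ring
      · simp
  · rw [Complex.hasSum_iff]
    constructor
    · have := ((h.var1.mul_left (P.r1 ^ 2 * Real.cos P.ψ)).add
        (h.var2.mul_left (P.r2 ^ 2 * Real.cos P.ψ))).add (h.cov.mul_left (2 * (P.r1 * P.r2)))
      refine hs_congr this (fun d => ?_) ?_
      · skip
        rw [c2]
        simp [ZZ, sq]
        linear_combination (2 * P.r1 * P.r2 * d.1 * d.2 * μ d) * c0
      · simp only [Complex.zero_re]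
        linear_combination -Real.cos P.ψ * e1 - Real.cos P.ψ * e2 - 2 * e3
    · have := ((h.var2.mul_left (2 * P.r2 ^ 2 * Real.cos (P.ψ / 2) * Real.sin (P.ψ / 2))).sub
        (h.var1.mul_left (2 * P.r1 ^ 2 * Real.cos (P.ψ / 2) * Real.sin (P.ψ / 2))))
      refine hs_congr this (fun d => ?_) ?_
      · skip
        simp [ZZ, sq]
        ring
      · simp only [Complex.zero_im]
        linear_combination 2 * Real.cos (P.ψ / 2) * Real.sin (P.ψ / 2) * (e1 - e2)
  · have := ((h.var1.mul_left (P.r1 ^ 2)).add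
        (h.var2.mul_left (P.r2 ^ 2))).add (h.cov.mul_left (2 * (P.r1 * P.r2) * Real.cos P.ψ))
    refine hs_congr this (fun d => ?_) ?_
    · skip
      rw [ZZ_normSq]; ring
    · have := Real.cos_sq_add_sin_sq P.ψ
      linear_combination -e1 - e2 - 2 * Real.cos P.ψ * e3 + 2 * this
  · intro N
    refine Summable.of_nonneg_of_le (fun d => mul_nonneg (h.nonneg d) (by positivity)) ?_
      ((h.mom N).mul_left ((P.r1 + P.r2) ^ N))
    intro d
    have h1 := P.h1
    have h2 := P.h2
    have : ‖ZZ P d.1 d.2‖ ≤ (P.r1 + P.r2) * (|(d.1 : ℝ)| + |(d.2 : ℝ)|) := by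
      refine (ZZ_norm_le P _ _).trans ?_
      have := abs_nonneg (d.1 : ℝ)
      have := abs_nonneg (d.2 : ℝ)
      nlinarith
    calc _ ≤ μ d * ((P.r1 + P.r2) * (|(d.1 : ℝ)| + |(d.2 : ℝ)|)) ^ N := by
          have := h.nonneg d
          gcongr
      _ = _ := by rw [mul_pow]; ring

theorem exists_par {s11 s12 s22 : ℝ} (h11 : 0 < s11) (h22 : 0 < s22) (h12 : s12 < 0)
    (hd : s12 ^ 2 < s11 * s22) :
    ∃ P : Par, P.r1 ^ 2 * s11 = 1 ∧ P.r2 ^ 2 * s22 = 1 ∧ P.r1 * P.r2 * s12 = - Real.cos P.ψ := by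
  have a1 : 0 < Real.sqrt s11 := Real.sqrt_pos.2 h11
  have a2 : 0 < Real.sqrt s22 := Real.sqrt_pos.2 h22
  have b1 := Real.sq_sqrt h11.le
  have b2 := Real.sq_sqrt h22.le
  set c : ℝ := -s12 / (Real.sqrt s11 * Real.sqrt s22) with hc
  have c0 : 0 < c := div_pos (by linarith) (by positivity)
  have c1 : c < 1 := by
    rw [hc, div_lt_one (by positivity)]
    apply lt_of_pow_lt_pow_left₀ 2 (by positivity)
    rw [mul_pow, b1, b2]; linarith [neg_sq s12]
  refine ⟨⟨Real.arccos c, (Real.sqrt s11)⁻¹, (Real.sqrt s22)⁻¹, Real.arccos_pos.2 c1,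
    Real.arccos_lt_pi_div_two.2 c0, by positivity, by positivity⟩, ?_, ?_, ?_⟩
  · simp only
    rw [inv_pow, b1]; field_simp
  · simp only
    rw [inv_pow, b2]; field_simp
  · simp only
    rw [Real.cos_arccos (by linarith) c1.le, hc]
    field_simp

/-- Taylor expansion of the expectation. -/
theorem Geo.taylor {μ : ℤ × ℤ → ℝ} {P : Par} {σ2 : ℝ} (h : Geo μ P σ2) {q m : ℝ} (hq : 0 < q)
    (hqm : q + m ≠ 0) :
    ∃ C : ℝ, 0 < C ∧ ∀ z : ℂ, 0 < z.re → 1 ≤ ‖z‖ →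
      Summable (fun d : ℤ × ℤ => μ d * G q m (z + ZZ P d.1 d.2)) ∧
      |∑' d : ℤ × ℤ, μ d * G q m (z + ZZ P d.1 d.2)
        - G q m z * (1 + (q ^ 2 - m ^ 2) / 4 * σ2 / ‖z‖ ^ 2)| ≤ C * ‖z‖ ^ (q - 3) := by
  set s := (q + m) / 2 with hs
  set t := (q - m) / 2 with ht
  have hs0 : s ≠ 0 := by rw [hs]; intro h; apply hqm; linarith
  have est : s + t = q := by rw [hs, ht]; ring
  have est' : s - t = m := by rw [hs, ht]; ring
  have hst : 0 < s + t := by rw [est]; exact hq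
  obtain ⟨N0, hN0⟩ := exists_nat_ge q
  set N := N0 + 3 with hN
  obtain ⟨C, hC, H⟩ := tay3 hs0 hst N (by omega) (by rw [est, hN]; push_cast; linarith)
  set M := ∑' d : ℤ × ℤ, (μ d * ‖ZZ P d.1 d.2‖ ^ 3 + μ d * ‖ZZ P d.1 d.2‖ ^ N) with hM
  have sM := (h.mom 3).add (h.mom N)
  have M0 : 0 ≤ M := tsum_nonneg fun d => by have := h.nonneg d; positivity
  refine ⟨C * M + 1, by positivity, fun z hz hz1 => ?_⟩
  have hz0 : z ≠ 0 := by rintro rfl; simp at hz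
  have hr : 0 < ‖z‖ := by linarith
  set ζ : ℤ × ℤ → ℂ := fun d => ZZ P d.1 d.2 with hζ
  set R : ℤ × ℤ → ℂ := fun d => FF s t (z + ζ d) - FF s t z * (1 + TT s t (ζ d / z)) with hR
  have hRb : ∀ d, ‖(μ d : ℂ) * R d‖ ≤ C * ‖z‖ ^ (q - 3) * (μ d * ‖ζ d‖ ^ 3 + μ d * ‖ζ d‖ ^ N) := by
    intro d
    have h1 := H z (ζ d / z) hz
    have e : z * (1 + ζ d / z) = z + ζ d := by field_simp
    rw [e, est, norm_div, div_pow, div_pow] at h1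
    have h2 : ‖ζ d‖ ^ N / ‖z‖ ^ N ≤ ‖ζ d‖ ^ N / ‖z‖ ^ 3 := by
      gcongr
      omega
    rw [norm_mul, Complex.norm_real, Real.norm_of_nonneg (h.nonneg d)]
    calc μ d * ‖R d‖ ≤ μ d * (C * ‖z‖ ^ q * (‖ζ d‖ ^ 3 / ‖z‖ ^ 3 + ‖ζ d‖ ^ N / ‖z‖ ^ 3)) := by
          refine mul_le_mul_of_nonneg_left (h1.trans ?_) (h.nonneg d)
          gcongr
      _ = C * (‖z‖ ^ q / ‖z‖ ^ 3) * (μ d * ‖ζ d‖ ^ 3 + μ d * ‖ζ d‖ ^ N) := by ring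
      _ = _ := by
        rw [Real.rpow_sub hr]
        congr 3
        exact_mod_cast (Real.rpow_natCast ‖z‖ 3).symm
  have sR : Summable (fun d => (μ d : ℂ) * R d) :=
    Summable.of_norm_bounded (sM.mul_left _) hRb
  have nR : ‖∑' d, (μ d : ℂ) * R d‖ ≤ C * ‖z‖ ^ (q - 3) * M := by
    rw [hM, ← tsum_mul_left]
    exact tsum_of_norm_bounded (sM.mul_left _).hasSum hRb
  -- main part
  have k0 : HasSum (fun d => (μ d : ℂ)) 1 := by simpa using Complex.hasSum_ofReal.2 h.mass
  have k3 : HasSum (fun d => (μ d : ℂ) * (ζ d * conj (ζ d))) (σ2 : ℂ) := by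
    have := Complex.hasSum_ofReal (f := fun d => μ d * ‖ζ d‖ ^ 2) (x := σ2) |>.2 h.m3
    refine hs_congr this (fun d => ?_) rfl
    rw [Complex.mul_conj']; push_cast; ring
  have k1' := Complex.hasSum_conj'.2 h.m1
  have k2' := Complex.hasSum_conj'.2 h.m2
  have kT := (((((k0.add (h.m1.mul_left ((s : ℂ) / z))).add (k1'.mul_left ((t : ℂ) / conj z))).add
    (h.m2.mul_left ((s : ℂ) * (s - 1) / 2 / z ^ 2))).add
    (k2'.mul_left ((t : ℂ) * (t - 1) / 2 / (conj z) ^ 2))).add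
    (k3.mul_left ((s : ℂ) * t / (z * conj z)))).mul_left (FF s t z)
  have kF := kT.add sR.hasSum
  have cz : conj z ≠ 0 := by simpa using hz0
  have kF' : HasSum (fun d => (μ d : ℂ) * FF s t (z + ζ d))
      (FF s t z * (1 + (s * t : ℂ) / (z * conj z) * σ2) + ∑' d, (μ d : ℂ) * R d) := by
    refine hs_congr kF (fun d => ?_) ?_
    · skip
      simp only [hR, TT, map_mul, map_pow, map_div₀, Complex.conj_ofReal, hζ]
      field_simp
      ring
    · simp
  have kG := (Complex.hasSum_iff _ _).1 kF' |>.1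
  have eG : (fun d : ℤ × ℤ => ((μ d : ℂ) * FF s t (z + ζ d)).re)
      = fun d => μ d * G q m (z + ZZ P d.1 d.2) := by
    funext d
    rw [Complex.re_ofReal_mul, FF_re hs0 hst.ne', est, est']
  rw [eG] at kG
  refine ⟨kG.summable, ?_⟩
  rw [kG.tsum_eq]
  have e1 : (1 + (s * t : ℂ) / (z * conj z) * σ2)
      = ((1 + (q ^ 2 - m ^ 2) / 4 * σ2 / ‖z‖ ^ 2 : ℝ) : ℂ) := by
    rw [Complex.mul_conj', hs, ht]
    push_cast
    ring
  rw [e1, Complex.add_re, Complex.re_mul_ofReal, FF_re hs0 hst.ne', est, est', add_sub_cancel_left]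
  refine (Complex.abs_re_le_norm _).trans (nR.trans ?_)
  have : 0 ≤ ‖z‖ ^ (q - 3) := by positivity
  nlinarith

end SB

namespace SB
open Complex ComplexConjugate

theorem polar (a : ℝ) (z : ℂ) : ‖z‖ * Real.sin (a - arg z) = Real.sin a * z.re - Real.cos a * z.im := by
  rw [Real.sin_sub, ← Complex.norm_mul_cos_arg z, ← Complex.norm_mul_sin_arg z]; ring

theorem polar' (a : ℝ) (z : ℂ) : ‖z‖ * Real.sin (a + arg z) = Real.sin a * z.re + Real.cos a * z.im := by
  rw [Real.sin_add, ← Complex.norm_mul_cos_arg z, ← Complex.norm_mul_sin_arg z]; ring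

theorem Par.sin_pos (P : Par) : 0 < Real.sin P.ψ :=
  Real.sin_pos_of_pos_of_lt_pi P.hψ0 (by linarith [P.hψ1, Real.pi_pos])

theorem Par.sin2_pos (P : Par) : 0 < Real.sin (P.ψ / 2) :=
  Real.sin_pos_of_pos_of_lt_pi (by linarith [P.hψ0]) (by linarith [P.hψ1, Real.pi_pos])

theorem Par.cos2_pos (P : Par) : 0 < Real.cos (P.ψ / 2) :=
  Real.cos_pos_of_mem_Ioo ⟨by linarith [P.hψ0, P.hψ1, Real.pi_pos], by linarith [P.hψ1, Real.pi_pos]⟩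

theorem Par.cos_pos (P : Par) : 0 < Real.cos P.ψ :=
  Real.cos_pos_of_mem_Ioo ⟨by linarith [P.hψ0, P.hψ1, Real.pi_pos], by linarith [P.hψ1, Real.pi_pos]⟩

theorem Par.sin_eq (P : Par) : Real.sin P.ψ = 2 * Real.sin (P.ψ / 2) * Real.cos (P.ψ / 2) := by
  rw [← Real.sin_two_mul]; congr 1; ring

theorem ZZ_s1 (P : Par) (X1 X2 : ℝ) :
    ‖ZZ P X1 X2‖ * Real.sin (P.ψ / 2 - arg (ZZ P X1 X2)) = X1 * P.r1 * Real.sin P.ψ := by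
  rw [polar, P.sin_eq]; simp only [ZZ]; ring

theorem ZZ_s2 (P : Par) (X1 X2 : ℝ) :
    ‖ZZ P X1 X2‖ * Real.sin (P.ψ / 2 + arg (ZZ P X1 X2)) = X2 * P.r2 * Real.sin P.ψ := by
  rw [polar', P.sin_eq]; simp only [ZZ]; ring

theorem ZZ_re_pos (P : Par) {X1 X2 : ℝ} (h1 : 0 ≤ X1) (h2 : 0 ≤ X2) (h : 0 < X1 + X2) :
    0 < (ZZ P X1 X2).re := by
  have a := P.h1
  have b := P.h2
  apply mul_pos _ P.cos2_pos
  rcases h1.lt_or_eq with h1 | h1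
  · positivity
  · rcases h2.lt_or_eq with h2 | h2
    · positivity
    · linarith

theorem arg_le_of {z : ℂ} (hz : 0 < z.re) {a : ℝ} (ha : 0 ≤ a)
    (h : 0 ≤ Real.sin (a - arg z)) : arg z ≤ a := by
  have h1 := Complex.abs_arg_lt_pi_div_two_iff.2 (Or.inl hz)
  rw [abs_lt] at h1
  by_contra hc
  push Not at hc
  have : Real.sin (a - arg z) < 0 :=
    Real.sin_neg_of_neg_of_neg_pi_lt (by linarith) (by linarith [Real.pi_pos])
  linarith

theorem arg_ge_of {z : ℂ} (hz : 0 < z.re) {a : ℝ} (ha : 0 ≤ a)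
    (h : 0 ≤ Real.sin (a + arg z)) : - a ≤ arg z := by
  have h1 := Complex.abs_arg_lt_pi_div_two_iff.2 (Or.inl hz)
  rw [abs_lt] at h1
  by_contra hc
  push Not at hc
  have : Real.sin (a + arg z) < 0 :=
    Real.sin_neg_of_neg_of_neg_pi_lt (by linarith) (by linarith [Real.pi_pos])
  linarith

theorem ZZ_zero (P : Par) : ZZ P 0 0 = 0 := by apply Complex.ext <;> simp [ZZ]

theorem ZZ_arg (P : Par) {X1 X2 : ℝ} (h1 : 0 ≤ X1) (h2 : 0 ≤ X2) :
    |arg (ZZ P X1 X2)| ≤ P.ψ / 2 := by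
  by_cases h : 0 < X1 + X2
  · have hre := ZZ_re_pos P h1 h2 h
    have hn : 0 < ‖ZZ P X1 X2‖ := by
      rw [norm_pos_iff]; intro h; rw [h] at hre; simp at hre
    have a := P.h1
    have b := P.h2
    have c := P.sin_pos
    rw [abs_le]
    constructor
    · apply arg_ge_of hre (by linarith [P.hψ0])
      refine nonneg_of_mul_nonneg_right (a := ‖ZZ P X1 X2‖) ?_ hn
      rw [ZZ_s2]; positivity
    · apply arg_le_of hre (by linarith [P.hψ0])
      refine nonneg_of_mul_nonneg_right (a := ‖ZZ P X1 X2‖) ?_ hn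
      rw [ZZ_s1]; positivity
  · have e1 : X1 = 0 := by linarith
    have e2 : X2 = 0 := by linarith
    rw [e1, e2, ZZ_zero]; simp; linarith [P.hψ0]

theorem ZZ_ge1 (P : Par) {X1 X2 : ℝ} (h1 : 0 ≤ X1) (h2 : 0 ≤ X2) : X1 * P.r1 ≤ ‖ZZ P X1 X2‖ := by
  have a := P.h1
  have b := P.h2
  have c := P.cos_pos
  apply abs_le_of_sq_le_sq' _ (by positivity) |>.2
  rw [ZZ_normSq]
  have : 0 ≤ 2 * (X1 * X2 * P.r1 * P.r2) * Real.cos P.ψ := by positivity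
  have : 0 ≤ X2 ^ 2 * P.r2 ^ 2 := by positivity
  nlinarith

theorem ZZ_ge2 (P : Par) {X1 X2 : ℝ} (h1 : 0 ≤ X1) (h2 : 0 ≤ X2) : X2 * P.r2 ≤ ‖ZZ P X1 X2‖ := by
  have a := P.h1
  have b := P.h2
  have c := P.cos_pos
  apply abs_le_of_sq_le_sq' _ (by positivity) |>.2
  rw [ZZ_normSq]
  have : 0 ≤ 2 * (X1 * X2 * P.r1 * P.r2) * Real.cos P.ψ := by positivity
  have : 0 ≤ X1 ^ 2 * P.r1 ^ 2 := by positivity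
  nlinarith

/-- exchange of the coordinates -/
def Par.swap (P : Par) : Par := ⟨P.ψ, P.r2, P.r1, P.hψ0, P.hψ1, P.h2, P.h1⟩

theorem ZZ_swap (P : Par) (X1 X2 : ℝ) : ZZ P X1 X2 = conj (ZZ P.swap X2 X1) := by
  apply Complex.ext
  · simp only [ZZ, Par.swap, Complex.conj_re]; ring
  · simp only [ZZ, Par.swap, Complex.conj_im]; ring

theorem G_conj (q m : ℝ) (z : ℂ) : G q m (conj z) = G q m z := by
  unfold G
  rw [Complex.norm_conj, Complex.arg_conj]
  split_ifs with h
  · rw [h]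
  · rw [mul_neg, Real.cos_neg]

theorem G_swap (P : Par) (q m X1 X2 : ℝ) : G q m (ZZ P X1 X2) = G q m (ZZ P.swap X2 X1) := by
  rw [ZZ_swap, G_conj]

theorem G_smul (q m : ℝ) {c : ℝ} (hc : 0 < c) (z : ℂ) : G q m (c * z) = c ^ q * G q m z := by
  unfold G
  rw [norm_mul, Complex.norm_real, Real.norm_of_nonneg hc.le, Complex.arg_real_mul _ hc,
    Real.mul_rpow hc.le (norm_nonneg _), mul_assoc]

theorem G_abs (q m : ℝ) (z : ℂ) : |G q m z| ≤ ‖z‖ ^ q := by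
  unfold G
  rw [abs_mul, abs_of_nonneg (by positivity)]
  exact mul_le_of_le_one_right (by positivity) (Real.abs_cos_le_one _)

theorem G_nonneg (P : Par) {q m : ℝ} (hm0 : 0 ≤ m) (hm : m ≤ P.p) {X1 X2 : ℝ} (h1 : 0 ≤ X1) (h2 : 0 ≤ X2) :
    0 ≤ G q m (ZZ P X1 X2) := by
  apply mul_nonneg (by positivity)
  have h := ZZ_arg P h1 h2
  have hp := P.p_mul
  have h3 : |m * arg (ZZ P X1 X2)| ≤ Real.pi / 2 := by
    rw [abs_mul, abs_of_nonneg hm0]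
    have := P.p_gt
    calc _ ≤ P.p * (P.ψ / 2) := by gcongr
      _ = _ := by linarith
  rw [abs_le] at h3
  exact Real.cos_nonneg_of_mem_Icc ⟨by linarith, h3.2⟩

theorem G_lower (P : Par) {m : ℝ} (hm0 : 0 ≤ m) (hm : m < P.p) : ∃ c : ℝ, 0 < c ∧
    ∀ q X1 X2 : ℝ, 0 ≤ X1 → 0 ≤ X2 → c * ‖ZZ P X1 X2‖ ^ q ≤ G q m (ZZ P X1 X2) := by
  have hp := P.p_mul
  have hψ := P.hψ0
  have k : m * (P.ψ / 2) < Real.pi / 2 := by nlinarith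
  refine ⟨Real.cos (m * (P.ψ / 2)), Real.cos_pos_of_mem_Ioo ⟨?_, k⟩, fun q X1 X2 h1 h2 => ?_⟩
  · have : 0 ≤ m * (P.ψ / 2) := by positivity
    linarith [Real.pi_pos]
  · have h := ZZ_arg P h1 h2
    unfold G
    rw [mul_comm]
    refine mul_le_mul_of_nonneg_left ?_ (by positivity)
    rw [← Real.cos_abs (m * arg _), abs_mul, abs_of_nonneg hm0]
    apply Real.cos_le_cos_of_nonneg_of_le_pi (by positivity) (by linarith [Real.pi_pos])
    gcongr

theorem cos_p (P : Par) {φ : ℝ} (h : |φ| ≤ P.ψ / 2) :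
    2 * P.p / Real.pi * (Real.sin (P.ψ / 2 - φ) * Real.sin (P.ψ / 2 + φ)) ≤ Real.cos (P.p * φ) ∧
    Real.cos (P.p * φ) ≤ P.p * (Real.pi / 2) / Real.sin (P.ψ / 2) *
      (Real.sin (P.ψ / 2 - φ) * Real.sin (P.ψ / 2 + φ)) := by
  wlog hφ : 0 ≤ φ with H
  · have := H P (φ := -φ) (by rwa [abs_neg]) (by linarith)
    rw [mul_neg, Real.cos_neg, sub_neg_eq_add, ← sub_eq_add_neg, mul_comm (Real.sin (P.ψ / 2 + φ))] at this
    exact this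
  rw [abs_of_nonneg hφ] at h
  have hp := P.p_mul
  have hp2 := P.p_gt
  have hψ := P.hψ0
  have hψ1 := P.hψ1
  have pi := Real.pi_pos
  set δ := P.ψ / 2 - φ with hδ
  have e : P.ψ / 2 + φ = P.ψ - δ := by rw [hδ]; ring
  have d0 : 0 ≤ δ := by linarith
  have d1 : δ ≤ P.ψ / 2 := by linarith
  have ec : Real.cos (P.p * φ) = Real.sin (P.p * δ) := by
    rw [← Real.cos_pi_div_two_sub]; congr 1; rw [hδ]; linarith
  have pd0 : 0 ≤ P.p * δ := by positivity
  have pd1 : P.p * δ ≤ Real.pi / 2 := by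
    calc _ ≤ P.p * (P.ψ / 2) := by gcongr
      _ = _ := by linarith
  have s1 : 2 / Real.pi * (P.p * δ) ≤ Real.sin (P.p * δ) := Real.mul_le_sin pd0 pd1
  have s2 : Real.sin (P.p * δ) ≤ P.p * δ := Real.sin_le pd0
  have s3 : 2 / Real.pi * δ ≤ Real.sin δ := Real.mul_le_sin d0 (by linarith)
  have s4 : Real.sin δ ≤ δ := Real.sin_le d0
  have s5 : Real.sin (P.ψ / 2) ≤ Real.sin (P.ψ - δ) :=
    Real.sin_le_sin_of_le_of_le_pi_div_two (by linarith) (by linarith) (by linarith)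
  have s6 : Real.sin (P.ψ - δ) ≤ 1 := Real.sin_le_one _
  have s7 := P.sin2_pos
  have s8 : 0 ≤ Real.sin δ := Real.sin_nonneg_of_nonneg_of_le_pi d0 (by linarith)
  rw [ec, e]
  constructor
  · calc _ ≤ 2 * P.p / Real.pi * (δ * 1) := by
          have : 0 < Real.sin (P.ψ - δ) := by linarith
          gcongr
      _ ≤ _ := by refine le_trans (le_of_eq ?_) s1; ring
  · have : δ ≤ Real.pi / 2 * Real.sin δ := by
      have := mul_le_mul_of_nonneg_left s3 (show 0 ≤ Real.pi / 2 by positivity)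
      refine le_trans (le_of_eq ?_) this
      field_simp
    calc _ ≤ P.p * δ := s2
      _ ≤ P.p * (Real.pi / 2 * Real.sin δ) := by gcongr
      _ = P.p * (Real.pi / 2) / Real.sin (P.ψ / 2) * (Real.sin δ * Real.sin (P.ψ / 2)) := by field_simp
      _ ≤ _ := by gcongr

/-- two sided bounds for the harmonic function of the cone. -/
theorem u_bounds (P : Par) : ∃ c C : ℝ, 0 < c ∧ 0 < C ∧ ∀ q X1 X2 : ℝ, 0 ≤ X1 → 0 ≤ X2 → 0 < X1 + X2 →
    c * (‖ZZ P X1 X2‖ ^ (q - 2) * (X1 * X2)) ≤ G q P.p (ZZ P X1 X2) ∧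
    G q P.p (ZZ P X1 X2) ≤ C * (‖ZZ P X1 X2‖ ^ (q - 2) * (X1 * X2)) := by
  have hp2 := P.p_gt
  have pi := Real.pi_pos
  have a := P.h1
  have b := P.h2
  have s := P.sin_pos
  have s2 := P.sin2_pos
  refine ⟨2 * P.p / Real.pi * (P.r1 * P.r2 * Real.sin P.ψ ^ 2),
    P.p * (Real.pi / 2) / Real.sin (P.ψ / 2) * (P.r1 * P.r2 * Real.sin P.ψ ^ 2), by positivity, by positivity,
    fun q X1 X2 h1 h2 h => ?_⟩
  have hre := ZZ_re_pos P h1 h2 h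
  have hn : 0 < ‖ZZ P X1 X2‖ := by
    rw [norm_pos_iff]; intro h; rw [h] at hre; simp at hre
  have A := ZZ_s1 P X1 X2
  have B := ZZ_s2 P X1 X2
  have Cc := cos_p P (ZZ_arg P h1 h2)
  set r := ‖ZZ P X1 X2‖
  set φ := arg (ZZ P X1 X2)
  have e : r ^ (q - 2) * (X1 * X2) * (P.r1 * P.r2 * Real.sin P.ψ ^ 2)
      = r ^ q * (Real.sin (P.ψ / 2 - φ) * Real.sin (P.ψ / 2 + φ)) := by
    have : r ^ q = r ^ (q - 2) * r ^ 2 := by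
      rw [← Real.rpow_natCast, ← Real.rpow_add hn]; congr 1; push_cast; ring
    rw [this]
    linear_combination - r ^ (q - 2) * (X2 * P.r2 * Real.sin P.ψ) * A
      - r ^ (q - 2) * (r * Real.sin (P.ψ / 2 - φ)) * B
  have hq : 0 ≤ r ^ q := by positivity
  unfold G
  constructor
  · calc _ = 2 * P.p / Real.pi * (r ^ (q - 2) * (X1 * X2) * (P.r1 * P.r2 * Real.sin P.ψ ^ 2)) := by ring
      _ = r ^ q * (2 * P.p / Real.pi * (Real.sin (P.ψ / 2 - φ) * Real.sin (P.ψ / 2 + φ))) := by rw [e]; ring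
      _ ≤ _ := mul_le_mul_of_nonneg_left Cc.1 hq
  · calc _ ≤ r ^ q * (P.p * (Real.pi / 2) / Real.sin (P.ψ / 2) * (Real.sin (P.ψ / 2 - φ) * Real.sin (P.ψ / 2 + φ))) :=
          mul_le_mul_of_nonneg_left Cc.2 hq
      _ = P.p * (Real.pi / 2) / Real.sin (P.ψ / 2) * (r ^ (q - 2) * (X1 * X2) * (P.r1 * P.r2 * Real.sin P.ψ ^ 2)) := by
          rw [e]; ring
      _ = _ := by ring

/-- boundary overshoot lemma -/
theorem bdry (P : Par) {q m : ℝ} (hq : 0 < q) (hm0 : 0 < m) (hm : m ≤ P.p) :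
    ∃ (C : ℝ) (N0 : ℕ), 0 < C ∧ 3 ≤ N0 ∧ ∀ N, N0 ≤ N → ∀ X2 k : ℝ, 1 ≤ X2 → 0 ≤ k →
      - (C * X2 ^ (q - 1) * (k + k ^ N)) ≤ G q m (ZZ P (-k) X2) := by
  set s := (q + m) / 2 with hs
  set t := (q - m) / 2 with ht
  have hs0 : s ≠ 0 := by rw [hs]; positivity
  have est : s + t = q := by rw [hs, ht]; ring
  have est' : s - t = m := by rw [hs, ht]; ring
  have hst : 0 < s + t := by rw [est]; exact hq
  obtain ⟨n0, hn0⟩ := exists_nat_ge q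
  set M := n0 + 3 with hM
  obtain ⟨C, hC, H⟩ := tay3 hs0 hst M (by omega) (by rw [est, hM]; push_cast; linarith)
  obtain ⟨D, hD, HD⟩ := TT_le s t
  have a := P.h1
  have b := P.h2
  set K := max 1 (P.r1 / P.r2) with hK
  have K1 : 1 ≤ K := le_max_left _ _
  have K2 : P.r1 / P.r2 ≤ K := le_max_right _ _
  refine ⟨P.r2 ^ q * (2 * D + 2 * C) * K ^ M, M, by positivity, by omega, fun N hN X2 k hX hk => ?_⟩
  have hX0 : 0 < X2 := by linarith
  set z := ZZ P 0 X2 with hz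
  have hre : 0 < z.re := ZZ_re_pos P le_rfl hX0.le (by linarith)
  have hz0 : z ≠ 0 := by intro h; rw [h] at hre; simp at hre
  have nz : ‖z‖ = X2 * P.r2 := by
    have : ‖z‖ ^ 2 = (X2 * P.r2) ^ 2 := by rw [hz, ZZ_normSq]; ring
    exact (pow_left_inj₀ (norm_nonneg _) (by positivity) two_ne_zero).1 this
  set ζ := ZZ P (-k) 0 with hζ
  have nζ : ‖ζ‖ = k * P.r1 := by
    have : ‖ζ‖ ^ 2 = (k * P.r1) ^ 2 := by rw [hζ, ZZ_normSq]; ring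
    exact (pow_left_inj₀ (norm_nonneg _) (by positivity) two_ne_zero).1 this
  have ezz : ZZ P (-k) X2 = z * (1 + ζ / z) := by
    have : z * (1 + ζ / z) = z + ζ := by field_simp
    rw [this, hz, hζ, ← ZZ_add]; simp
  have nη : ‖ζ / z‖ = (P.r1 / P.r2) * (k / X2) := by
    rw [norm_div, nζ, nz]; field_simp
  have h1 := H z (ζ / z) hre
  have h2 := HD (ζ / z)
  set η := ζ / z
  have pw : ∀ i : ℕ, 1 ≤ i → i ≤ M → ‖η‖ ^ i ≤ K ^ M / X2 * (k + k ^ N) := by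
    intro i hi hi'
    rw [nη, mul_pow, div_pow k]
    have e1 : (P.r1 / P.r2) ^ i ≤ K ^ M := by
      calc _ ≤ K ^ i := by gcongr
        _ ≤ _ := pow_le_pow_right₀ K1 hi'
    have e2 : k ^ i ≤ k + k ^ N := by
      rcases le_total k 1 with h | h
      · have : k ^ i ≤ k ^ 1 := pow_le_pow_of_le_one hk h hi
        have : 0 ≤ k ^ N := by positivity
        linarith [pow_one k]
      · have : k ^ i ≤ k ^ N := pow_le_pow_right₀ h (by omega)
        linarith
    have e3 : X2 ≤ X2 ^ i := le_self_pow₀ hX (by omega)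
    calc _ ≤ K ^ M * ((k + k ^ N) / X2) := by gcongr
      _ = _ := by ring
  have hG0 : 0 ≤ (FF s t z).re := by
    rw [FF_re hs0 hst.ne', est, est']; exact G_nonneg P hm0.le hm le_rfl hX0.le
  have key : G q m (ZZ P (-k) X2) = (FF s t (z * (1 + η))).re := by
    rw [FF_re hs0 hst.ne', est, est', ezz]
  rw [key]
  set T := K ^ M / X2 * (k + k ^ N) with hT
  have hFz : ‖FF s t z‖ = ‖z‖ ^ q := by rw [FF_norm hs0 hst.ne', est]
  have b1 : ‖FF s t (z * (1 + η)) - FF s t z‖ ≤ ‖z‖ ^ q * ((2 * D + 2 * C) * T) := by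
    have : FF s t (z * (1 + η)) - FF s t z = (FF s t (z * (1 + η)) - FF s t z * (1 + TT s t η))
        + FF s t z * TT s t η := by ring
    rw [this]
    refine (norm_add_le _ _).trans ?_
    rw [norm_mul, hFz]
    have p1 := pw 1 le_rfl (by omega)
    have p2 := pw 2 (by omega) (by omega)
    have p3 := pw 3 (by omega) (by omega)
    have p4 := pw M (by omega) le_rfl
    rw [pow_one] at p1
    rw [est] at h1
    calc _ ≤ C * ‖z‖ ^ q * (T + T) + ‖z‖ ^ q * (D * (T + T)) := by
          refine add_le_add (h1.trans ?_) (mul_le_mul_of_nonneg_left (h2.trans ?_) (by positivity))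
          · gcongr
          · gcongr
      _ = _ := by ring
  have b2 := (Complex.abs_re_le_norm (FF s t (z * (1 + η)) - FF s t z)).trans b1
  rw [Complex.sub_re] at b2
  have b3 := (abs_le.1 b2).1
  have e5 : ‖z‖ ^ q * ((2 * D + 2 * C) * T) = P.r2 ^ q * (2 * D + 2 * C) * K ^ M * X2 ^ (q - 1) * (k + k ^ N) := by
    rw [nz, Real.mul_rpow hX0.le b.le, Real.rpow_sub hX0, Real.rpow_one, hT]
    ring
  rw [e5] at b3
  linarith

end SB

namespace SB

/-- Jumps out of the quadrant contribute non-negatively for functions that are large just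
outside the quadrant and only polynomially negative far outside. -/
def OutGood (μ : ℤ × ℤ → ℝ) : Prop :=
  ∀ (N : ℕ) (c C : ℝ), 0 < c → 0 < C → ∃ a0 : ℕ, ∀ a : ℕ, a0 ≤ a → ∀ f : ℤ × ℤ → ℝ,
    (∀ y : ℤ × ℤ, -(a : ℤ) ≤ y.1 → -(a : ℤ) ≤ y.2 → 0 ≤ f y) →
    (∀ t : ℤ, 0 ≤ t → ∃ A : ℝ, 0 ≤ A ∧ c * a * A ≤ f (-1, t) ∧
      ∀ j : ℕ, a ≤ j → -(A * C * ((j : ℝ) + 1) ^ N) ≤ f (-((j : ℤ) + 1), t)) →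
    (∀ t : ℤ, 0 ≤ t → ∃ A : ℝ, 0 ≤ A ∧ c * a * A ≤ f (t, -1) ∧
      ∀ j : ℕ, a ≤ j → -(A * C * ((j : ℝ) + 1) ^ N) ≤ f (t, -((j : ℤ) + 1))) →
    ∀ x ∈ Q, Summable (fun d => μ d * f (x + d)) →
      0 ≤ ∑' d, μ d * (if x + d ∈ Q then 0 else f (x + d))

theorem outGood_fwd {γ : ℝ} (hγ : γ^3 - γ^2 + 2*γ - 1 = 0) : OutGood (revWSb γ) := by
  intro N c C hc hC
  refine ⟨1, fun a ha f h0 _ _ x hx _ => tsum_nonneg fun d => ?_⟩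
  obtain ⟨hx1, hx2⟩ := hx
  by_cases hd : revWSb γ d = 0
  · simp [hd]
  refine mul_nonneg (rev_nonneg hγ d) ?_
  split_ifs with hQ
  · exact le_rfl
  · have : (0 < d.1 ∧ d.2 = 0) ∨ d = (0, -1) ∨ (d.1 = -1 ∧ 0 ≤ d.2) := by
      by_contra hcon
      push Not at hcon
      exact hd (rev0 d (fun h => hcon.1 h.1 h.2) hcon.2.1 (fun h => absurd h.2 (not_le.2 (hcon.2.2 h.1))))
    apply h0
    · rcases this with h | h | h
      · simp; omega
      · simp [h]; omega
      · simp [h.1]; omega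
    · rcases this with h | h | h
      · simp; omega
      · simp [h]; omega
      · simp; omega

theorem geo_nonneg {r : ℝ} (hr : 0 < r) {h : ℕ → ℝ} {n a N : ℕ} {c C A : ℝ} (hC : 0 < C) (hA : 0 ≤ A)
    (ha : 1 ≤ a)
    (hs0 : Summable (fun j : ℕ => r ^ j * ((j : ℝ) + 1) ^ N))
    (hbig : C * ∑' j : ℕ, r ^ j * ((j : ℝ) + 1) ^ N ≤ c * a)
    (hz : ∀ i < n, h i = 0) (hs : Summable (fun i => r ^ i * h i))
    (h1 : ∀ j : ℕ, j + 1 ≤ a → 0 ≤ h (j + n)) (h2 : c * a * A ≤ h n)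
    (h3 : ∀ j : ℕ, a ≤ j → -(A * C * ((j : ℝ) + 1) ^ N) ≤ h (j + n)) :
    0 ≤ ∑' i, r ^ i * h i := by
  rw [← hs.sum_add_tsum_nat_add n]
  have e0 : ∑ i ∈ Finset.range n, r ^ i * h i = 0 :=
    Finset.sum_eq_zero fun i hi => by rw [hz i (Finset.mem_range.1 hi), mul_zero]
  rw [e0, zero_add]
  have e1 : ∀ i : ℕ, r ^ (i + n) * h (i + n) = r ^ n * (r ^ i * h (i + n)) := by
    intro i; rw [pow_add]; ring
  have hs' : Summable (fun i => r ^ i * h (i + n)) := by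
    have := ((summable_nat_add_iff n).2 hs).mul_left (r ^ n)⁻¹
    refine this.congr fun i => ?_
    rw [e1]; field_simp
  rw [tsum_congr e1, tsum_mul_left]
  refine mul_nonneg (by positivity) ?_
  set B : ℕ → ℝ := fun j => (if j = 0 then c * a * A else 0) - A * C * (r ^ j * ((j : ℝ) + 1) ^ N) with hB
  have hBs : HasSum B (c * a * A - A * C * ∑' j : ℕ, r ^ j * ((j : ℝ) + 1) ^ N) := by
    exact (hasSum_ite_eq 0 (c * a * A)).sub (hs0.hasSum.mul_left (A * C))
  have : 0 ≤ c * a * A - A * C * ∑' j : ℕ, r ^ j * ((j : ℝ) + 1) ^ N := by nlinarith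
  refine this.trans ?_
  rw [← hBs.tsum_eq]
  refine hBs.summable.tsum_le_tsum (fun j => ?_) hs'
  simp only [hB]
  have nn : 0 ≤ A * C * (r ^ j * ((j : ℝ) + 1) ^ N) := by positivity
  split_ifs with hj
  · subst hj
    simp only [pow_zero, one_mul, zero_add] at *
    linarith
  · rw [zero_sub]
    rcases le_or_gt a j with haj | haj
    · have := mul_le_mul_of_nonneg_left (h3 j haj) (show 0 ≤ r ^ j by positivity)
      linarith
    · have := mul_nonneg (show 0 ≤ r ^ j by positivity) (h1 j haj)
      linarith

theorem sum_pow_aux {r : ℝ} (hr : 0 < r) (hr1 : r < 1) (N : ℕ) :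
    Summable (fun j : ℕ => r ^ j * ((j : ℝ) + 1) ^ N) := by
  have h := summable_pow_mul_geometric_of_norm_lt_one (R := ℝ) N (r := r) (by rwa [Real.norm_of_nonneg hr.le])
  have h2 := ((summable_nat_add_iff 1).2 h).mul_left r⁻¹
  refine h2.congr fun j => ?_
  rw [pow_succ]; push_cast; field_simp

theorem outGood_dual {γ : ℝ} (hγ : γ^3 - γ^2 + 2*γ - 1 = 0) : OutGood (fun d => revWSb γ (-d)) := by
  obtain ⟨g1, g2⟩ := gam_bounds hγ
  have hα := alpha_pos hγ
  have hθ := theta_eq hγ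
  have hθ0 : 0 < sbθ γ := by rw [hθ]; linarith
  have hθ1 : sbθ γ < 1 := by rw [hθ]; linarith
  have hγ0 : 0 < γ := by linarith
  have hγ1 : γ < 1 := by linarith
  intro N c C hc hC
  have s1 := sum_pow_aux hγ0 hγ1 N
  have s2 := sum_pow_aux hθ0 hθ1 N
  set S1 := ∑' j : ℕ, γ ^ j * ((j : ℝ) + 1) ^ N
  set S2 := ∑' j : ℕ, (sbθ γ) ^ j * ((j : ℝ) + 1) ^ N
  obtain ⟨a1, ha1⟩ := exists_nat_ge (C * S1 / c)
  obtain ⟨a2, ha2⟩ := exists_nat_ge (C * S2 / c)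
  refine ⟨a1 + a2 + 1, fun a ha f h0 hl hr x hx hsum => ?_⟩
  have b1 : C * S1 ≤ c * a := by
    rw [div_le_iff₀ hc] at ha1
    have : (a1 : ℝ) ≤ a := by exact_mod_cast (by omega : a1 ≤ a)
    nlinarith
  have b2 : C * S2 ≤ c * a := by
    rw [div_le_iff₀ hc] at ha2
    have : (a2 : ℝ) ≤ a := by exact_mod_cast (by omega : a2 ≤ a)
    nlinarith
  obtain ⟨x1, x2⟩ := x
  obtain ⟨hx1, hx2⟩ := hx
  simp only at hx1 hx2
  obtain ⟨m1, rfl⟩ := Int.eq_ofNat_of_zero_le hx1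
  obtain ⟨m2, rfl⟩ := Int.eq_ofNat_of_zero_le hx2
  set x : ℤ × ℤ := ((m1 : ℤ), (m2 : ℤ)) with hxd
  set S : ℤ × ℤ → ℝ := fun d => if x - d ∈ Q then 0 else f (x - d) with hS
  have et : ∑' d, revWSb γ (-d) * (if x + d ∈ Q then 0 else f (x + d)) = ∑' d, revWSb γ d * S d := by
    rw [← (Equiv.neg (ℤ × ℤ)).tsum_eq]
    refine tsum_congr fun d => ?_
    simp [hS, sub_eq_add_neg]
  have sf : Summable (fun d => revWSb γ d * f (x - d)) := by
    rw [← (Equiv.neg (ℤ × ℤ)).summable_iff]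
    refine hsum.congr fun d => ?_
    simp [Function.comp]
  have sS : Summable (fun d => revWSb γ d * S d) := by
    refine Summable.of_norm_bounded sf.norm fun d => ?_
    simp only [hS]
    split_ifs
    · simp only [mul_zero, norm_zero]; positivity
    · exact le_rfl
  have sA : Summable (fun i : ℕ => γ ^ i * S ((i : ℤ) + 1, 0)) := by
    have := (sS.comp_injective (i := fun i : ℕ => (((i : ℤ) + 1, 0) : ℤ × ℤ))
      (by intro a b h; simpa using h)).mul_left (sbα γ * γ)⁻¹
    refine this.congr fun i => ?_
    simp only [Function.comp, rev1]
    rw [pow_succ]; field_simp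
  have sC : Summable (fun i : ℕ => (sbθ γ) ^ i * S (-1, (i : ℤ))) := by
    have := (sS.comp_injective (i := fun i : ℕ => ((-1, (i : ℤ)) : ℤ × ℤ))
      (by intro a b h; simpa using h)).mul_left (sbα γ * γ⁻¹)⁻¹
    refine this.congr fun i => ?_
    simp only [Function.comp, rev3]
    field_simp
  have sA' : HasSum (fun i : ℕ => γ ^ (i + 1) * S ((i : ℤ) + 1, 0)) (γ * ∑' i : ℕ, γ ^ i * S ((i : ℤ) + 1, 0)) := by
    have := sA.hasSum.mul_left γ
    refine this.congr_fun fun i => ?_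
    rw [pow_succ]; ring
  rw [et, (hasSum_rev sA' sC.hasSum).tsum_eq]
  have n1 : 0 ≤ ∑' i : ℕ, γ ^ i * S ((i : ℤ) + 1, 0) := by
    obtain ⟨A, hA, hA1, hA2⟩ := hl m2 (by positivity)
    have ev : ∀ j : ℕ, S (((j + m1 : ℕ) : ℤ) + 1, 0) = f (-((j : ℤ) + 1), m2) := by
      intro j
      have e : x - (((j + m1 : ℕ) : ℤ) + 1, 0) = (-((j : ℤ) + 1), (m2 : ℤ)) := by
        rw [hxd]; ext <;> simp; ring
      simp only [hS, e]
      rw [if_neg]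
      rintro ⟨h, -⟩
      simp only at h; omega
    refine geo_nonneg hγ0 (n := m1) (a := a) hC hA (by omega) s1 b1 ?_ sA ?_ ?_ ?_
    · intro i hi
      simp only [hS]
      rw [if_pos]
      constructor
      · simp [hxd]; omega
      · simp [hxd]
    · intro j hj
      rw [ev]
      apply h0
      · simp only; omega
      · simp only; omega
    · have := ev 0
      rw [zero_add] at this
      rw [this]; simpa using hA1
    · intro j hj
      rw [ev]; exact hA2 j hj
  have n2 : 0 ≤ ∑' i : ℕ, (sbθ γ) ^ i * S (-1, (i : ℤ)) := by
    obtain ⟨A, hA, hA1, hA2⟩ := hr (m1 + 1) (by positivity)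
    have ev : ∀ j : ℕ, S (-1, ((j + (m2 + 1) : ℕ) : ℤ)) = f ((m1 : ℤ) + 1, -((j : ℤ) + 1)) := by
      intro j
      have e : x - (-1, ((j + (m2 + 1) : ℕ) : ℤ)) = ((m1 : ℤ) + 1, -((j : ℤ) + 1)) := by
        rw [hxd]; ext <;> simp; ring
      simp only [hS, e]
      rw [if_neg]
      rintro ⟨-, h⟩
      simp only at h; omega
    refine geo_nonneg hθ0 (n := m2 + 1) (a := a) hC hA (by omega) s2 b2 ?_ sC ?_ ?_ ?_
    · intro i hi
      simp only [hS]
      rw [if_pos]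
      constructor
      · simp [hxd]; omega
      · simp [hxd]; omega
    · intro j hj
      rw [ev]
      apply h0
      · simp only; omega
      · simp only; omega
    · have := ev 0
      rw [zero_add] at this
      rw [this]; simpa using hA1
    · intro j hj
      rw [ev]; exact hA2 j hj
  have n3 : S (0, -1) = 0 := by
    simp only [hS]
    rw [if_pos]
    constructor
    · simp [hxd]
    · simp [hxd]; omega
  rw [n3]
  positivity

end SB

namespace SB

/-- behaviour near the boundary of the cone -/
structure Bdy (P : Par) (H : ℂ → ℝ) (e c C : ℝ) (N : ℕ) : Prop where
  c0 : 0 < c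
  C0 : 0 < C
  nn : ∀ X1 X2 : ℝ, 0 ≤ X1 → 0 ≤ X2 → 0 ≤ H (ZZ P X1 X2)
  l1 : ∀ X1 X2 : ℝ, 0 ≤ X1 → 1 ≤ X2 → c * X1 * X2 ^ e ≤ H (ZZ P X1 X2)
  l2 : ∀ X1 X2 : ℝ, 1 ≤ X1 → 0 ≤ X2 → c * X2 * X1 ^ e ≤ H (ZZ P X1 X2)
  o1 : ∀ k X2 : ℝ, 0 ≤ k → 1 ≤ X2 → -(C * X2 ^ e * (k + k ^ N)) ≤ H (ZZ P (-k) X2)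
  o2 : ∀ k X1 : ℝ, 0 ≤ k → 1 ≤ X1 → -(C * X1 ^ e * (k + k ^ N)) ≤ H (ZZ P X1 (-k))

theorem G_low1 (P : Par) : ∃ c : ℝ, 0 < c ∧ ∀ q X1 X2 : ℝ, q ∈ Set.Icc 2 (P.p + 2) → 0 ≤ X1 → 1 ≤ X2 →
    c * X1 * X2 ^ (q - 1) ≤ G q P.p (ZZ P X1 X2) := by
  obtain ⟨c, C, hc, -, h⟩ := u_bounds P
  have b := P.h2
  set m := min 1 (P.r2 ^ P.p) with hm
  have m0 : 0 < m := by rw [hm]; positivity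
  refine ⟨c * m, by positivity, fun q X1 X2 hq h1 h2 => ?_⟩
  have hX : 0 < X2 := by linarith
  refine le_trans ?_ (h q X1 X2 h1 hX.le (by linarith)).1
  have g := ZZ_ge2 P h1 hX.le
  have hm2 : m ≤ P.r2 ^ (q - 2) := by
    rcases le_total 1 P.r2 with h | h
    · exact (min_le_left _ _).trans (Real.one_le_rpow h (by linarith [hq.1]))
    · exact (min_le_right _ _).trans (Real.rpow_le_rpow_of_exponent_ge b h (by linarith [hq.2]))
  calc c * m * X1 * X2 ^ (q - 1) = c * (m * X2 ^ (q - 2) * (X1 * X2)) := by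
        rw [show q - 1 = (q - 2) + 1 by ring, Real.rpow_add hX, Real.rpow_one]; ring
    _ ≤ c * (P.r2 ^ (q - 2) * X2 ^ (q - 2) * (X1 * X2)) := by gcongr
    _ = c * ((X2 * P.r2) ^ (q - 2) * (X1 * X2)) := by rw [Real.mul_rpow hX.le b.le]; ring
    _ ≤ _ := by
      have : 0 ≤ q - 2 := by linarith [hq.1]
      gcongr

/-- boundary behaviour of `G q p + l * G q' m` -/
theorem bdy_exists (P : Par) {q q' m : ℝ} (hq : q ∈ Set.Icc 2 (P.p + 2)) (hq'0 : 0 < q') (hq' : q' ≤ q)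
    (hm0 : 0 < m) (hm : m ≤ P.p) (l : ℝ) (hl : 0 ≤ l) :
    ∃ c C N, Bdy P (fun z => G q P.p z + l * G q' m z) (q - 1) c C N := by
  have hp := P.p_gt
  have hq0 : 0 < q := by linarith [hq.1]
  obtain ⟨c1, hc1, L1⟩ := G_low1 P
  obtain ⟨c2, hc2, L2⟩ := G_low1 P.swap
  obtain ⟨C1, N1, hC1, -, B1⟩ := bdry P hq0 (by linarith : 0 < P.p) le_rfl
  obtain ⟨C2, N2, hC2, -, B2⟩ := bdry P.swap hq0 (by linarith : 0 < P.p) le_rfl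
  obtain ⟨C3, N3, hC3, -, B3⟩ := bdry P hq'0 hm0 hm
  obtain ⟨C4, N4, hC4, -, B4⟩ := bdry P.swap hq'0 hm0 hm
  have key : ∀ (C C' X k : ℝ) (N : ℕ) (A B : ℝ), 0 < C → 0 < C' → 1 ≤ X → 0 ≤ k →
      C ≤ C1 + C2 → C' ≤ C3 + C4 →
      -(C * X ^ (q - 1) * (k + k ^ N)) ≤ A → -(C' * X ^ (q' - 1) * (k + k ^ N)) ≤ B →
      -((C1 + C2 + l * (C3 + C4)) * X ^ (q - 1) * (k + k ^ N)) ≤ A + l * B := by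
    intro C C' X k N A B hC hC' hX hk e1 e2 h1 h2
    have hX0 : 0 < X := by linarith
    have m1 : X ^ (q' - 1) ≤ X ^ (q - 1) := Real.rpow_le_rpow_of_exponent_le hX (by linarith)
    have m2 : C' * X ^ (q' - 1) * (k + k ^ N) ≤ (C3 + C4) * X ^ (q - 1) * (k + k ^ N) := by
      have := hC'.le.trans e2
      gcongr
    have m3 : C * X ^ (q - 1) * (k + k ^ N) ≤ (C1 + C2) * X ^ (q - 1) * (k + k ^ N) := by
      gcongr
    have m4 := mul_le_mul_of_nonneg_left (h2.trans' (neg_le_neg m2)) hl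
    nlinarith
  refine ⟨min c1 c2, C1 + C2 + l * (C3 + C4), N1 + N2 + N3 + N4, ⟨by positivity, by positivity, ?_, ?_, ?_, ?_, ?_⟩⟩
  · intro X1 X2 h1 h2
    have := G_nonneg P (q := q) (by linarith) le_rfl h1 h2
    have := G_nonneg P (q := q') hm0.le hm h1 h2
    positivity
  · intro X1 X2 h1 h2
    have a1 := L1 q X1 X2 hq h1 h2
    have a2 := G_nonneg P (q := q') hm0.le hm h1 (by linarith : 0 ≤ X2)
    have : min c1 c2 * X1 * X2 ^ (q - 1) ≤ c1 * X1 * X2 ^ (q - 1) := by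
      gcongr; exact min_le_left _ _
    have := mul_nonneg hl a2
    linarith
  · intro X1 X2 h1 h2
    have a1 := L2 q X2 X1 hq h2 h1
    have a2 := G_nonneg P (q := q') hm0.le hm (by linarith : 0 ≤ X1) h2
    have : min c1 c2 * X2 * X1 ^ (q - 1) ≤ c2 * X2 * X1 ^ (q - 1) := by
      gcongr; exact min_le_right _ _
    have := mul_nonneg hl a2
    rw [← G_swap] at a1
    have e : P.swap.p = P.p := rfl
    rw [e] at a1
    linarith
  · intro k X2 hk h2
    exact key C1 C3 X2 k _ _ _ hC1 hC3 h2 hk (by linarith) (by linarith)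
      (B1 _ (by omega) X2 k h2 hk) (B3 _ (by omega) X2 k h2 hk)
  · intro k X1 hk h2
    rw [G_swap P q, G_swap P q']
    exact key C2 C4 X1 k _ _ _ hC2 hC4 h2 hk (by linarith) (by linarith)
      (B2 _ (by omega) X1 k h2 hk) (B4 _ (by omega) X1 k h2 hk)

/-- shifted coordinates -/
def Za (P : Par) (a : ℝ) (x : ℤ × ℤ) : ℂ := ZZ P (x.1 + a) (x.2 + a)

theorem Za_add (P : Par) (a : ℝ) (x d : ℤ × ℤ) : Za P a (x + d) = Za P a x + ZZ P d.1 d.2 := by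
  unfold Za
  rw [← ZZ_add]
  simp only [Prod.fst_add, Prod.snd_add]
  push_cast
  congr 1 <;> ring

theorem Bdy.out {P : Par} {H : ℂ → ℝ} {e c C : ℝ} {N : ℕ} (h : Bdy P H e c C N) {μ : ℤ × ℤ → ℝ}
    (ho : OutGood μ) : ∃ a0 : ℕ, ∀ a : ℕ, a0 ≤ a → ∀ x ∈ Q, Summable (fun d => μ d * H (Za P a (x + d))) →
      0 ≤ ∑' d, μ d * (if x + d ∈ Q then 0 else H (Za P a (x + d))) := by
  have hc := h.c0
  have hC := h.C0
  obtain ⟨a0, h0⟩ := ho (N + 1) (c / 2) (2 * C) (by linarith) (by linarith)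
  refine ⟨a0 + 2, fun a ha x hx hs => ?_⟩
  have ha2 : (2 : ℝ) ≤ a := by exact_mod_cast (by omega : 2 ≤ a)
  have pk : ∀ (j : ℕ) (A : ℝ), 0 ≤ A → a ≤ j →
      C * A * (((j : ℝ) + 1 - a) + ((j : ℝ) + 1 - a) ^ N) ≤ A * (2 * C) * ((j : ℝ) + 1) ^ (N + 1) := by
    intro j A hA hj
    have hj' : (a : ℝ) ≤ j := by exact_mod_cast hj
    have k0 : 0 ≤ (j : ℝ) + 1 - a := by linarith
    have e1 : (j : ℝ) + 1 - a ≤ ((j : ℝ) + 1) ^ (N + 1) :=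
      (by linarith : (j : ℝ) + 1 - a ≤ (j : ℝ) + 1).trans (le_self_pow₀ (by linarith) (by omega))
    have e2 : ((j : ℝ) + 1 - a) ^ N ≤ ((j : ℝ) + 1) ^ (N + 1) :=
      calc _ ≤ ((j : ℝ) + 1) ^ N := by gcongr; linarith
        _ ≤ _ := pow_le_pow_right₀ (by linarith) (by omega)
    have : 0 ≤ C * A := by positivity
    nlinarith
  refine h0 a (by omega) (fun y => H (Za P a y)) ?_ ?_ ?_ x hx hs
  · intro y h1 h2
    have h1' : -(a : ℝ) ≤ y.1 := by exact_mod_cast h1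
    have h2' : -(a : ℝ) ≤ y.2 := by exact_mod_cast h2
    exact h.nn _ _ (by linarith) (by linarith)
  · intro t ht
    have ht' : (0 : ℝ) ≤ t := by exact_mod_cast ht
    have hA : 0 ≤ ((t : ℝ) + a) ^ e := by positivity
    refine ⟨((t : ℝ) + a) ^ e, hA, ?_, ?_⟩
    · have := h.l1 (-1 + a) (t + a) (by linarith) (by linarith)
      simp only [Za]
      push_cast
      refine le_trans ?_ this
      refine mul_le_mul_of_nonneg_right ?_ hA
      nlinarith
    · intro j hj
      have hj' : (a : ℝ) ≤ j := by exact_mod_cast hj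
      have := h.o1 ((j : ℝ) + 1 - a) (t + a) (by linarith) (by linarith)
      have e1 : Za P a (-((j : ℤ) + 1), t) = ZZ P (-((j : ℝ) + 1 - a)) (t + a) := by
        simp only [Za]; push_cast; congr 1; ring
      rw [e1]
      have := pk j _ hA hj
      linarith
  · intro t ht
    have ht' : (0 : ℝ) ≤ t := by exact_mod_cast ht
    have hA : 0 ≤ ((t : ℝ) + a) ^ e := by positivity
    refine ⟨((t : ℝ) + a) ^ e, hA, ?_, ?_⟩
    · have := h.l2 (t + a) (-1 + a) (by linarith) (by linarith)
      simp only [Za]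
      push_cast
      refine le_trans ?_ this
      refine mul_le_mul_of_nonneg_right ?_ hA
      nlinarith
    · intro j hj
      have hj' : (a : ℝ) ≤ j := by exact_mod_cast hj
      have := h.o2 ((j : ℝ) + 1 - a) (t + a) (by linarith) (by linarith)
      have e1 : Za P a (t, -((j : ℤ) + 1)) = ZZ P (t + a) (-((j : ℝ) + 1 - a)) := by
        simp only [Za]; push_cast; congr 1; ring
      rw [e1]
      have := pk j _ hA hj
      linarith

open ENNReal in
/-- From a bound on the full sum and non-negativity of the outside part. -/
theorem kq_bound {μ : ℤ × ℤ → ℝ} (h0 : ∀ d, 0 ≤ μ d) {x : ℤ × ℤ} (hx : x ∈ Q) {f : ℤ × ℤ → ℝ}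
    (hf : ∀ y ∈ Q, 0 ≤ f y) (hs : Summable (fun d => μ d * f (x + d)))
    (ho : 0 ≤ ∑' d, μ d * (if x + d ∈ Q then 0 else f (x + d))) {B : ℝ}
    (hB : ∑' d, μ d * f (x + d) ≤ B) :
    0 ≤ B ∧ ∑' y, kq μ x y * ENNReal.ofReal (f y) ≤ ENNReal.ofReal B := by
  have s1 : Summable (fun d => μ d * (if x + d ∈ Q then 0 else f (x + d))) := by
    refine Summable.of_norm_bounded hs.norm fun d => ?_
    split_ifs
    · simp only [mul_zero, norm_zero]; positivity
    · exact le_rfl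
  have h2 := hs.hasSum.sub s1.hasSum
  have h3 : HasSum (fun d => if x + d ∈ Q then μ d * f (x + d) else 0)
      (∑' d, μ d * f (x + d) - ∑' d, μ d * (if x + d ∈ Q then 0 else f (x + d))) := by
    refine hs_congr h2 (fun d => ?_) rfl
    split_ifs <;> simp
  have h4 := kq_super h0 hx hf h3
  have h5 : 0 ≤ ∑' d, μ d * f (x + d) - ∑' d, μ d * (if x + d ∈ Q then 0 else f (x + d)) := by
    refine h3.nonneg fun d => ?_
    split_ifs with h
    · exact mul_nonneg (h0 d) (hf _ h)
    · exact le_rfl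
  refine ⟨by linarith, ?_⟩
  rw [h4]
  exact ENNReal.ofReal_le_ofReal (by linarith)

end SB

namespace SB

theorem asy {c C : ℝ} (hc : 0 < c) : ∃ R : ℝ, 1 ≤ R ∧ ∀ r e : ℝ, R ≤ r →
    C * r ^ (e - 1 / 2) ≤ c * r ^ e := by
  refine ⟨max 1 ((C / c) ^ 2), le_max_left _ _, fun r e hr => ?_⟩
  have r1 : 1 ≤ r := (le_max_left _ _).trans hr
  have r0 : 0 < r := by linarith
  have h1 : C / c ≤ r ^ (1 / 2 : ℝ) := by
    rw [← Real.sqrt_eq_rpow]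
    exact Real.le_sqrt_of_sq_le ((le_max_right _ _).trans hr)
  rw [div_le_iff₀ hc] at h1
  have : r ^ e = r ^ (e - 1 / 2) * r ^ (1 / 2 : ℝ) := by
    rw [← Real.rpow_add r0]; congr 1; ring
  rw [this]
  have : 0 < r ^ (e - 1 / 2) := by positivity
  nlinarith

/-- exponent of the correction -/
def Par.q (P : Par) : ℝ := P.p - 1 / 2
/-- angular frequency of the correction -/
def Par.m (P : Par) : ℝ := P.p - 1 / 4

/-- the correction function -/
def wf (P : Par) (z : ℂ) : ℝ := G P.q P.m z
/-- the harmonic function -/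
def uf (P : Par) (z : ℂ) : ℝ := G P.p P.p z
/-- the supersolution -/
def Uf (P : Par) (z : ℂ) : ℝ := G P.p P.p z + 1 * G P.q P.m z
/-- growth control -/
def Pf (P : Par) (z : ℂ) : ℝ := G (P.p + 2) P.p z + 0 * G P.q P.m z

theorem Za_pos (P : Par) {a : ℝ} (ha : 1 ≤ a) {x : ℤ × ℤ} (hx : x ∈ Q) :
    0 < (Za P a x).re ∧ a * P.r1 ≤ ‖Za P a x‖ := by
  have h1 : (0 : ℝ) ≤ x.1 := by exact_mod_cast hx.1
  have h2 : (0 : ℝ) ≤ x.2 := by exact_mod_cast hx.2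
  refine ⟨ZZ_re_pos P (by linarith) (by linarith) (by linarith), ?_⟩
  refine le_trans ?_ (ZZ_ge1 P (by linarith) (by linarith))
  have := P.h1
  gcongr; linarith

/-- the analytic drift of the correction -/
theorem drift {μ : ℤ × ℤ → ℝ} {P : Par} {σ2 : ℝ} (h : Geo μ P σ2) :
    ∃ c C : ℝ, 0 < c ∧ 0 < C ∧ ∀ x1 x2 : ℝ, 0 ≤ x1 → 0 ≤ x2 → 1 ≤ ‖ZZ P x1 x2‖ →
      Summable (fun d : ℤ × ℤ => μ d * uf P (ZZ P x1 x2 + ZZ P d.1 d.2)) ∧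
      Summable (fun d : ℤ × ℤ => μ d * wf P (ZZ P x1 x2 + ZZ P d.1 d.2)) ∧
      |∑' d : ℤ × ℤ, μ d * uf P (ZZ P x1 x2 + ZZ P d.1 d.2) - uf P (ZZ P x1 x2)| ≤ C * ‖ZZ P x1 x2‖ ^ (P.p - 3) ∧
      ∑' d : ℤ × ℤ, μ d * wf P (ZZ P x1 x2 + ZZ P d.1 d.2) ≤
        wf P (ZZ P x1 x2) - c * ‖ZZ P x1 x2‖ ^ (P.p - 5 / 2) + C * ‖ZZ P x1 x2‖ ^ (P.p - 3) := by
  have hp := P.p_gt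
  have hσ := h.σpos
  obtain ⟨C1, hC1, T1⟩ := h.taylor (q := P.p) (m := P.p) (by linarith) (by linarith)
  obtain ⟨C2, hC2, T2⟩ := h.taylor (q := P.q) (m := P.m) (by unfold Par.q; linarith)
    (by unfold Par.q Par.m; linarith)
  obtain ⟨cw, hcw, L⟩ := G_lower P (m := P.m) (by unfold Par.m; linarith) (by unfold Par.m; linarith)
  set κ := (P.m ^ 2 - P.q ^ 2) / 4 * σ2 with hκ
  have κ0 : 0 < κ := by
    have : 0 < P.m ^ 2 - P.q ^ 2 := by unfold Par.m Par.q; nlinarith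
    positivity
  refine ⟨cw * κ, C1 + C2, by positivity, by positivity, fun x1 x2 h1 h2 hr => ?_⟩
  have hre : 0 < (ZZ P x1 x2).re := by
    apply ZZ_re_pos P h1 h2
    by_contra hc
    have e1 : x1 = 0 := by linarith
    have e2 : x2 = 0 := by linarith
    rw [e1, e2, ZZ_zero] at hr; norm_num at hr
  obtain ⟨s1, b1⟩ := T1 _ hre hr
  obtain ⟨s2, b2⟩ := T2 _ hre hr
  have Lw := L P.q x1 x2 h1 h2
  set z := ZZ P x1 x2
  have hr0 : 0 < ‖z‖ := by linarith
  have p3 : 0 < ‖z‖ ^ (P.p - 3) := by positivity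
  refine ⟨s1, s2, ?_, ?_⟩
  · rw [sub_self, zero_div, zero_mul, zero_div, add_zero, mul_one] at b1
    refine b1.trans ?_
    nlinarith
  · have b3 := (abs_le.1 b2).2
    have e1 : ‖z‖ ^ (P.q - 3) ≤ ‖z‖ ^ (P.p - 3) :=
      Real.rpow_le_rpow_of_exponent_le hr (by unfold Par.q; linarith)
    have e2 : ‖z‖ ^ P.q = ‖z‖ ^ (P.p - 5 / 2) * ‖z‖ ^ 2 := by
      rw [← Real.rpow_natCast ‖z‖ 2, ← Real.rpow_add hr0]; congr 1; unfold Par.q; push_cast; ring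
    have e3 : G P.q P.m z * (1 + (P.q ^ 2 - P.m ^ 2) / 4 * σ2 / ‖z‖ ^ 2)
        = G P.q P.m z - κ * (G P.q P.m z / ‖z‖ ^ 2) := by rw [hκ]; ring
    have e4 : cw * ‖z‖ ^ (P.p - 5 / 2) ≤ G P.q P.m z / ‖z‖ ^ 2 := by
      rw [le_div_iff₀ (by positivity)]
      refine le_trans (le_of_eq ?_) Lw
      rw [e2]; ring
    have e5 := mul_le_mul_of_nonneg_left e4 κ0.le
    have e6 : C2 * ‖z‖ ^ (P.q - 3) ≤ C2 * ‖z‖ ^ (P.p - 3) := by gcongr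
    have e7 : 0 ≤ C1 * ‖z‖ ^ (P.p - 3) := by positivity
    unfold wf
    nlinarith

theorem barrier_U {μ : ℤ × ℤ → ℝ} {P : Par} {σ2 : ℝ} (h : Geo μ P σ2) (ho : OutGood μ) :
    ∃ a0 : ℕ, 1 ≤ a0 ∧ ∀ a : ℕ, a0 ≤ a → ∀ x,
      ∑' y, kq μ x y * ENNReal.ofReal (Uf P (Za P a y)) ≤ ENNReal.ofReal (Uf P (Za P a x)) := by
  have hp := P.p_gt
  obtain ⟨c, C, N, B⟩ := bdy_exists P (q := P.p) (q' := P.q) (m := P.m) ⟨by linarith, by linarith⟩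
    (by unfold Par.q; linarith) (by unfold Par.q; linarith) (by unfold Par.m; linarith)
    (by unfold Par.m; linarith) 1 zero_le_one
  obtain ⟨a1, h1⟩ := B.out ho
  obtain ⟨cd, Cd, hcd, hCd, D⟩ := drift h
  obtain ⟨R, R1, HR⟩ := asy (c := cd) (C := 2 * Cd) hcd
  obtain ⟨a2, ha2⟩ := exists_nat_ge (R / P.r1)
  refine ⟨a1 + a2 + 1, by omega, fun a ha x => ?_⟩
  by_cases hx : x ∈ Q
  swap
  · rw [kq_out hx]; exact zero_le
  have ha' : (1 : ℝ) ≤ a := by exact_mod_cast (by omega : 1 ≤ a)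
  have ha2' : (a2 : ℝ) ≤ a := by exact_mod_cast (by omega : a2 ≤ a)
  obtain ⟨hre, hr⟩ := Za_pos P ha' hx
  have hrR : R ≤ ‖Za P a x‖ := by
    refine le_trans ?_ hr
    rw [div_le_iff₀ P.h1] at ha2
    have := P.h1
    nlinarith
  have q1 : (0 : ℝ) ≤ x.1 := by exact_mod_cast hx.1
  have q2 : (0 : ℝ) ≤ x.2 := by exact_mod_cast hx.2
  obtain ⟨s1, s2, b1, b2⟩ := D (x.1 + a) (x.2 + a) (by linarith) (by linarith) (R1.trans hrR)
  have e0 : ∀ d, Uf P (Za P a (x + d)) = uf P (Za P a x + ZZ P d.1 d.2) + wf P (Za P a x + ZZ P d.1 d.2) := by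
    intro d; rw [Za_add]; unfold Uf uf wf; ring
  have hs : Summable (fun d => μ d * Uf P (Za P a (x + d))) := by
    refine (s1.add s2).congr fun d => ?_
    rw [e0, mul_add]; rfl
  refine (kq_bound h.nonneg hx (f := fun y => Uf P (Za P a y)) ?_ hs (h1 a (by omega) x hx hs) ?_).2
  · intro y hy
    have q1 : (0 : ℝ) ≤ y.1 := by exact_mod_cast hy.1
    have q2 : (0 : ℝ) ≤ y.2 := by exact_mod_cast hy.2
    exact B.nn _ _ (by linarith) (by linarith)
  · have et : ∑' d, μ d * Uf P (Za P a (x + d)) = ∑' d : ℤ × ℤ, μ d * uf P (Za P a x + ZZ P d.1 d.2)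
        + ∑' d : ℤ × ℤ, μ d * wf P (Za P a x + ZZ P d.1 d.2) := by
      have := s1.tsum_add s2
      simp only [Za] at *
      rw [← this]
      refine tsum_congr fun d => ?_
      rw [e0, mul_add]
    rw [et]
    have b3 := (abs_le.1 b1).2
    have hh := HR _ (P.p - 5 / 2) hrR
    have ee : P.p - 5 / 2 - 1 / 2 = P.p - 3 := by ring
    rw [ee] at hh
    have ef : Uf P (Za P a x) = uf P (Za P a x) + wf P (Za P a x) := by unfold Uf uf wf; ring
    rw [ef]
    simp only [Za] at *
    linarith

theorem Uf_ge (P : Par) : ∃ c : ℝ, 0 < c ∧ ∀ X1 X2 : ℝ, 0 ≤ X1 → 0 ≤ X2 →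
    c * ‖ZZ P X1 X2‖ ^ P.q ≤ Uf P (ZZ P X1 X2) := by
  have hp := P.p_gt
  obtain ⟨cw, hcw, L⟩ := G_lower P (m := P.m) (by unfold Par.m; linarith) (by unfold Par.m; linarith)
  refine ⟨cw, hcw, fun X1 X2 h1 h2 => ?_⟩
  have := L P.q X1 X2 h1 h2
  have := G_nonneg P (q := P.p) (by linarith) le_rfl h1 h2
  unfold Uf
  linarith

theorem barrier_P {μ : ℤ × ℤ → ℝ} {P : Par} {σ2 : ℝ} (h : Geo μ P σ2) (ho : OutGood μ) :
    ∃ (a0 : ℕ) (C : ℝ), 0 < C ∧ 1 ≤ a0 ∧ ∀ a : ℕ, a0 ≤ a → ∀ x,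
      ∑' y, kq μ x y * ENNReal.ofReal (Pf P (Za P a y)) ≤
        ENNReal.ofReal (Pf P (Za P a x)) + ENNReal.ofReal C * ENNReal.ofReal (Uf P (Za P a x)) := by
  have hp := P.p_gt
  have hσ := h.σpos
  obtain ⟨c, C, N, B⟩ := bdy_exists P (q := P.p + 2) (q' := P.q) (m := P.m) ⟨by linarith, by linarith⟩
    (by unfold Par.q; linarith) (by unfold Par.q; linarith) (by unfold Par.m; linarith)
    (by unfold Par.m; linarith) 0 le_rfl
  obtain ⟨a1, h1⟩ := B.out ho
  obtain ⟨C1, hC1, T1⟩ := h.taylor (q := P.p + 2) (m := P.p) (by linarith) (by linarith)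
  obtain ⟨cu, hcu, Lu⟩ := Uf_ge P
  obtain ⟨a2, ha2⟩ := exists_nat_ge (1 / P.r1)
  set D := ((P.p + 2) ^ 2 - P.p ^ 2) / 4 * σ2 with hD
  have D0 : 0 < D := by
    have : 0 < (P.p + 2) ^ 2 - P.p ^ 2 := by nlinarith
    positivity
  refine ⟨a1 + a2 + 1, D + C1 / cu, by positivity, by omega, fun a ha x => ?_⟩
  by_cases hx : x ∈ Q
  swap
  · rw [kq_out hx]; exact zero_le
  have ha' : (1 : ℝ) ≤ a := by exact_mod_cast (by omega : 1 ≤ a)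
  have ha2' : (a2 : ℝ) ≤ a := by exact_mod_cast (by omega : a2 ≤ a)
  obtain ⟨hre, hr⟩ := Za_pos P ha' hx
  have hrR : 1 ≤ ‖Za P a x‖ := by
    refine le_trans ?_ hr
    rw [div_le_iff₀ P.h1] at ha2
    have := P.h1
    nlinarith
  have q1 : (0 : ℝ) ≤ x.1 := by exact_mod_cast hx.1
  have q2 : (0 : ℝ) ≤ x.2 := by exact_mod_cast hx.2
  obtain ⟨s1, b1⟩ := T1 _ hre hrR
  have e0 : ∀ d, Pf P (Za P a (x + d)) = G (P.p + 2) P.p (Za P a x + ZZ P d.1 d.2) := by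
    intro d; rw [Za_add]; unfold Pf; ring
  have hs : Summable (fun d => μ d * Pf P (Za P a (x + d))) := by
    refine s1.congr fun d => ?_
    rw [e0]
  have nnP : 0 ≤ Pf P (Za P a x) := B.nn _ _ (by linarith) (by linarith)
  have Lux := Lu (x.1 + a) (x.2 + a) (by linarith) (by linarith)
  have uu := G_nonneg P (q := P.q) (m := P.m) (by unfold Par.m; linarith) (by unfold Par.m; linarith)
    (by linarith : 0 ≤ (x.1 : ℝ) + a) (by linarith : 0 ≤ (x.2 : ℝ) + a)
  have nnU : 0 ≤ Uf P (Za P a x) := le_trans (by positivity) Lux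
  rw [← ENNReal.ofReal_mul (by positivity), ← ENNReal.ofReal_add nnP (by positivity)]
  refine (kq_bound h.nonneg hx (f := fun y => Pf P (Za P a y)) ?_ hs (h1 a (by omega) x hx hs) ?_).2
  · intro y hy
    have q1 : (0 : ℝ) ≤ y.1 := by exact_mod_cast hy.1
    have q2 : (0 : ℝ) ≤ y.2 := by exact_mod_cast hy.2
    exact B.nn _ _ (by linarith) (by linarith)
  · rw [tsum_congr (fun d => by rw [e0])]
    have b3 := (abs_le.1 b1).2
    have eP : Pf P (Za P a x) = G (P.p + 2) P.p (Za P a x) := by unfold Pf; ring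
    rw [eP]
    change 0 ≤ G P.q P.m (Za P a x) at uu
    change cu * ‖Za P a x‖ ^ P.q ≤ Uf P (Za P a x) at Lux
    set z := Za P a x
    have hr0 : 0 < ‖z‖ := by linarith
    have e1 : G (P.p + 2) P.p z * (1 + ((P.p + 2) ^ 2 - P.p ^ 2) / 4 * σ2 / ‖z‖ ^ 2)
        = G (P.p + 2) P.p z + D * G P.p P.p z := by
      have : G (P.p + 2) P.p z = G P.p P.p z * ‖z‖ ^ 2 := by
        unfold G
        rw [Real.rpow_add hr0]
        rw [show ‖z‖ ^ (2 : ℝ) = ‖z‖ ^ 2 by exact_mod_cast Real.rpow_natCast ‖z‖ 2]; ring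
      rw [this, ← hD]; field_simp
    have e2 : ‖z‖ ^ (P.p + 2 - 3) ≤ ‖z‖ ^ P.q :=
      Real.rpow_le_rpow_of_exponent_le hrR (by unfold Par.q; linarith)
    have e3 : C1 * ‖z‖ ^ (P.p + 2 - 3) ≤ C1 / cu * Uf P z := by
      rw [div_mul_eq_mul_div, le_div_iff₀ hcu]
      calc _ ≤ C1 * ‖z‖ ^ P.q * cu := by gcongr
        _ = C1 * (cu * ‖z‖ ^ P.q) := by ring
        _ ≤ _ := by gcongr
    have e4 : G P.p P.p z ≤ Uf P z := by unfold Uf; linarith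
    have e5 := mul_le_mul_of_nonneg_left e4 D0.le
    linarith

theorem barrier_F {μ : ℤ × ℤ → ℝ} {s11 s12 s22 : ℝ} (h : Law μ s11 s12 s22) (ho : OutGood μ) (h12 : s12 < 0) :
    ∃ b : ℕ, 1 ≤ b ∧ ∀ x ∈ Q,
      ∑' y, kq μ x y * ENNReal.ofReal (((y.1 : ℝ) + b) * ((y.2 : ℝ) + b)) + ENNReal.ofReal (-s12) ≤
        ENNReal.ofReal (((x.1 : ℝ) + b) * ((x.2 : ℝ) + b)) := by
  obtain ⟨a0, h0⟩ := ho 1 (1 / 2) 1 (by norm_num) (by norm_num)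
  refine ⟨a0 + 2, by omega, fun x hx => ?_⟩
  have h1 := h0 (a0 + 2) (by omega)
  generalize hb : a0 + 2 = b at h1
  have b2 : (2 : ℝ) ≤ b := by exact_mod_cast (by omega : 2 ≤ b)
  set f : ℤ × ℤ → ℝ := fun y => ((y.1 : ℝ) + b) * ((y.2 : ℝ) + b) with hf
  have hsum : HasSum (fun d => μ d * f (x + d)) (f x + s12) := by
    have := ((h.mass.mul_left (f x)).add ((h.mean1.mul_left ((x.2 : ℝ) + b)).add
      (h.mean2.mul_left ((x.1 : ℝ) + b)))).add h.cov
    refine hs_congr this (fun d => ?_) ?_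
    · simp only [hf, Prod.fst_add, Prod.snd_add]; push_cast; ring
    · ring
  have hfQ : ∀ y : ℤ × ℤ, -(b : ℤ) ≤ y.1 → -(b : ℤ) ≤ y.2 → 0 ≤ f y := by
    intro y h1 h2
    have h1' : -(b : ℝ) ≤ y.1 := by exact_mod_cast h1
    have h2' : -(b : ℝ) ≤ y.2 := by exact_mod_cast h2
    exact mul_nonneg (by linarith) (by linarith)
  have hout := h1 f hfQ ?_ ?_ x hx hsum.summable
  · have hq : ∀ y ∈ Q, 0 ≤ f y := by
      intro y hy
      obtain ⟨u1, u2⟩ := hy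
      apply hfQ <;> omega
    obtain ⟨k1, k2⟩ := kq_bound h.nonneg hx hq hsum.summable hout (B := f x + s12) hsum.tsum_eq.le
    refine (add_le_add_left k2 _).trans ?_
    rw [← ENNReal.ofReal_add k1 (by linarith)]
    apply ENNReal.ofReal_le_ofReal
    simp only [hf]; linarith
  · intro t ht
    have ht' : (0 : ℝ) ≤ t := by exact_mod_cast ht
    refine ⟨t + b, by positivity, ?_, ?_⟩
    · simp only [hf]; push_cast
      refine mul_le_mul_of_nonneg_right ?_ (by positivity)
      linarith
    · intro j hj
      simp only [hf]; push_cast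
      have : (0 : ℝ) ≤ (t + b) * b := by positivity
      nlinarith
  · intro t ht
    have ht' : (0 : ℝ) ≤ t := by exact_mod_cast ht
    refine ⟨t + b, by positivity, ?_, ?_⟩
    · simp only [hf]; push_cast
      rw [mul_comm ((t : ℝ) + b)]
      refine mul_le_mul_of_nonneg_right ?_ (by positivity)
      linarith
    · intro j hj
      simp only [hf]; push_cast
      have : (0 : ℝ) ≤ (t + b) * b := by positivity
      nlinarith

end SB

namespace SB
open Complex

theorem sin_ge {s t : ℝ} (hs : 0 ≤ s) (h1 : s ≤ t) (h2 : t ≤ Real.pi - s) : Real.sin s ≤ Real.sin t := by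
  rcases le_total t (Real.pi / 2) with h | h
  · exact Real.sin_le_sin_of_le_of_le_pi_div_two (by linarith [Real.pi_pos]) h h1
  · rw [← Real.sin_pi_sub t]
    exact Real.sin_le_sin_of_le_of_le_pi_div_two (by linarith [Real.pi_pos]) (by linarith) (by linarith)

theorem lin_ge (a : ℝ) (ζ : ℂ) : -‖ζ‖ ≤ Real.sin a * ζ.re - Real.cos a * ζ.im := by
  rw [← polar]
  have := Real.neg_one_le_sin (a - arg ζ)
  have := norm_nonneg ζ
  nlinarith

theorem lin_ge' (a : ℝ) (ζ : ℂ) : -‖ζ‖ ≤ Real.sin a * ζ.re + Real.cos a * ζ.im := by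
  rw [← polar']
  have := Real.neg_one_le_sin (a + arg ζ)
  have := norm_nonneg ζ
  nlinarith

theorem near_out (P : Par) : ∃ c : ℝ, 0 < c ∧ c ≤ 1 ∧ ∀ X1 X2 Y1 Y2 : ℝ, ∀ ζ : ℂ, 0 ≤ X1 → 0 ≤ X2 → 0 < X1 + X2 →
    ZZ P Y1 Y2 = ZZ P X1 X2 + ζ → ‖ζ‖ ≤ c * ‖ZZ P X1 X2‖ → (Y1 < 0 ∨ Y2 < 0) →
    uf P (ZZ P Y1 Y2) ≤ 0 ∧ 0 ≤ wf P (ZZ P Y1 Y2) := by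
  have hp := P.p_gt
  have hpi := Real.pi_pos
  have hψ := P.hψ0
  have hψ1 := P.hψ1
  have pm := P.p_mul
  have hm : 1 < P.m := by unfold Par.m; linarith
  set β := Real.pi / (2 * P.m) with hβ
  have β0 : 0 < β := by positivity
  have mβ : P.m * β = Real.pi / 2 := by rw [hβ]; field_simp
  have β1 : β < Real.pi / 2 := by
    rw [hβ]; apply div_lt_div_of_pos_left hpi (by norm_num); linarith
  have β2 : P.ψ / 2 < β := by
    have : P.m * (P.ψ / 2) < P.m * β := by
      rw [mβ]
      have : P.m * (P.ψ / 2) < P.p * (P.ψ / 2) := by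
        apply mul_lt_mul_of_pos_right _ (by linarith)
        unfold Par.m; linarith
      linarith
    exact lt_of_mul_lt_mul_left this (by linarith)
  have s0 : 0 < Real.sin (β - P.ψ / 2) := Real.sin_pos_of_pos_of_lt_pi (by linarith) (by linarith)
  have c0 := P.cos2_pos
  set c := min (Real.sin (β - P.ψ / 2)) (Real.cos (P.ψ / 2)) / 2 with hc
  have cpos : 0 < c := by rw [hc]; have := lt_min s0 c0; linarith
  have c1 : c < Real.sin (β - P.ψ / 2) := by
    have := min_le_left (Real.sin (β - P.ψ / 2)) (Real.cos (P.ψ / 2)); linarith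
  have c2 : c < Real.cos (P.ψ / 2) := by
    have := min_le_right (Real.sin (β - P.ψ / 2)) (Real.cos (P.ψ / 2)); linarith
  refine ⟨c, cpos, by linarith [Real.cos_le_one (P.ψ / 2)], fun X1 X2 Y1 Y2 ζ h1 h2 h3 e hζ hY => ?_⟩
  have hre := ZZ_re_pos P h1 h2 h3
  have harg := abs_le.1 (ZZ_arg P h1 h2)
  have A1 := ZZ_s1 P Y1 Y2
  have A2 := ZZ_s2 P Y1 Y2
  set z := ZZ P X1 X2
  set y := ZZ P Y1 Y2
  have hn : 0 < ‖z‖ := by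
    rw [norm_pos_iff]; intro h; rw [h] at hre; simp at hre
  have yre : 0 < y.re := by
    have a1 : Real.cos (P.ψ / 2) * ‖z‖ ≤ z.re := by
      rw [← Complex.norm_mul_cos_arg z, mul_comm]
      refine mul_le_mul_of_nonneg_left ?_ hn.le
      rw [← Real.cos_abs (arg z)]
      exact Real.cos_le_cos_of_nonneg_of_le_pi (abs_nonneg _) (by linarith) (abs_le.2 harg)
    have a2 := (abs_le.1 (Complex.abs_re_le_norm ζ)).1
    rw [e, Complex.add_re]
    have := mul_lt_mul_of_pos_right c2 hn
    linarith
  have yn : 0 < ‖y‖ := by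
    rw [norm_pos_iff]; intro h; rw [h] at yre; simp at yre
  have b1 : 0 ≤ Real.sin (β - arg y) := by
    refine nonneg_of_mul_nonneg_right (a := ‖y‖) ?_ yn
    rw [polar, e, Complex.add_re, Complex.add_im]
    have d1 := polar β z
    have d2 : Real.sin (β - P.ψ / 2) ≤ Real.sin (β - arg z) := sin_ge (by linarith) (by linarith) (by linarith)
    have d3 := lin_ge β ζ
    have d4 := mul_le_mul_of_nonneg_left d2 hn.le
    have d5 := mul_lt_mul_of_pos_right c1 hn
    linarith
  have b2 : 0 ≤ Real.sin (β + arg y) := by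
    refine nonneg_of_mul_nonneg_right (a := ‖y‖) ?_ yn
    rw [polar', e, Complex.add_re, Complex.add_im]
    have d1 := polar' β z
    have d2 : Real.sin (β - P.ψ / 2) ≤ Real.sin (β + arg z) := sin_ge (by linarith) (by linarith) (by linarith)
    have d3 := lin_ge' β ζ
    have d4 := mul_le_mul_of_nonneg_left d2 hn.le
    have d5 := mul_lt_mul_of_pos_right c1 hn
    linarith
  have k1 := arg_le_of yre β0.le b1
  have k2 := arg_ge_of yre β0.le b2
  have k3 : |arg y| ≤ β := abs_le.2 ⟨k2, k1⟩
  have k4 : P.ψ / 2 ≤ |arg y| := by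
    by_contra hcon
    push Not at hcon
    have hcon := abs_lt.1 hcon
    have f1 := P.sin_pos
    have f2 := P.h1
    have f3 := P.h2
    rcases hY with hY | hY
    · have : 0 < ‖y‖ * Real.sin (P.ψ / 2 - arg y) :=
        mul_pos yn (Real.sin_pos_of_pos_of_lt_pi (by linarith) (by linarith))
      rw [A1] at this
      have : Y1 * P.r1 * Real.sin P.ψ < 0 := mul_neg_of_neg_of_pos (mul_neg_of_neg_of_pos hY f2) f1
      linarith
    · have : 0 < ‖y‖ * Real.sin (P.ψ / 2 + arg y) :=
        mul_pos yn (Real.sin_pos_of_pos_of_lt_pi (by linarith) (by linarith))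
      rw [A2] at this
      have : Y2 * P.r2 * Real.sin P.ψ < 0 := mul_neg_of_neg_of_pos (mul_neg_of_neg_of_pos hY f3) f1
      linarith
  constructor
  · apply mul_nonpos_of_nonneg_of_nonpos (by positivity)
    rw [← Real.cos_abs, abs_mul, abs_of_pos (by linarith : 0 < P.p)]
    apply Real.cos_nonpos_of_pi_div_two_le_of_le
    · calc Real.pi / 2 = P.p * (P.ψ / 2) := by linarith
        _ ≤ _ := by gcongr
    · calc _ ≤ P.p * β := by gcongr
        _ ≤ (3 * P.m) * β := by
          refine mul_le_mul_of_nonneg_right ?_ β0.le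
          unfold Par.m; linarith
        _ = 3 * (P.m * β) := by ring
        _ ≤ _ := by rw [mβ]; linarith
  · apply mul_nonneg (by positivity)
    rw [← Real.cos_abs, abs_mul, abs_of_pos (by linarith : 0 < P.m)]
    apply Real.cos_nonneg_of_mem_Icc
    constructor
    · have : 0 ≤ P.m * |arg y| := by positivity
      linarith
    · rw [← mβ]; gcongr

/-- subsolution -/
def Lf (P : Par) (A : ℝ) (x : ℤ × ℤ) : ℝ :=
  if x ∈ Q then max 0 (uf P (ZZ P x.1 x.2) - A * wf P (ZZ P x.1 x.2)) else 0

theorem Lf_nonneg (P : Par) (A : ℝ) (x : ℤ × ℤ) : 0 ≤ Lf P A x := by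
  unfold Lf; split_ifs
  · exact le_max_left _ _
  · exact le_rfl

theorem uf_abs (P : Par) (z : ℂ) : |uf P z| ≤ ‖z‖ ^ P.p := G_abs _ _ _
theorem wf_abs (P : Par) (z : ℂ) : |wf P z| ≤ ‖z‖ ^ P.q := G_abs _ _ _

theorem barrier_L {μ : ℤ × ℤ → ℝ} {P : Par} {σ2 : ℝ} (h : Geo μ P σ2) :
    ∃ A : ℝ, 1 ≤ A ∧ ∀ x, ENNReal.ofReal (Lf P A x) ≤ ∑' y, kq μ x y * ENNReal.ofReal (Lf P A y) := by
  have hp := P.p_gt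
  obtain ⟨c', hc', hc'1, near⟩ := near_out P
  obtain ⟨cd, Cd, hcd, hCd, D⟩ := drift h
  obtain ⟨cw, hcw, Lw⟩ := G_lower P (m := P.m) (by unfold Par.m; linarith) (by unfold Par.m; linarith)
  obtain ⟨M, hM⟩ := exists_nat_ge P.p
  set K := 2 / c' with hK
  have K1 : 1 ≤ K := by rw [hK, le_div_iff₀ hc']; linarith
  set m3 := ∑' d : ℤ × ℤ, μ d * ‖ZZ P d.1 d.2‖ ^ (M + 3) with hm3
  have m30 : 0 ≤ m3 := tsum_nonneg fun d => mul_nonneg (h.nonneg d) (by positivity)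
  set E := K ^ M * (1 / c') ^ 3 with hE
  have E0 : 0 < E := by positivity
  obtain ⟨R, R1, HR⟩ := asy (c := cd) (C := 2 * Cd + 2 * E * m3) hcd
  set A := max 1 (Real.sqrt R / cw) with hA
  have A1 : 1 ≤ A := le_max_left _ _
  have A2 : Real.sqrt R ≤ A * cw := by
    rw [← div_le_iff₀ hcw]; exact le_max_right _ _
  refine ⟨A, A1, fun x => ?_⟩
  by_cases hpos : Lf P A x = 0
  · rw [hpos]; simp
  have hx : x ∈ Q := by
    by_contra hc; apply hpos; unfold Lf; rw [if_neg hc]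
  have q1 : (0 : ℝ) ≤ x.1 := by exact_mod_cast hx.1
  have q2 : (0 : ℝ) ≤ x.2 := by exact_mod_cast hx.2
  have hg : 0 < uf P (ZZ P x.1 x.2) - A * wf P (ZZ P x.1 x.2) := by
    by_contra hc
    push Not at hc
    apply hpos; unfold Lf; rw [if_pos hx, max_eq_left hc]
  have hLx : Lf P A x = uf P (ZZ P x.1 x.2) - A * wf P (ZZ P x.1 x.2) := by
    unfold Lf; rw [if_pos hx, max_eq_right hg.le]
  have hX : (0 : ℝ) < x.1 + x.2 := by
    by_contra hc
    have e1 : (x.1 : ℝ) = 0 := by linarith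
    have e2 : (x.2 : ℝ) = 0 := by linarith
    rw [e1, e2, ZZ_zero] at hg
    have z1 : uf P 0 = 0 := by
      unfold uf G; rw [norm_zero, Real.zero_rpow (by linarith), zero_mul]
    have z2 : wf P 0 = 0 := by
      unfold wf G; rw [norm_zero, Real.zero_rpow (by unfold Par.q; linarith), zero_mul]
    rw [z1, z2] at hg; simp at hg
  have hre := ZZ_re_pos P q1 q2 hX
  have hn : 0 < ‖ZZ P x.1 x.2‖ := by
    rw [norm_pos_iff]; intro h; rw [h] at hre; simp at hre
  have hR : R ≤ ‖ZZ P x.1 x.2‖ := by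
    have w1 := Lw P.q x.1 x.2 q1 q2
    have u1 := (abs_le.1 (uf_abs P (ZZ P x.1 x.2))).2
    change _ ≤ wf P _ at w1
    set r := ‖ZZ P x.1 x.2‖
    have e : r ^ P.p = r ^ P.q * Real.sqrt r := by
      rw [Real.sqrt_eq_rpow, ← Real.rpow_add hn]; congr 1; unfold Par.q; ring
    have : A * (cw * r ^ P.q) ≤ r ^ P.q * Real.sqrt r := by
      rw [← e]
      have := mul_le_mul_of_nonneg_left w1 (by linarith : 0 ≤ A)
      linarith
    have rq : 0 < r ^ P.q := by positivity
    have : A * cw ≤ Real.sqrt r := by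
      refine le_of_mul_le_mul_left ?_ rq
      linarith
    exact (Real.sqrt_le_sqrt_iff hn.le).1 (A2.trans this)
  have hr1 := R1.trans hR
  obtain ⟨s1, s2, b1, b2⟩ := D x.1 x.2 q1 q2 hr1
  set z := ZZ P x.1 x.2 with hz
  set r := ‖z‖ with hr
  have eadd : ∀ d : ℤ × ℤ, ZZ P (x + d).1 (x + d).2 = z + ZZ P d.1 d.2 := by
    intro d; rw [hz, ← ZZ_add]; simp
  set g : ℤ × ℤ → ℝ := fun d => uf P (z + ZZ P d.1 d.2) - A * wf P (z + ZZ P d.1 d.2) with hgd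
  have sg : Summable (fun d => μ d * g d) := by
    refine (s1.sub (s2.mul_left A)).congr fun d => ?_
    simp only [hgd]; ring
  have sL : Summable (fun d => if x + d ∈ Q then μ d * Lf P A (x + d) else 0) := by
    refine Summable.of_norm_bounded sg.norm fun d => ?_
    split_ifs with hd
    · have e : Lf P A (x + d) = max 0 (g d) := by
        unfold Lf; rw [if_pos hd, eadd]
      rw [norm_mul, norm_mul, e]
      refine mul_le_mul_of_nonneg_left ?_ (norm_nonneg _)
      rw [Real.norm_of_nonneg (le_max_left _ _)]
      exact max_le (norm_nonneg _) (le_abs_self _)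
    · rw [norm_zero]; positivity
  rw [kq_super h.nonneg hx (fun y _ => Lf_nonneg P A y) sL.hasSum]
  apply ENNReal.ofReal_le_ofReal
  have sm := h.mom (M + 3)
  have cmp : ∀ d, μ d * g d ≤ (if x + d ∈ Q then μ d * Lf P A (x + d) else 0)
      + ((1 + A) * E * r ^ (P.p - 3)) * (μ d * ‖ZZ P d.1 d.2‖ ^ (M + 3)) := by
    intro d
    have hμ := h.nonneg d
    have nnE : 0 ≤ ((1 + A) * E * r ^ (P.p - 3)) * (μ d * ‖ZZ P d.1 d.2‖ ^ (M + 3)) := by positivity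
    split_ifs with hd
    · have e : Lf P A (x + d) = max 0 (g d) := by
        unfold Lf; rw [if_pos hd, eadd]
      rw [e]
      have := mul_le_mul_of_nonneg_left (le_max_right 0 (g d)) hμ
      linarith
    · rw [zero_add]
      rcases le_or_gt ‖ZZ P d.1 d.2‖ (c' * r) with hs | hs
      · have hY : (((x + d).1 : ℤ) : ℝ) < 0 ∨ (((x + d).2 : ℤ) : ℝ) < 0 := by
          by_contra hc
          push Not at hc
          exact hd ⟨by exact_mod_cast hc.1, by exact_mod_cast hc.2⟩
        have := near x.1 x.2 _ _ (ZZ P d.1 d.2) q1 q2 hX (eadd d) hs hY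
        rw [eadd] at this
        have g0 : g d ≤ 0 := by
          simp only [hgd]
          have := mul_nonneg (by linarith : 0 ≤ A) this.2
          linarith
        have := mul_nonpos_of_nonneg_of_nonpos hμ g0
        linarith
      · set ζ := ZZ P d.1 d.2
        have t1 : r ≤ ‖ζ‖ / c' := by rw [le_div_iff₀ hc']; linarith
        have t2 : ‖z + ζ‖ ≤ K * ‖ζ‖ := by
          refine (norm_add_le _ _).trans ?_
          have : ‖ζ‖ ≤ ‖ζ‖ / c' := by rw [le_div_iff₀ hc']; nlinarith [norm_nonneg ζ]
          calc _ ≤ ‖ζ‖ / c' + ‖ζ‖ / c' := add_le_add t1 this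
            _ = _ := by rw [hK]; ring
        have t3 : 1 ≤ K * ‖ζ‖ := by
          have : (1 : ℝ) ≤ ‖ζ‖ / c' := hr1.trans t1
          calc (1 : ℝ) ≤ ‖ζ‖ / c' := this
            _ ≤ _ := by
              rw [hK, div_mul_eq_mul_div]; gcongr; linarith [norm_nonneg ζ]
        have t4 : ∀ e : ℝ, 0 ≤ e → e ≤ P.p → ‖z + ζ‖ ^ e ≤ (K * ‖ζ‖) ^ M := by
          intro e he he'
          calc _ ≤ (K * ‖ζ‖) ^ e := by gcongr
            _ ≤ (K * ‖ζ‖) ^ (M : ℝ) := Real.rpow_le_rpow_of_exponent_le t3 (by linarith)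
            _ = _ := Real.rpow_natCast _ _
        have t5 : g d ≤ (1 + A) * (K * ‖ζ‖) ^ M := by
          have v1 := (abs_le.1 (uf_abs P (z + ζ))).2
          have v2 := (abs_le.1 (wf_abs P (z + ζ))).1
          have v3 := t4 P.p (by linarith) le_rfl
          have v4 := t4 P.q (by unfold Par.q; linarith) (by unfold Par.q; linarith)
          have v5 : -(K * ‖ζ‖) ^ M ≤ wf P (z + ζ) := by linarith
          have v6 := mul_le_mul_of_nonneg_left v5 (by linarith : 0 ≤ A)
          simp only [hgd]
          change uf P (z + ζ) - A * wf P (z + ζ) ≤ _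
          linarith
        have t6 : 1 ≤ r ^ (P.p - 3) * (‖ζ‖ / c') ^ 3 := by
          have r3 : r ^ (P.p - 3) * r ^ 3 = r ^ P.p := by
            rw [← Real.rpow_natCast r 3, ← Real.rpow_add hn]; congr 1; push_cast; ring
          calc (1 : ℝ) ≤ r ^ P.p := Real.one_le_rpow hr1 (by linarith)
            _ = r ^ (P.p - 3) * r ^ 3 := r3.symm
            _ ≤ _ := by gcongr
        have t7 : g d ≤ ((1 + A) * E * r ^ (P.p - 3)) * ‖ζ‖ ^ (M + 3) := by
          refine t5.trans ?_
          have : 0 ≤ (1 + A) * (K * ‖ζ‖) ^ M := by positivity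
          calc _ ≤ (1 + A) * (K * ‖ζ‖) ^ M * (r ^ (P.p - 3) * (‖ζ‖ / c') ^ 3) := le_mul_of_one_le_right this t6
            _ = _ := by rw [hE, mul_pow, pow_add]; ring
        calc _ ≤ μ d * (((1 + A) * E * r ^ (P.p - 3)) * ‖ζ‖ ^ (M + 3)) := by gcongr
          _ = _ := by ring
  have tot := sg.tsum_le_tsum cmp (sL.add (sm.mul_left _))
  rw [sL.tsum_add (sm.mul_left _), tsum_mul_left] at tot
  have tg : ∑' d, μ d * g d = ∑' d : ℤ × ℤ, μ d * uf P (z + ZZ P d.1 d.2)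
      - A * ∑' d : ℤ × ℤ, μ d * wf P (z + ZZ P d.1 d.2) := by
    rw [← tsum_mul_left, ← s1.tsum_sub (s2.mul_left A)]
    refine tsum_congr fun d => ?_
    simp only [hgd]; ring
  have hh := HR r (P.p - 5 / 2) hR
  rw [show P.p - 5 / 2 - 1 / 2 = P.p - 3 by ring] at hh
  have b3 := (abs_le.1 b1).1
  have b4 := mul_le_mul_of_nonneg_left b2 (by linarith : 0 ≤ A)
  have b5 := mul_le_mul_of_nonneg_left hh (by linarith : 0 ≤ A)
  rw [hLx]
  rw [← hm3] at tot
  have pz : 0 < r ^ (P.p - 3) := by positivity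
  have b6 : (1 + A) * E * r ^ (P.p - 3) * m3 ≤ A * (2 * E * m3 * r ^ (P.p - 3)) := by
    have : 0 ≤ E * m3 * r ^ (P.p - 3) := by positivity
    nlinarith
  have b7 : Cd * r ^ (P.p - 3) ≤ A * (Cd * r ^ (P.p - 3)) := by
    have : 0 ≤ Cd * r ^ (P.p - 3) := by positivity
    nlinarith
  linarith

theorem Lf_pos (P : Par) (A : ℝ) (hA : 1 ≤ A) : ∃ L : ℕ, 1 ≤ L ∧ 0 < Lf P A (L, L) := by
  have hp := P.p_gt
  obtain ⟨c, C, hc, hC, B⟩ := u_bounds P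
  have u1 := (B P.p 1 1 (by norm_num) (by norm_num) (by norm_num)).1
  have z0 : 0 < ‖ZZ P 1 1‖ := by
    have := ZZ_ge1 P (X1 := 1) (X2 := 1) (by norm_num) (by norm_num)
    linarith [P.h1]
  have up : 0 < uf P (ZZ P 1 1) := lt_of_lt_of_le (by positivity) u1
  set W := ‖ZZ P 1 1‖ ^ P.q with hW
  obtain ⟨L, hL⟩ := exists_nat_gt (max 1 ((A * W / uf P (ZZ P 1 1)) ^ 2))
  have L1 : (1 : ℝ) < L := (le_max_left _ _).trans_lt hL
  have L0 : (0 : ℝ) < L := by linarith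
  refine ⟨L, by exact_mod_cast L1.le, ?_⟩
  have hQ : (((L : ℤ), (L : ℤ)) : ℤ × ℤ) ∈ Q := ⟨by positivity, by positivity⟩
  unfold Lf
  rw [if_pos hQ]
  refine lt_of_lt_of_le ?_ (le_max_right _ _)
  have e : ZZ P (((L : ℤ) : ℝ)) (((L : ℤ) : ℝ)) = ((L : ℝ) : ℂ) * ZZ P 1 1 := by
    rw [← ZZ_smul]; simp
  simp only [e]
  have e1 : uf P (((L : ℝ) : ℂ) * ZZ P 1 1) = (L : ℝ) ^ P.p * uf P (ZZ P 1 1) := G_smul _ _ L0 _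
  have e2 : wf P (((L : ℝ) : ℂ) * ZZ P 1 1) = (L : ℝ) ^ P.q * wf P (ZZ P 1 1) := G_smul _ _ L0 _
  have e3 : (L : ℝ) ^ P.p = (L : ℝ) ^ P.q * Real.sqrt L := by
    rw [Real.sqrt_eq_rpow, ← Real.rpow_add L0]; congr 1; unfold Par.q; ring
  have e4 : A * W / uf P (ZZ P 1 1) < Real.sqrt L :=
    Real.lt_sqrt_of_sq_lt ((le_max_right _ _).trans_lt hL)
  rw [div_lt_iff₀ up] at e4
  have e5 := (abs_le.1 (wf_abs P (ZZ P 1 1))).2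
  rw [e1, e2, e3]
  have lq : 0 < (L : ℝ) ^ P.q := by positivity
  have e6 : A * wf P (ZZ P 1 1) < Real.sqrt L * uf P (ZZ P 1 1) := by
    refine lt_of_le_of_lt ?_ e4
    gcongr
  have := mul_lt_mul_of_pos_left e6 lq
  linarith

end SB

namespace SB

/-- sum of shifted coordinates -/
def Sx (x : ℤ × ℤ) : ℝ := ((x.1 : ℝ) + 1) + ((x.2 : ℝ) + 1)
/-- product of shifted coordinates -/
def Px (x : ℤ × ℤ) : ℝ := ((x.1 : ℝ) + 1) * ((x.2 : ℝ) + 1)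

theorem Sx_ge {x : ℤ × ℤ} (hx : x ∈ Q) : 2 ≤ Sx x := by
  have h1 : (0 : ℝ) ≤ x.1 := by exact_mod_cast hx.1
  have h2 : (0 : ℝ) ≤ x.2 := by exact_mod_cast hx.2
  unfold Sx; linarith

theorem Px_ge {x : ℤ × ℤ} (hx : x ∈ Q) : 1 ≤ Px x := by
  have h1 : (0 : ℝ) ≤ x.1 := by exact_mod_cast hx.1
  have h2 : (0 : ℝ) ≤ x.2 := by exact_mod_cast hx.2
  unfold Px; nlinarith

theorem Px_le {x : ℤ × ℤ} : Px x ≤ Sx x ^ 2 := by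
  unfold Px Sx; nlinarith [sq_nonneg ((x.1 : ℝ) + 1), sq_nonneg ((x.2 : ℝ) + 1), sq_nonneg ((x.1 : ℝ) + 1 + (x.2 + 1))]

theorem Glow (P : Par) {q : ℝ} (hq : 0 ≤ q) : ∃ c : ℝ, 0 < c ∧ ∀ a : ℕ, 1 ≤ a → ∀ x ∈ Q,
    c * (Sx x ^ q * Px x) ≤ G (q + 2) P.p (Za P a x) := by
  obtain ⟨c, C, hc, hC, B⟩ := u_bounds P
  have m1 := P.h1
  have m2 := P.h2
  set ρ := min P.r1 P.r2 / 2 with hρ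
  have hρ0 : 0 < ρ := by have := lt_min m1 m2; positivity
  refine ⟨c * ρ ^ q, by positivity, fun a ha x hx => ?_⟩
  have h1 : (0 : ℝ) ≤ x.1 := by exact_mod_cast hx.1
  have h2 : (0 : ℝ) ≤ x.2 := by exact_mod_cast hx.2
  have ha' : (1 : ℝ) ≤ a := by exact_mod_cast ha
  have b := (B (q + 2) ((x.1 : ℝ) + a) ((x.2 : ℝ) + a) (by linarith) (by linarith) (by linarith)).1
  have g1 := ZZ_ge1 P (X1 := (x.1 : ℝ) + a) (X2 := (x.2 : ℝ) + a) (by linarith) (by linarith)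
  have g2 := ZZ_ge2 P (X1 := (x.1 : ℝ) + a) (X2 := (x.2 : ℝ) + a) (by linarith) (by linarith)
  refine le_trans ?_ b
  have s0 := Sx_ge hx
  have hr : ρ * Sx x ≤ ‖ZZ P ((x.1 : ℝ) + a) ((x.2 : ℝ) + a)‖ := by
    have k1 : ((x.1 : ℝ) + 1) * min P.r1 P.r2 ≤ ((x.1 : ℝ) + a) * P.r1 := by
      apply mul_le_mul (by linarith) (min_le_left _ _) (lt_min m1 m2).le (by linarith)
    have k2 : ((x.2 : ℝ) + 1) * min P.r1 P.r2 ≤ ((x.2 : ℝ) + a) * P.r2 := by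
      apply mul_le_mul (by linarith) (min_le_right _ _) (lt_min m1 m2).le (by linarith)
    unfold Sx; rw [hρ]; nlinarith
  rw [show q + 2 - 2 = q by ring, mul_assoc]
  refine mul_le_mul_of_nonneg_left ?_ hc.le
  rw [← mul_assoc, ← Real.mul_rpow hρ0.le (by linarith)]
  refine mul_le_mul (Real.rpow_le_rpow (by positivity) hr hq) ?_ (by linarith [Px_ge hx]) (by positivity)
  unfold Px
  exact mul_le_mul (by linarith) (by linarith) (by linarith) (by linarith)

theorem Uf_up (P : Par) (a : ℕ) (ha : 1 ≤ a) : ∃ C : ℝ, 0 < C ∧ ∀ x ∈ Q, Uf P (Za P a x) ≤ C * Sx x ^ P.p := by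
  have hp := P.p_gt
  have m1 := P.h1
  have m2 := P.h2
  have ha' : (1 : ℝ) ≤ a := by exact_mod_cast ha
  set ρ := a * (P.r1 + P.r2) with hρ
  have hρ0 : 0 < ρ := by positivity
  refine ⟨2 * ρ ^ P.p + 1, by positivity, fun x hx => ?_⟩
  have h1 : (0 : ℝ) ≤ x.1 := by exact_mod_cast hx.1
  have h2 : (0 : ℝ) ≤ x.2 := by exact_mod_cast hx.2
  have hr : ‖Za P a x‖ ≤ ρ * Sx x := by
    refine (ZZ_norm_le P _ _).trans ?_
    rw [abs_of_nonneg (by linarith), abs_of_nonneg (by linarith), hρ]; unfold Sx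
    have e1 : (x.1 : ℝ) + a ≤ a * (x.1 + 1) := by nlinarith
    have e2 : (x.2 : ℝ) + a ≤ a * (x.2 + 1) := by nlinarith
    have f1 : 0 ≤ (a : ℝ) * (x.1 + 1) := by positivity
    have f2 : 0 ≤ (a : ℝ) * (x.2 + 1) := by positivity
    nlinarith [mul_nonneg f1 m2.le, mul_nonneg f2 m1.le]
  have s0 := Sx_ge hx
  have e1 := (le_abs_self _).trans (G_abs P.p P.p (Za P a x))
  have e2 := (le_abs_self _).trans (G_abs P.q P.m (Za P a x))
  have n0 := norm_nonneg (Za P a x)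
  have e3 : ‖Za P a x‖ ^ P.q ≤ 1 + ‖Za P a x‖ ^ P.p := by
    rcases le_total ‖Za P a x‖ 1 with h | h
    · have := Real.rpow_le_one n0 h (show 0 ≤ P.q by unfold Par.q; linarith)
      have : 0 ≤ ‖Za P a x‖ ^ P.p := by positivity
      linarith
    · have := Real.rpow_le_rpow_of_exponent_le h (show P.q ≤ P.p by unfold Par.q; linarith)
      linarith
  have e4 := Real.rpow_le_rpow n0 hr (show 0 ≤ P.p by linarith)
  rw [Real.mul_rpow hρ0.le (by linarith)] at e4
  have e5 := Real.one_le_rpow (show 1 ≤ Sx x by linarith) (show 0 ≤ P.p by linarith)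
  unfold Uf
  nlinarith

theorem Lf_up (P : Par) (A : ℝ) (hA : 1 ≤ A) : ∃ C : ℝ, 0 < C ∧ ∀ x ∈ Q, Lf P A x ≤ C * (Sx x ^ (P.p - 2) * Px x) := by
  have hp := P.p_gt
  have m1 := P.h1
  have m2 := P.h2
  obtain ⟨c, C, hc, hC, B⟩ := u_bounds P
  set ρ := (P.r1 + P.r2) with hρ
  have hρ0 : 0 < ρ := by positivity
  refine ⟨C * ρ ^ (P.p - 2), by positivity, fun x hx => ?_⟩
  have h1 : (0 : ℝ) ≤ x.1 := by exact_mod_cast hx.1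
  have h2 : (0 : ℝ) ≤ x.2 := by exact_mod_cast hx.2
  have s0 := Sx_ge hx
  have p0 := Px_ge hx
  have hr : ‖ZZ P x.1 x.2‖ ≤ ρ * Sx x := by
    refine (ZZ_norm_le P _ _).trans ?_
    rw [abs_of_nonneg (by linarith), abs_of_nonneg (by linarith), hρ]; unfold Sx
    nlinarith [mul_nonneg h1 m2.le, mul_nonneg h2 m1.le]
  have hw : 0 ≤ wf P (ZZ P x.1 x.2) := by
    refine G_nonneg P (q := P.q) ?_ ?_ h1 h2 <;> unfold Par.m <;> linarith
  have R0 : 0 ≤ C * ρ ^ (P.p - 2) * (Sx x ^ (P.p - 2) * Px x) := by positivity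
  unfold Lf
  rw [if_pos hx]
  refine max_le R0 ?_
  refine le_trans (sub_le_self _ (by positivity)) ?_
  by_cases hz : (0 : ℝ) < x.1 + x.2
  · refine (B P.p x.1 x.2 h1 h2 hz).2.trans ?_
    rw [mul_assoc]
    refine mul_le_mul_of_nonneg_left ?_ hC.le
    rw [← mul_assoc (ρ ^ _), ← Real.mul_rpow hρ0.le (by linarith)]
    refine mul_le_mul (Real.rpow_le_rpow (norm_nonneg _) hr (by linarith)) ?_ (by positivity) (by positivity)
    unfold Px; nlinarith
  · have z1 : (x.1 : ℝ) = 0 := by linarith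
    have z2 : (x.2 : ℝ) = 0 := by linarith
    have := (le_abs_self _).trans (uf_abs P (ZZ P x.1 x.2))
    have hz : ZZ P x.1 x.2 = 0 := by rw [z1, z2]; simp [ZZ, Complex.ext_iff]
    rw [hz, norm_zero, Real.zero_rpow (by linarith)] at this
    rw [hz]; linarith

/-- package of barrier functions for a killed kernel -/
structure Bar (K : ℤ × ℤ → ℤ × ℤ → ENNReal) (p C : ℝ) (U V F Lo : ℤ × ℤ → ℝ) (L : ℕ) : Prop where
  hp : 2 < p
  hC : 1 ≤ C
  one : ∀ x, ∑' y, K x y ≤ 1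
  out : ∀ x, x ∉ Q → ∀ y, K x y = 0
  out' : ∀ x y, y ∉ Q → K x y = 0
  U_s : ∀ x, ∑' y, K x y * ENNReal.ofReal (U y) ≤ ENNReal.ofReal (U x)
  V_s : ∀ x, ∑' y, K x y * ENNReal.ofReal (V y) ≤ ENNReal.ofReal (V x) + ENNReal.ofReal C * ENNReal.ofReal (U x)
  F_s : ∀ x ∈ Q, ∑' y, K x y * ENNReal.ofReal (F y) + ENNReal.ofReal C⁻¹ ≤ ENNReal.ofReal (F x)
  L_s : ∀ x, ENNReal.ofReal (Lo x) ≤ ∑' y, K x y * ENNReal.ofReal (Lo y)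
  U_l : ∀ x ∈ Q, Px x ^ (p / 2) ≤ C * U x
  U_u : ∀ x ∈ Q, U x ≤ C * Sx x ^ p
  V_l : ∀ x ∈ Q, Sx x ^ p * Px x ≤ C * V x
  F_u : ∀ x ∈ Q, F x ≤ C * Px x
  L_0 : ∀ x, 0 ≤ Lo x
  L_o : ∀ x, x ∉ Q → Lo x = 0
  L_u : ∀ x ∈ Q, Lo x ≤ C * (Sx x ^ (p - 2) * Px x)
  L_p : 0 < Lo (L, L)

theorem bar_exists {μ : ℤ × ℤ → ℝ} {s11 s12 s22 : ℝ} (hl : Law μ s11 s12 s22) (h12 : s12 < 0)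
    {P : Par} {σ2 : ℝ} (h : Geo μ P σ2) (ho : OutGood μ) :
    ∃ C U V F Lo L, Bar (kq μ) P.p C U V F Lo L := by
  have hp := P.p_gt
  obtain ⟨a1, ha1, H1⟩ := barrier_U h ho
  obtain ⟨a2, C2, hC2, ha2, H2⟩ := barrier_P h ho
  obtain ⟨b, hb, H3⟩ := barrier_F hl ho h12
  obtain ⟨A, hA, H4⟩ := barrier_L h
  obtain ⟨L, hL, HL⟩ := Lf_pos P A hA
  set a := max a1 a2
  have haa : 1 ≤ a := ha1.trans (le_max_left _ _)
  obtain ⟨c5, hc5, H5⟩ := Glow P (q := P.p - 2) (by linarith)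
  obtain ⟨c6, hc6, H6⟩ := Glow P (q := P.p) (by linarith)
  obtain ⟨C7, hC7, H7⟩ := Uf_up P a haa
  obtain ⟨C8, hC8, H8⟩ := Lf_up P A hA
  set C : ℝ := 1 + C2 + (-s12)⁻¹ + c5⁻¹ + c6⁻¹ + C7 + C8 + b ^ 2 with hC
  have i1 : 0 < (-s12)⁻¹ := inv_pos.2 (by linarith)
  have i2 : 0 < c5⁻¹ := inv_pos.2 hc5
  have i3 : 0 < c6⁻¹ := inv_pos.2 hc6
  have i4 : (0 : ℝ) ≤ b ^ 2 := by positivity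
  have wU : ∀ x ∈ Q, 0 ≤ wf P (Za P a x) := by
    intro x hx
    have h1 : (0 : ℝ) ≤ x.1 := by exact_mod_cast hx.1
    have h2 : (0 : ℝ) ≤ x.2 := by exact_mod_cast hx.2
    refine G_nonneg P (q := P.q) ?_ ?_ (by positivity) (by positivity) <;> unfold Par.m <;> linarith
  refine ⟨C, fun x => Uf P (Za P a x), fun x => Pf P (Za P a x), fun x => ((x.1 : ℝ) + b) * ((x.2 : ℝ) + b),
    Lf P A, L, hp, by linarith, kq_sum hl, fun x hx y => by simp [kq, hx], fun x y hy => by simp [kq, hy],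
    H1 a (le_max_left _ _), fun x => (H2 a (le_max_right _ _) x).trans ?_, fun x hx => le_trans ?_ (H3 x hx), H4,
    fun x hx => ?_, fun x hx => (H7 x hx).trans ?_, fun x hx => ?_, fun x hx => ?_, Lf_nonneg P A, fun x hx => by simp [Lf, hx],
    fun x hx => (H8 x hx).trans ?_, HL⟩
  · gcongr; linarith
  · gcongr
    rw [inv_le_comm₀ (by linarith) (by linarith)]; linarith
  · have h5 := H5 a haa x hx
    have h51 := wU x hx
    have s0 := Sx_ge hx
    have p0 := Px_ge hx
    rw [show P.p - 2 + 2 = P.p by ring] at h5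
    have k : c5 * Px x ^ (P.p / 2) ≤ c5 * (Sx x ^ (P.p - 2) * Px x) := by
      refine mul_le_mul_of_nonneg_left ?_ hc5.le
      have e : Px x ^ (P.p / 2) = Px x ^ ((P.p - 2) / 2) * Px x := by
        conv_rhs => rw [← Real.rpow_one (Px x), ← Real.rpow_mul (by linarith), ← Real.rpow_add (by linarith)]
        congr 1; ring
      rw [e]
      refine mul_le_mul_of_nonneg_right ?_ (by linarith)
      calc Px x ^ ((P.p - 2) / 2) ≤ (Sx x ^ 2) ^ ((P.p - 2) / 2) := Real.rpow_le_rpow (by linarith) Px_le (by linarith)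
        _ = Sx x ^ (P.p - 2) := by
          rw [← Real.rpow_natCast, ← Real.rpow_mul (by linarith)]; congr 1; push_cast; ring
    have k2 : c5 * Px x ^ (P.p / 2) ≤ Uf P (Za P a x) := by
      unfold Uf; unfold wf at h51; linarith
    have k3 : Px x ^ (P.p / 2) ≤ c5⁻¹ * Uf P (Za P a x) := by
      rw [← div_eq_inv_mul, le_div_iff₀ hc5]; linarith
    have k4 : 0 ≤ Uf P (Za P a x) := le_trans (by positivity) k2
    refine k3.trans (mul_le_mul_of_nonneg_right (by linarith) k4)
  · have s0 := Sx_ge hx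
    refine mul_le_mul_of_nonneg_right (by linarith) (by positivity)
  · have h6 := H6 a haa x hx
    have s0 := Sx_ge hx
    have p0 := Px_ge hx
    have k2 : c6 * (Sx x ^ P.p * Px x) ≤ Pf P (Za P a x) := by unfold Pf; linarith
    have k3 : (Sx x ^ P.p * Px x) ≤ c6⁻¹ * Pf P (Za P a x) := by
      rw [← div_eq_inv_mul, le_div_iff₀ hc6]; linarith
    have k4 : 0 ≤ Pf P (Za P a x) := le_trans (by positivity) k2
    refine k3.trans (mul_le_mul_of_nonneg_right (by linarith) k4)
  · have h1 : (0 : ℝ) ≤ x.1 := by exact_mod_cast hx.1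
    have h2 : (0 : ℝ) ≤ x.2 := by exact_mod_cast hx.2
    have p0 := Px_ge hx
    have hb' : (1 : ℝ) ≤ b := by exact_mod_cast hb
    calc ((x.1 : ℝ) + b) * (x.2 + b) ≤ (b * (x.1 + 1)) * (b * (x.2 + 1)) :=
          mul_le_mul (by nlinarith) (by nlinarith) (by positivity) (by positivity)
      _ = b ^ 2 * Px x := by unfold Px; ring
      _ ≤ C * Px x := mul_le_mul_of_nonneg_right (by linarith) (by linarith)
  · have s0 := Sx_ge hx
    have p0 := Px_ge hx
    refine mul_le_mul_of_nonneg_right (by linarith) (by positivity)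

end SB

namespace SB
open ENNReal (ofReal)

section
variable {K : ℤ × ℤ → ℤ × ℤ → ENNReal} {p C : ℝ} {U V F Lo : ℤ × ℤ → ℝ} {L : ℕ}

theorem Bar.U_n (B : Bar K p C U V F Lo L) {x : ℤ × ℤ} (hx : x ∈ Q) : 0 < U x ∧ 1 ≤ C * U x := by
  have h := B.U_l x hx
  have hp := B.hp
  have h1 := Real.one_le_rpow (Px_ge hx) (show 0 ≤ p / 2 by linarith)
  have hC := B.hC
  refine ⟨?_, by linarith⟩
  by_contra hn
  push Not at hn
  nlinarith

theorem Bar.V_n (B : Bar K p C U V F Lo L) {x : ℤ × ℤ} (hx : x ∈ Q) : 0 ≤ V x := by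
  have h := B.V_l x hx
  have s0 := Sx_ge hx
  have p0 := Px_ge hx
  have h1 : 0 ≤ Sx x ^ p * Px x := by positivity
  have hC := B.hC
  by_contra hn
  push Not at hn
  nlinarith

theorem Bar.sv_out (B : Bar K p C U V F Lo L) {x : ℤ × ℤ} (hx : x ∉ Q) (n : ℕ) : sv K (n + 1) x = 0 := by
  unfold sv
  rw [ex_succ]
  simp [B.out x hx]

theorem Bar.F_n (B : Bar K p C U V F Lo L) (n : ℕ) : ∀ x ∈ Q,
    ex K n (fun y => ofReal (F y)) x + (n * ofReal C⁻¹) * sv K n x ≤ ofReal (F x) := by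
  induction n with
  | zero => intro x hx; simp [ex_zero]
  | succ n ih =>
    intro x hx
    have h1 : sv K (n + 1) x = ∑' z, K x z * sv K n z := ex_succ K n _ x
    have h2 : ∑' z, K x z * (ex K n (fun y => ofReal (F y)) z + (n * ofReal C⁻¹) * sv K n z) ≤
        ∑' z, K x z * ofReal (F z) := by
      refine ENNReal.tsum_le_tsum fun z => ?_
      by_cases hz : z ∈ Q
      · gcongr; exact ih z hz
      · rw [B.out' x z hz]; simp
    have h3 : ∑' z, K x z * (ex K n (fun y => ofReal (F y)) z + (n * ofReal C⁻¹) * sv K n z) =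
        ex K (n + 1) (fun y => ofReal (F y)) x + (n * ofReal C⁻¹) * sv K (n + 1) x := by
      rw [ex_succ, h1, ← ENNReal.tsum_mul_left, ← ENNReal.tsum_add]
      refine tsum_congr fun z => by ring
    have h4 : sv K (n + 1) x ≤ 1 := sv_le_one K B.one _ _
    refine le_trans ?_ (B.F_s x hx)
    refine le_trans ?_ (add_le_add_left h2 _)
    rw [h3]
    push_cast
    rw [add_mul, one_mul, add_mul, ← add_assoc]
    gcongr
    exact mul_le_of_le_one_right (zero_le) h4

theorem Bar.sv_split (B : Bar K p C U V F Lo L) {η : ℝ} (hη : 0 < η) : ∃ D : ℝ, 0 < D ∧ ∀ n : ℕ, 1 ≤ n → ∀ x,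
    sv K n x ≤ ofReal η + ofReal (D * (n : ℝ) ^ (-(p / 2))) * ofReal (U x) := by
  have hC := B.hC
  have hp := B.hp
  refine ⟨(C ^ 2 / η) ^ (p / 2) * C, by positivity, fun n hn x => ?_⟩
  by_cases hx : x ∈ Q
  swap
  · obtain ⟨k, rfl⟩ : ∃ k, n = k + 1 := ⟨n - 1, by omega⟩
    rw [B.sv_out hx]; exact zero_le
  have p0 := Px_ge hx
  have hn' : (1 : ℝ) ≤ n := by exact_mod_cast hn
  have hU := B.U_n hx
  rcases le_or_gt (C ^ 2 * Px x) (η * n) with h | h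
  · refine le_trans ?_ le_self_add
    have h1 : (n * ofReal C⁻¹) * sv K n x ≤ ofReal (F x) := le_trans le_add_self (B.F_n n x hx)
    have h2 : (n * ofReal C⁻¹ : ENNReal) = ofReal (n * C⁻¹) := by
      rw [ENNReal.ofReal_mul (by positivity), ENNReal.ofReal_natCast]
    rw [h2, mul_comm, ← ENNReal.le_div_iff_mul_le (Or.inl ?_) (Or.inl ENNReal.ofReal_ne_top),
      ← ENNReal.ofReal_div_of_pos (by positivity)] at h1
    · refine h1.trans (ENNReal.ofReal_le_ofReal ?_)
      rw [div_le_iff₀ (by positivity)]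
      have := B.F_u x hx
      have e : η * (n * C⁻¹) = (η * n) / C := by field_simp
      rw [e, le_div_iff₀ (by positivity)]
      nlinarith
    · simp only [ne_eq, ENNReal.ofReal_eq_zero, not_le]; positivity
  · refine le_trans (sv_le_one K B.one n x) (le_trans ?_ le_add_self)
    rw [← ENNReal.ofReal_mul (by positivity)]
    rw [← ENNReal.ofReal_one]
    refine ENNReal.ofReal_le_ofReal ?_
    have h1 : 1 ≤ C ^ 2 / η * (n : ℝ)⁻¹ * Px x := by
      have e : C ^ 2 / η * (n : ℝ)⁻¹ * Px x = (C ^ 2 * Px x) / (η * n) := by field_simp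
      rw [e, le_div_iff₀ (by positivity)]; linarith
    have h2 := Real.one_le_rpow h1 (show 0 ≤ p / 2 by linarith)
    rw [Real.mul_rpow (by positivity) (by linarith), Real.mul_rpow (by positivity) (by positivity),
      Real.inv_rpow (by positivity), ← Real.rpow_neg (by positivity)] at h2
    refine h2.trans ?_
    have := B.U_l x hx
    have k : 0 ≤ (C ^ 2 / η) ^ (p / 2) * (n : ℝ) ^ (-(p / 2)) := by positivity
    calc _ ≤ (C ^ 2 / η) ^ (p / 2) * (n : ℝ) ^ (-(p / 2)) * (C * U x) := mul_le_mul_of_nonneg_left this k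
      _ = _ := by ring

theorem Bar.tail (B : Bar K p C U V F Lo L) : ∃ M : ℝ, 0 < M ∧ ∀ n : ℕ, 1 ≤ n → ∀ x,
    sv K n x ≤ ofReal (M * (n : ℝ) ^ (-(p / 2))) * ofReal (U x) := by
  have hC := B.hC
  have hp := B.hp
  set t : ℝ := 2 ^ (-(p / 2)) with ht
  have t0 : 0 < t := by positivity
  obtain ⟨D, hD, H⟩ := B.sv_split (η := t / 2) (by positivity)
  set M := 2 * D / t + C with hM
  have M0 : 0 < M := by positivity
  have key : ∀ k : ℕ, ∀ x, sv K (2 ^ k) x ≤ ofReal (M * t ^ k) * ofReal (U x) := by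
    intro k
    induction k with
    | zero =>
      intro x
      by_cases hx : x ∈ Q
      · have hU := B.U_n hx
        refine (sv_le_one K B.one _ x).trans ?_
        rw [← ENNReal.ofReal_mul (by positivity), ← ENNReal.ofReal_one]
        refine ENNReal.ofReal_le_ofReal ?_
        have : C ≤ M := by have : 0 ≤ 2 * D / t := by positivity
                           linarith
        simp only [pow_zero, mul_one]
        nlinarith
      · rw [pow_zero, show (1 : ℕ) = 0 + 1 from rfl, B.sv_out hx 0]; exact zero_le
    | succ k ih =>
      intro x
      have h1 : sv K (2 ^ (k + 1)) x = ex K (2 ^ k) (sv K (2 ^ k)) x := by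
        rw [← sv_add]; congr 1; ring
      have e2 : (((2 ^ k : ℕ) : ℝ)) ^ (-(p / 2)) = t ^ k := by
        rw [ht]; push_cast
        rw [← Real.rpow_natCast, ← Real.rpow_natCast, ← Real.rpow_mul (by norm_num), ← Real.rpow_mul (by norm_num), mul_comm]
      have h2 : sv K (2 ^ (k + 1)) x ≤ ofReal (t / 2) * sv K (2 ^ k) x + ofReal (D * t ^ k) * ofReal (U x) := by
        rw [h1]
        refine (ex_mono K _ (fun y => H (2 ^ k) Nat.one_le_two_pow y) x).trans ?_
        rw [e2, ex_addf, ex_mul K (2 ^ k) (ofReal (D * t ^ k)) (fun y => ofReal (U y))]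
        gcongr
        · rw [sv, ← ex_mul]; simp
        · exact ex_super K B.U_s _ x
      refine h2.trans ?_
      refine (add_le_add (mul_le_mul' le_rfl (ih x)) le_rfl).trans ?_
      rw [← mul_assoc, ← add_mul, ← ENNReal.ofReal_mul (by positivity), ← ENNReal.ofReal_add (by positivity) (by positivity)]
      gcongr
      have e : M * t ^ (k + 1) = t / 2 * (M * t ^ k) + (t / 2 * M) * t ^ k := by ring
      rw [e]
      have : D ≤ t / 2 * M := by
        have : t / 2 * M = D + t / 2 * C := by rw [hM]; field_simp
        rw [this]; have : 0 ≤ t / 2 * C := by positivity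
        linarith
      have : D * t ^ k ≤ (t / 2 * M) * t ^ k := mul_le_mul_of_nonneg_right this (by positivity)
      linarith
  refine ⟨M / t, by positivity, fun n hn x => ?_⟩
  set k := Nat.log 2 n
  have k1 : 2 ^ k ≤ n := Nat.pow_log_le_self 2 (by omega)
  have k2 : n ≤ 2 ^ (k + 1) := (Nat.lt_pow_succ_log_self (by norm_num) n).le
  refine (sv_anti K B.one k1 x).trans ((key k x).trans ?_)
  refine mul_le_mul' (ENNReal.ofReal_le_ofReal ?_) le_rfl
  have : t ^ (k + 1) ≤ (n : ℝ) ^ (-(p / 2)) := by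
    have e2 : (((2 ^ (k + 1) : ℕ) : ℝ)) ^ (-(p / 2)) = t ^ (k + 1) := by
      rw [ht]; push_cast
      rw [← Real.rpow_natCast, ← Real.rpow_natCast, ← Real.rpow_mul (by norm_num), ← Real.rpow_mul (by norm_num), mul_comm]
    rw [← e2]
    refine Real.rpow_le_rpow_of_nonpos (by exact_mod_cast hn) (by exact_mod_cast k2) (by linarith)
  rw [div_mul_eq_mul_div, le_div_iff₀ t0]
  calc M * t ^ k * t = M * t ^ (k + 1) := by ring
    _ ≤ _ := mul_le_mul_of_nonneg_left this M0.le

theorem Bar.V_ex (B : Bar K p C U V F Lo L) (n : ℕ) (x : ℤ × ℤ) :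
    ex K n (fun y => ofReal (V y)) x ≤ ofReal (V x) + n * (ofReal C * ofReal (U x)) := by
  induction n with
  | zero => simp [ex_zero]
  | succ n ih =>
    rw [ex_add]
    have h1 : ex K n (ex K 1 fun y => ofReal (V y)) x ≤ ex K n (fun y => ofReal (V y) + ofReal C * ofReal (U y)) x := by
      refine ex_mono K n (fun y => ?_) x
      rw [ex_one]; exact B.V_s y
    refine h1.trans ?_
    rw [ex_addf, ex_mul K n (ofReal C) (fun y => ofReal (U y))]
    have h2 := ex_super K B.U_s n x
    calc _ ≤ (ofReal (V x) + n * (ofReal C * ofReal (U x))) + ofReal C * ofReal (U x) := by gcongr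
      _ = _ := by push_cast; ring

/-- the bulk box at scale `s` -/
def box (ε A s : ℝ) : Set (ℤ × ℤ) := {y | y ∈ Q ∧ ε * s ≤ (y.1 : ℝ) + 1 ∧ ε * s ≤ (y.2 : ℝ) + 1 ∧ Sx y ≤ A * s}

theorem Bar.L_pt (B : Bar K p C U V F Lo L) {ε A s : ℝ} (hε : 0 < ε) (hA : 1 ≤ A) (hs : 0 < s) (y : ℤ × ℤ) :
    Lo y ≤ C * (A * s) ^ p * (if y ∈ box ε A s then 1 else 0) + C * ε * A ^ (p - 1) * s ^ p
      + C ^ 2 / (A * s) ^ 2 * max 0 (V y) := by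
  have hC := B.hC
  have hp := B.hp
  have n2 : 0 ≤ C * ε * A ^ (p - 1) * s ^ p := by positivity
  have n3 : 0 ≤ C ^ 2 / (A * s) ^ 2 * max 0 (V y) := mul_nonneg (by positivity) (le_max_left _ _)
  have n1 : 0 ≤ C * (A * s) ^ p * (if y ∈ box ε A s then (1 : ℝ) else 0) := mul_nonneg (by positivity) (by split_ifs <;> norm_num)
  by_cases hy : y ∈ Q
  swap
  · rw [B.L_o y hy]; linarith
  have s0 := Sx_ge hy
  have p0 := Px_ge hy
  have hL := B.L_u y hy
  have eS : Sx y ^ p = Sx y ^ (p - 2) * Sx y ^ 2 := by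
    conv_rhs => rw [← Real.rpow_natCast, ← Real.rpow_add (by linarith)]
    congr 1; push_cast; ring
  rcases le_or_gt (Sx y) (A * s) with h | h
  · by_cases hb : y ∈ box ε A s
    · rw [if_pos hb]
      have : Sx y ^ (p - 2) * Px y ≤ (A * s) ^ p := by
        calc Sx y ^ (p - 2) * Px y ≤ Sx y ^ (p - 2) * Sx y ^ 2 := mul_le_mul_of_nonneg_left Px_le (by positivity)
          _ = Sx y ^ p := eS.symm
          _ ≤ _ := Real.rpow_le_rpow (by linarith) h (by linarith)
      have := mul_le_mul_of_nonneg_left this (show 0 ≤ C by linarith)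
      linarith
    · have hP : Px y ≤ ε * s * (A * s) := by
        have h1 : (0 : ℝ) ≤ y.1 := by exact_mod_cast hy.1
        have h2 : (0 : ℝ) ≤ y.2 := by exact_mod_cast hy.2
        have es : 0 < ε * s := by positivity
        unfold Sx at h
        unfold Px
        by_cases c1 : ε * s ≤ (y.1 : ℝ) + 1
        · by_cases c2 : ε * s ≤ (y.2 : ℝ) + 1
          · exact absurd ⟨hy, c1, c2, h⟩ hb
          · push Not at c2
            rw [mul_comm]
            exact mul_le_mul c2.le (by linarith) (by linarith) es.le
        · push Not at c1
          exact mul_le_mul c1.le (by linarith) (by linarith) es.le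
      have : Sx y ^ (p - 2) * Px y ≤ ε * A ^ (p - 1) * s ^ p := by
        calc Sx y ^ (p - 2) * Px y ≤ (A * s) ^ (p - 2) * (ε * s * (A * s)) :=
              mul_le_mul (Real.rpow_le_rpow (by linarith) h (by linarith)) hP (by linarith) (by positivity)
          _ = ε * A ^ (p - 1) * s ^ p := by
            rw [Real.mul_rpow (by linarith) hs.le, show p - 1 = p - 2 + 1 by ring, Real.rpow_add (by linarith),
              Real.rpow_one]
            have : s ^ p = s ^ (p - 2) * s ^ 2 := by
              conv_rhs => rw [← Real.rpow_natCast, ← Real.rpow_add (by linarith)]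
              congr 1; push_cast; ring
            rw [this]; ring
      have := mul_le_mul_of_nonneg_left this (show 0 ≤ C by linarith)
      linarith
  · have hV := B.V_l y hy
    have hV' := le_max_right 0 (V y)
    have hm : 0 ≤ max 0 (V y) := le_max_left _ _
    have : Sx y ^ (p - 2) * Px y ≤ C / (A * s) ^ 2 * max 0 (V y) := by
      rw [div_mul_eq_mul_div, le_div_iff₀ (by positivity)]
      calc Sx y ^ (p - 2) * Px y * (A * s) ^ 2 ≤ Sx y ^ (p - 2) * Px y * Sx y ^ 2 := by
            refine mul_le_mul_of_nonneg_left (pow_le_pow_left₀ (by positivity) h.le 2) (by positivity)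
        _ = Sx y ^ p * Px y := by rw [eS]; ring
        _ ≤ C * V y := hV
        _ ≤ _ := mul_le_mul_of_nonneg_left hV' (by linarith)
    have := mul_le_mul_of_nonneg_left this (show 0 ≤ C by linarith)
    have e : C * (C / (A * s) ^ 2 * max 0 (V y)) = C ^ 2 / (A * s) ^ 2 * max 0 (V y) := by ring
    linarith

theorem Bar.bulk (B : Bar K p C U V F Lo L) : ∃ ε A c : ℝ, 0 < ε ∧ 1 ≤ A ∧ 0 < c ∧ ∀ n : ℕ, 1 ≤ n →
    ofReal (c * (n : ℝ) ^ (-(p / 2))) ≤ ex K n (fun y => if y ∈ box ε A (Real.sqrt n) then 1 else 0) (L, L) := by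
  have hC := B.hC
  have hp := B.hp
  obtain ⟨M, hM, HM⟩ := B.tail
  have hQ : ((L : ℤ), (L : ℤ)) ∈ Q := ⟨by simp, by simp⟩
  set u := U (L, L)
  set v := V (L, L)
  set l := Lo (L, L) with hl
  have hu : 0 < u := (B.U_n hQ).1
  have hv : 0 ≤ v := B.V_n hQ
  have l0 : 0 < l := B.L_p
  set A : ℝ := 1 + 3 * C ^ 2 * (v + C * u) / l with hA
  have A1 : 1 ≤ A := by have : 0 ≤ 3 * C ^ 2 * (v + C * u) / l := by positivity
                        linarith
  set ε : ℝ := l / (3 * (C * M * A ^ (p - 1) * u)) with hε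
  have ε0 : 0 < ε := by positivity
  refine ⟨ε, A, l / (3 * (C * A ^ p)), ε0, A1, by positivity, fun n hn => ?_⟩
  have hn' : (1 : ℝ) ≤ n := by exact_mod_cast hn
  set s := Real.sqrt n with hs
  have s0 : 0 < s := Real.sqrt_pos.2 (by linarith)
  have s2 : s ^ 2 = n := Real.sq_sqrt (by linarith)
  have sp : s ^ p = (n : ℝ) ^ (p / 2) := by
    rw [hs, Real.sqrt_eq_rpow, ← Real.rpow_mul (by linarith)]; congr 1; ring
  have spi : (n : ℝ) ^ (-(p / 2)) = (s ^ p)⁻¹ := by rw [sp, Real.rpow_neg (by linarith)]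
  have sp0 : 0 < s ^ p := by positivity
  set I := ex K n (fun y => if y ∈ box ε A s then 1 else 0) (L, L) with hI
  have I1 : I ≤ 1 := by
    refine le_trans (ex_mono K n (fun y => ?_) _) (sv_le_one K B.one n _)
    split_ifs <;> simp
  have hIt : I ≠ ⊤ := (I1.trans_lt ENNReal.one_lt_top).ne
  have h1 : ofReal l ≤ ofReal (C * (A * s) ^ p) * I + ofReal (C * ε * A ^ (p - 1) * s ^ p) * sv K n (L, L)
      + ofReal (C ^ 2 / (A * s) ^ 2) * ex K n (fun y => ofReal (V y)) (L, L) := by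
    refine (ex_sub K B.L_s n (L, L)).trans ?_
    rw [hI, sv, ← ex_mul, ← ex_mul, ← ex_mul, ← ex_addf, ← ex_addf]
    refine ex_mono K n (fun y => ?_) _
    refine (ENNReal.ofReal_le_ofReal (B.L_pt ε0 A1 s0 y)).trans ?_
    have n3 : 0 ≤ C ^ 2 / (A * s) ^ 2 * max 0 (V y) := mul_nonneg (by positivity) (le_max_left _ _)
    have n1 : 0 ≤ C * (A * s) ^ p * (if y ∈ box ε A s then (1 : ℝ) else 0) := mul_nonneg (by positivity) (by split_ifs <;> norm_num)
    rw [ENNReal.ofReal_add (by positivity) n3, ENNReal.ofReal_add n1 (by positivity),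
      ENNReal.ofReal_mul (by positivity), ENNReal.ofReal_mul (q := max 0 (V y)) (by positivity)]
    have m1 : ofReal (if y ∈ box ε A s then (1 : ℝ) else 0) = if y ∈ box ε A s then 1 else 0 := by split_ifs <;> simp
    have m2 : ofReal (max 0 (V y)) = ofReal (V y) := by
      rcases le_total 0 (V y) with h | h
      · rw [max_eq_right h]
      · rw [max_eq_left h, ENNReal.ofReal_of_nonpos h]; simp
    rw [m1, m2, mul_one]
  have h2 : ofReal (C * ε * A ^ (p - 1) * s ^ p) * sv K n (L, L) ≤ ofReal (l / 3) := by
    refine (mul_le_mul' le_rfl (HM n hn (L, L))).trans ?_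
    rw [← ENNReal.ofReal_mul (by positivity), ← ENNReal.ofReal_mul (by positivity)]
    refine ENNReal.ofReal_le_ofReal (le_of_eq ?_)
    rw [spi, hε]
    have : 0 < A ^ (p - 1) := by positivity
    change C * (l / (3 * (C * M * A ^ (p - 1) * u))) * A ^ (p - 1) * s ^ p * (M * (s ^ p)⁻¹ * u) = l / 3
    field_simp
  have h3 : ofReal (C ^ 2 / (A * s) ^ 2) * ex K n (fun y => ofReal (V y)) (L, L) ≤ ofReal (l / 3) := by
    refine (mul_le_mul' le_rfl (B.V_ex n (L, L))).trans ?_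
    rw [← ENNReal.ofReal_mul (by linarith), ← ENNReal.ofReal_natCast, ← ENNReal.ofReal_mul (by positivity),
      ← ENNReal.ofReal_add hv (by positivity), ← ENNReal.ofReal_mul (by positivity)]
    refine ENNReal.ofReal_le_ofReal ?_
    rw [mul_pow, s2, div_mul_eq_mul_div, div_le_iff₀ (by positivity)]
    change C ^ 2 * (v + n * (C * u)) ≤ _
    have a1 : C ^ 2 * (v + n * (C * u)) ≤ n * (C ^ 2 * (v + C * u)) := by
      have : 0 ≤ (n - 1) * (C ^ 2 * v) := mul_nonneg (by linarith) (by positivity)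
      nlinarith
    have a2 : C ^ 2 * (v + C * u) ≤ l / 3 * A := by
      rw [hA]
      have e : l / 3 * (1 + 3 * C ^ 2 * (v + C * u) / l) = l / 3 + C ^ 2 * (v + C * u) := by field_simp
      rw [e]; linarith
    have a3 : l / 3 * A ≤ l / 3 * A ^ 2 := mul_le_mul_of_nonneg_left (by nlinarith) (by positivity)
    calc _ ≤ n * (C ^ 2 * (v + C * u)) := a1
      _ ≤ n * (l / 3 * A ^ 2) := mul_le_mul_of_nonneg_left (a2.trans a3) (by linarith)
      _ = _ := by ring
  have h4 := h1.trans (add_le_add (add_le_add le_rfl h2) h3)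
  rw [← ENNReal.ofReal_toReal hIt] at h4 ⊢
  rw [← ENNReal.ofReal_mul (by positivity), ← ENNReal.ofReal_add (by positivity) (by positivity),
    ← ENNReal.ofReal_add (by positivity) (by positivity), ENNReal.ofReal_le_ofReal_iff (by positivity)] at h4
  refine ENNReal.ofReal_le_ofReal ?_
  rw [spi, ← div_eq_mul_inv, div_le_iff₀ sp0, div_le_iff₀ (by positivity)]
  rw [Real.mul_rpow (by linarith) s0.le] at h4
  nlinarith
end
end SB

namespace SB
open MeasureTheory

/-- characters -/
def ee (v : ℤ × ℤ) (t : ℝ × ℝ) : ℂ := Complex.exp (((v.1 * t.1 + v.2 * t.2 : ℝ) : ℂ) * Complex.I)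

theorem ee_add (v w : ℤ × ℤ) (t : ℝ × ℝ) : ee (v + w) t = ee v t * ee w t := by
  unfold ee
  rw [← Complex.exp_add]
  congr 1
  push_cast [Prod.fst_add, Prod.snd_add]
  ring

theorem ee_norm (v : ℤ × ℤ) (t : ℝ × ℝ) : ‖ee v t‖ = 1 := Complex.norm_exp_ofReal_mul_I _

theorem ee_cont (v : ℤ × ℤ) : Continuous (ee v) := by unfold ee; fun_prop

/-- characteristic function -/
def ch (μ : ℤ × ℤ → ℝ) (t : ℝ × ℝ) : ℂ := ∑' d, (μ d : ℂ) * ee d t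

/-- fundamental square -/
def Sq : Set (ℝ × ℝ) := Set.Ioc (-Real.pi) Real.pi ×ˢ Set.Ioc (-Real.pi) Real.pi

theorem orth1 (k : ℤ) : ∫ x in Set.Ioc (-Real.pi) Real.pi, Complex.exp (((k * x : ℝ) : ℂ) * Complex.I)
    = if k = 0 then ((2 * Real.pi : ℝ) : ℂ) else 0 := by
  have hpi := Real.pi_pos
  rw [← intervalIntegral.integral_of_le (by linarith)]
  split_ifs with h
  · subst h
    simp
    ring
  · have hk : (k : ℂ) * Complex.I ≠ 0 := by simp [h, Complex.I_ne_zero]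
    have := integral_exp_mul_complex (a := -Real.pi) (b := Real.pi) hk
    have e : ∀ x : ℝ, ((k * x : ℝ) : ℂ) * Complex.I = (k : ℂ) * Complex.I * x := by intro x; push_cast; ring
    simp only [e]
    rw [this, div_eq_zero_iff]
    left
    rw [sub_eq_zero, Complex.exp_eq_exp_iff_exists_int]
    exact ⟨k, by push_cast; ring⟩

theorem orth (v : ℤ × ℤ) : ∫ t in Sq, ee v t = if v = 0 then ((4 * Real.pi ^ 2 : ℝ) : ℂ) else 0 := by
  have e : ∀ t : ℝ × ℝ, ee v t = Complex.exp (((v.1 * t.1 : ℝ) : ℂ) * Complex.I) * Complex.exp (((v.2 * t.2 : ℝ) : ℂ) * Complex.I) := by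
    intro t; unfold ee; rw [← Complex.exp_add]; congr 1; push_cast; ring
  simp only [e]
  unfold Sq
  have := setIntegral_prod_mul (μ := (volume : Measure ℝ)) (ν := (volume : Measure ℝ))
    (fun x : ℝ => Complex.exp (((v.1 * x : ℝ) : ℂ) * Complex.I))
    (fun x : ℝ => Complex.exp (((v.2 * x : ℝ) : ℂ) * Complex.I)) (Set.Ioc (-Real.pi) Real.pi) (Set.Ioc (-Real.pi) Real.pi)
  rw [← Measure.volume_eq_prod] at this
  rw [this, orth1, orth1]
  by_cases h1 : v.1 = 0 <;> by_cases h2 : v.2 = 0 <;> simp [h1, h2, Prod.ext_iff]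
  ring

theorem Sq_fin : volume Sq < ⊤ := by
  unfold Sq
  rw [Measure.volume_eq_prod, Measure.prod_prod]
  simp
  exact ENNReal.mul_lt_top (by simp) (by simp)

theorem Sq_meas : MeasurableSet Sq := measurableSet_Ioc.prod measurableSet_Ioc

section
variable {μ : ℤ × ℤ → ℝ} {s11 s12 s22 : ℝ}

theorem Law.ch_sum (h : Law μ s11 s12 s22) (t : ℝ × ℝ) : Summable (fun d => (μ d : ℂ) * ee d t) := by
  refine Summable.of_norm ?_
  simp only [norm_mul, ee_norm, mul_one, Complex.norm_real, Real.norm_eq_abs, abs_of_nonneg (h.nonneg _)]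
  exact h.mass.summable

theorem Law.ch_cont (h : Law μ s11 s12 s22) : Continuous (ch μ) := by
  refine continuous_tsum (fun d => continuous_const.mul (ee_cont d)) h.mass.summable fun d t => ?_
  simp only [norm_mul, ee_norm, mul_one, Complex.norm_real, Real.norm_eq_abs, abs_of_nonneg (h.nonneg _)]
  exact le_rfl

theorem Law.ch_le (h : Law μ s11 s12 s22) (t : ℝ × ℝ) : ‖ch μ t‖ ≤ 1 := by
  refine tsum_of_norm_bounded h.mass fun d => ?_
  simp only [norm_mul, ee_norm, mul_one, Complex.norm_real, Real.norm_eq_abs, abs_of_nonneg (h.nonneg _)]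
  exact le_rfl

theorem Law.pw_le_one (h : Law μ s11 s12 s22) (n : ℕ) (x y : ℤ × ℤ) : pw (kf μ) n x y ≤ 1 :=
  (pw_le_sv _ n x y).trans (sv_le_one _ (fun z => (kf_sum h z).le) n x)

/-- real transition probabilities of the free walk -/
def fr (μ : ℤ × ℤ → ℝ) (n : ℕ) (x y : ℤ × ℤ) : ℝ := (pw (kf μ) n x y).toReal

theorem Law.fr_nonneg (n : ℕ) (x y : ℤ × ℤ) : 0 ≤ fr μ n x y := ENNReal.toReal_nonneg

theorem Law.fr_le_one (h : Law μ s11 s12 s22) (n : ℕ) (x y : ℤ × ℤ) : fr μ n x y ≤ 1 := by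
  have := ENNReal.toReal_mono ENNReal.one_ne_top (h.pw_le_one n x y)
  simpa [fr] using this

theorem Law.fr_succ (h : Law μ s11 s12 s22) (n : ℕ) (x y : ℤ × ℤ) :
    HasSum (fun d => μ d * fr μ n (x + d) y) (fr μ (n + 1) x y) := by
  have hs : Summable (fun d => μ d * fr μ n (x + d) y) := by
    refine Summable.of_nonneg_of_le (fun d => mul_nonneg (h.nonneg d) ENNReal.toReal_nonneg) (fun d => ?_) h.mass.summable
    exact mul_le_of_le_one_right (h.nonneg d) (h.fr_le_one n _ _)
  have : fr μ (n + 1) x y = ∑' d, μ d * fr μ n (x + d) y := by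
    unfold fr
    rw [show pw (kf μ) (n + 1) x y = ∑' z, kf μ x z * pw (kf μ) n z y from rfl, tsum_shift x, ENNReal.tsum_toReal_eq]
    · refine tsum_congr fun d => ?_
      rw [ENNReal.toReal_mul, kf, add_sub_cancel_left, ENNReal.toReal_ofReal (h.nonneg d)]
    · intro d
      refine ENNReal.mul_ne_top ENNReal.ofReal_ne_top (ne_of_lt ((h.pw_le_one n _ _).trans_lt ENNReal.one_lt_top))
  rw [this]; exact hs.hasSum

theorem Law.int_on (h : Law μ s11 s12 s22) (n : ℕ) (v : ℤ × ℤ) :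
    IntegrableOn (fun t => ch μ t ^ n * ee v t) Sq := by
  refine Measure.integrableOn_of_bounded Sq_fin.ne ?_ (M := 1) ?_
  · exact ((h.ch_cont.pow n).mul (ee_cont v)).aestronglyMeasurable
  · refine Filter.Eventually.of_forall fun t => ?_
    rw [norm_mul, norm_pow, ee_norm, mul_one]
    exact pow_le_one₀ (norm_nonneg _) (h.ch_le t)

theorem Law.inversion (h : Law μ s11 s12 s22) (n : ℕ) (x y : ℤ × ℤ) :
    ((4 * Real.pi ^ 2 * fr μ n x y : ℝ) : ℂ) = ∫ t in Sq, ch μ t ^ n * ee (x - y) t := by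
  induction n generalizing x with
  | zero =>
    simp only [pow_zero, one_mul]
    rw [orth]
    by_cases hxy : x = y
    · subst hxy; simp [fr, pw]
    · simp [fr, pw, hxy, sub_eq_zero]
  | succ n ih =>
    have h1 := (Complex.hasSum_ofReal.2 ((h.fr_succ n x y).mul_left (4 * Real.pi ^ 2)))
    have h2 : HasSum (fun d => ∫ t in Sq, (μ d : ℂ) * (ch μ t ^ n * ee (x + d - y) t))
        (∫ t in Sq, ∑' d, (μ d : ℂ) * (ch μ t ^ n * ee (x + d - y) t)) := by
      refine hasSum_integral_of_summable_integral_norm (fun d => (h.int_on n _).const_mul _) ?_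
      have : ∀ d, ∫ t in Sq, ‖(μ d : ℂ) * (ch μ t ^ n * ee (x + d - y) t)‖ = μ d * ∫ t in Sq, ‖ch μ t ^ n‖ := by
        intro d
        rw [← integral_const_mul]
        simp only [norm_mul, ee_norm, mul_one, Complex.norm_real, Real.norm_eq_abs, abs_of_nonneg (h.nonneg _)]
      simp only [this]
      exact h.mass.summable.mul_right _
    have h3 : ∀ d, ((4 * Real.pi ^ 2 * (μ d * fr μ n (x + d) y) : ℝ) : ℂ)
        = ∫ t in Sq, (μ d : ℂ) * (ch μ t ^ n * ee (x + d - y) t) := by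
      intro d
      rw [integral_const_mul, ← ih]; push_cast; ring
    rw [← h1.tsum_eq]
    simp only [h3]
    rw [h2.tsum_eq]
    congr 1
    funext t
    rw [pow_succ, show ch μ t ^ n * ch μ t * ee (x - y) t = ch μ t * (ch μ t ^ n * ee (x - y) t) by ring]
    rw [show ch μ t * (ch μ t ^ n * ee (x - y) t) = (∑' d, (μ d : ℂ) * ee d t) * (ch μ t ^ n * ee (x - y) t) from rfl,
      ← tsum_mul_right]
    refine tsum_congr fun d => ?_
    rw [show x + d - y = d + (x - y) by ring, ee_add]; ring

/-- atoms ensuring strong aperiodicity -/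
structure Atoms (μ : ℤ × ℤ → ℝ) (m : ℝ) : Prop where
  pos : 0 < m
  a1 : m ≤ μ (1, 0)
  a2 : m ≤ μ (2, 0)
  a3 : m ≤ μ (-1, 0)
  a4 : m ≤ μ (-1, 1)

theorem exp_pair (x y : ℝ) : ‖Complex.exp ((x : ℂ) * Complex.I) + Complex.exp ((y : ℂ) * Complex.I)‖ ≤ 2 * |Real.cos ((x - y) / 2)| := by
  have : Complex.exp ((x : ℂ) * Complex.I) + Complex.exp ((y : ℂ) * Complex.I)
      = Complex.exp ((((x + y) / 2 : ℝ) : ℂ) * Complex.I) * ((2 * Real.cos ((x - y) / 2) : ℝ) : ℂ) := by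
    push_cast
    rw [Complex.two_cos, mul_add, ← Complex.exp_add, ← Complex.exp_add]
    congr 1 <;> congr 1 <;> ring
  rw [this, norm_mul, Complex.norm_exp_ofReal_mul_I, Complex.norm_real, Real.norm_eq_abs, abs_mul]
  simp

theorem Law.ch_gauss (h : Law μ s11 s12 s22) {m : ℝ} (ha : Atoms μ m) :
    ∃ c : ℝ, 0 < c ∧ ∀ t ∈ Sq, ‖ch μ t‖ ≤ Real.exp (-(c * t.1 ^ 2) - c * t.2 ^ 2) := by
  have hpi := Real.pi_pos
  have m0 := ha.pos
  refine ⟨m * (1 / Real.pi ^ 2), by positivity, fun t ht => ?_⟩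
  set S : Finset (ℤ × ℤ) := {(1, 0), (2, 0), (-1, 0), (-1, 1)} with hS
  have hsum : ∀ f : ℤ × ℤ → ℝ, ∑ d ∈ S, f d = f (1, 0) + f (2, 0) + f (-1, 0) + f (-1, 1) := by
    intro f
    rw [hS, Finset.sum_insert (by decide), Finset.sum_insert (by decide), Finset.sum_insert (by decide), Finset.sum_singleton]
    ring
  have hsumC : ∀ f : ℤ × ℤ → ℂ, ∑ d ∈ S, f d = f (1, 0) + f (2, 0) + f (-1, 0) + f (-1, 1) := by
    intro f
    rw [hS, Finset.sum_insert (by decide), Finset.sum_insert (by decide), Finset.sum_insert (by decide), Finset.sum_singleton]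
    ring
  have k1 : HasSum (fun d => if d ∈ S then m else 0) (4 * m) := by
    have := hasSum_sum_of_ne_finset_zero (L := SummationFilter.unconditional _) (s := S) (f := fun d => if d ∈ S then m else 0) (fun b hb => by simp [hb])
    rw [hsum] at this
    convert this using 1
    simp [hS]; ring
  have k2 : HasSum (fun d => (if d ∈ S then (m : ℂ) else 0) * ee d t)
      (m * (ee (1, 0) t + ee (2, 0) t) + m * (ee (-1, 0) t + ee (-1, 1) t)) := by
    have := hasSum_sum_of_ne_finset_zero (L := SummationFilter.unconditional _) (s := S) (f := fun d => (if d ∈ S then (m : ℂ) else 0) * ee d t) (fun b hb => by simp [hb])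
    rw [hsumC] at this
    convert this using 1
    simp [hS]; ring
  have k3 := (h.ch_sum t).hasSum.sub k2
  have k4 := h.mass.sub k1
  have k5 : ‖ch μ t - (m * (ee (1, 0) t + ee (2, 0) t) + m * (ee (-1, 0) t + ee (-1, 1) t))‖ ≤ 1 - 4 * m := by
    rw [show ch μ t = ∑' d, (μ d : ℂ) * ee d t from rfl, ← k3.tsum_eq]
    refine tsum_of_norm_bounded k4 fun d => ?_
    rw [← sub_mul, norm_mul, ee_norm, mul_one]
    have : (μ d : ℂ) - (if d ∈ S then (m : ℂ) else 0) = ((μ d - if d ∈ S then m else 0 : ℝ) : ℂ) := by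
      push_cast; split_ifs <;> simp
    rw [this, Complex.norm_real, Real.norm_eq_abs, abs_of_nonneg]
    split_ifs with hd
    · simp only [hS, Finset.mem_insert, Finset.mem_singleton] at hd
      rcases hd with rfl | rfl | rfl | rfl
      · linarith [ha.a1]
      · linarith [ha.a2]
      · linarith [ha.a3]
      · linarith [ha.a4]
    · linarith [h.nonneg d]
  have cosb : ∀ s : ℝ, -Real.pi < s → s ≤ Real.pi → |Real.cos (s / 2)| ≤ 1 - 1 / Real.pi ^ 2 * (s ^ 2 / 2) := by
    intro s h1 h2
    rw [abs_of_nonneg (Real.cos_nonneg_of_mem_Icc ⟨by linarith, by linarith⟩)]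
    have := Real.cos_le_one_sub_mul_cos_sq (x := s / 2) (by rw [abs_le]; constructor <;> linarith)
    have e : 2 / Real.pi ^ 2 * (s / 2) ^ 2 = 1 / Real.pi ^ 2 * (s ^ 2 / 2) := by ring
    linarith
  have p1 : ‖ee (1, 0) t + ee (2, 0) t‖ ≤ 2 * (1 - 1 / Real.pi ^ 2 * (t.1 ^ 2 / 2)) := by
    refine (exp_pair _ _).trans (mul_le_mul_of_nonneg_left ?_ (by norm_num))
    refine le_trans (le_of_eq ?_) (cosb t.1 ht.1.1 ht.1.2)
    rw [← Real.cos_neg]; congr 2; push_cast; ring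
  have p2 : ‖ee (-1, 0) t + ee (-1, 1) t‖ ≤ 2 * (1 - 1 / Real.pi ^ 2 * (t.2 ^ 2 / 2)) := by
    refine (exp_pair _ _).trans (mul_le_mul_of_nonneg_left ?_ (by norm_num))
    refine le_trans (le_of_eq ?_) (cosb t.2 ht.2.1 ht.2.2)
    rw [← Real.cos_neg]; congr 2; push_cast; ring
  have p3 : ‖ch μ t‖ ≤ (1 - 4 * m) + (m * ‖ee (1, 0) t + ee (2, 0) t‖ + m * ‖ee (-1, 0) t + ee (-1, 1) t‖) := by
    have n1 : ∀ z : ℂ, ‖(m : ℂ) * z‖ = m * ‖z‖ := by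
      intro z; rw [norm_mul, Complex.norm_real, Real.norm_eq_abs, abs_of_pos m0]
    have := norm_add_le (ch μ t - (m * (ee (1, 0) t + ee (2, 0) t) + m * (ee (-1, 0) t + ee (-1, 1) t)))
      (m * (ee (1, 0) t + ee (2, 0) t) + m * (ee (-1, 0) t + ee (-1, 1) t))
    rw [sub_add_cancel] at this
    have h2 := norm_add_le ((m : ℂ) * (ee (1, 0) t + ee (2, 0) t)) (m * (ee (-1, 0) t + ee (-1, 1) t))
    rw [n1, n1] at h2
    linarith
  have q1 := mul_le_mul_of_nonneg_left p1 m0.le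
  have q2 := mul_le_mul_of_nonneg_left p2 m0.le
  have := Real.add_one_le_exp (-(m * (1 / Real.pi ^ 2) * t.1 ^ 2) - m * (1 / Real.pi ^ 2) * t.2 ^ 2)
  nlinarith
end
end SB

namespace SB
open MeasureTheory

/-- gaussian bound -/
def gb (c : ℝ) (t : ℝ × ℝ) : ℝ := Real.exp (-c * t.1 ^ 2) * Real.exp (-c * t.2 ^ 2)

theorem gb_int {c : ℝ} (hc : 0 < c) : Integrable (gb c) := by
  unfold gb
  rw [Measure.volume_eq_prod]
  exact Integrable.mul_prod (f := fun x : ℝ => Real.exp (-c * x ^ 2)) (g := fun x : ℝ => Real.exp (-c * x ^ 2))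
    (integrable_exp_neg_mul_sq hc) (integrable_exp_neg_mul_sq hc)

theorem gb_val {c : ℝ} (hc : 0 < c) : ∫ t, gb c t = Real.pi / c := by
  unfold gb
  rw [Measure.volume_eq_prod]
  rw [integral_prod_mul (fun x : ℝ => Real.exp (-c * x ^ 2)) (fun x : ℝ => Real.exp (-c * x ^ 2)), integral_gaussian]
  exact Real.mul_self_sqrt (by have := Real.pi_pos; positivity)

theorem gb_int1 {c : ℝ} (hc : 0 < c) : Integrable (fun t => gb c t * (|t.1| + |t.2|)) := by
  have h := integrable_exp_neg_mul_sq hc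
  have h1 := (integrable_mul_exp_neg_mul_sq hc).norm
  have a := Integrable.mul_prod h1 h
  have b := Integrable.mul_prod h h1
  rw [← Measure.volume_eq_prod] at a b
  refine (a.add b).congr (Filter.Eventually.of_forall fun t => ?_)
  simp only [Pi.add_apply, gb, norm_mul, Real.norm_eq_abs, Real.abs_exp]
  ring

section
variable {μ : ℤ × ℤ → ℝ} {s11 s12 s22 : ℝ}

theorem pow_gb {c : ℝ} {t : ℝ × ℝ} (n : ℕ) {z : ℂ} (h : ‖z‖ ≤ Real.exp (-(c * t.1 ^ 2) - c * t.2 ^ 2)) :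
    ‖z ^ n‖ ≤ gb (c * n) t := by
  rw [norm_pow]
  refine (pow_le_pow_left₀ (norm_nonneg _) h n).trans (le_of_eq ?_)
  unfold gb
  rw [← Real.exp_nat_mul, ← Real.exp_add]
  congr 1; ring

theorem Law.fr_upper (h : Law μ s11 s12 s22) {m : ℝ} (ha : Atoms μ m) :
    ∃ C : ℝ, 0 < C ∧ ∀ n : ℕ, 1 ≤ n → ∀ x y, fr μ n x y ≤ C / n := by
  obtain ⟨c, hc, H⟩ := h.ch_gauss ha
  have hpi := Real.pi_pos
  refine ⟨1 / (4 * Real.pi * c), by positivity, fun n hn x y => ?_⟩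
  have hn' : (1 : ℝ) ≤ n := by exact_mod_cast hn
  have cn : 0 < c * n := by positivity
  have h1 := congrArg norm (h.inversion n x y)
  rw [Complex.norm_real, Real.norm_eq_abs, abs_of_nonneg (mul_nonneg (by positivity) (Law.fr_nonneg n x y))] at h1
  have h2 : ‖∫ t in Sq, ch μ t ^ n * ee (x - y) t‖ ≤ ∫ t in Sq, gb (c * n) t := by
    refine norm_integral_le_of_norm_le (gb_int cn).integrableOn ?_
    refine (ae_restrict_iff' Sq_meas).2 (Filter.Eventually.of_forall fun t ht => ?_)
    rw [norm_mul, ee_norm, mul_one]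
    exact pow_gb n (H t ht)
  have h3 : ∫ t in Sq, gb (c * n) t ≤ ∫ t, gb (c * n) t :=
    setIntegral_le_integral (gb_int cn) (Filter.Eventually.of_forall fun t => by simp only [Pi.zero_apply]; unfold gb; positivity)
  rw [gb_val cn] at h3
  rw [← h1] at h2
  have h4 := h2.trans h3
  rw [div_div, le_div_iff₀ (by positivity)]
  rw [le_div_iff₀ cn] at h4
  have : Real.pi * (fr μ n x y * (4 * Real.pi * c * n)) ≤ Real.pi * 1 := by nlinarith
  exact le_of_mul_le_mul_left this hpi

theorem taylor_cis (x : ℝ) : ‖Complex.exp ((x : ℂ) * Complex.I) - (1 + x * Complex.I - x ^ 2 / 2)‖ ≤ 4 * |x| ^ 3 := by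
  rcases le_total |x| 1 with h | h
  · have hn : ‖(x : ℂ) * Complex.I‖ = |x| := by simp
    have := Complex.exp_bound (x := (x : ℂ) * Complex.I) (by rw [hn]; exact h) (n := 3) (by norm_num)
    rw [hn] at this
    have e : ∑ m ∈ Finset.range 3, ((x : ℂ) * Complex.I) ^ m / (m.factorial : ℂ) = 1 + x * Complex.I - x ^ 2 / 2 := by
      simp [Finset.sum_range_succ, mul_pow, Nat.factorial]
      ring
    rw [e] at this
    refine this.trans ?_
    have : 0 ≤ |x| ^ 3 := by positivity
    norm_num [Nat.factorial]
    linarith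
  · have h1 := norm_sub_le (Complex.exp ((x : ℂ) * Complex.I)) (1 + x * Complex.I - x ^ 2 / 2)
    have h2 := norm_sub_le (1 + (x : ℂ) * Complex.I) (x ^ 2 / 2)
    have h3 := norm_add_le (1 : ℂ) ((x : ℂ) * Complex.I)
    have e1 : ‖(x : ℂ) * Complex.I‖ = |x| := by simp
    have e2 : ‖(x : ℂ) ^ 2 / 2‖ = |x| ^ 2 / 2 := by simp
    rw [Complex.norm_exp_ofReal_mul_I] at h1
    rw [e1, norm_one] at h3
    rw [e2] at h2
    have : |x| ≤ |x| ^ 3 := by nlinarith [sq_nonneg (|x| - 1), sq_nonneg (|x|), mul_nonneg (sub_nonneg.2 h) (sq_nonneg |x|)]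
    have : |x| ^ 2 ≤ |x| ^ 3 := by nlinarith [sq_nonneg (|x|), mul_nonneg (sub_nonneg.2 h) (sq_nonneg |x|)]
    linarith

theorem Law.ch_taylor (h : Law μ s11 s12 s22) : ∃ C : ℝ, 0 < C ∧ ∀ t : ℝ × ℝ,
    ‖ch μ t - 1 + ((s11 * t.1 ^ 2 + 2 * s12 * (t.1 * t.2) + s22 * t.2 ^ 2) / 2 : ℝ)‖ ≤ C * (|t.1| + |t.2|) ^ 3 := by
  have hM := (h.mom 3).hasSum
  set M := ∑' d : ℤ × ℤ, μ d * (|(d.1 : ℝ)| + |(d.2 : ℝ)|) ^ 3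
  have M0 : 0 ≤ M := tsum_nonneg fun d => mul_nonneg (h.nonneg d) (by positivity)
  refine ⟨4 * M + 1, by positivity, fun t => ?_⟩
  set x : ℤ × ℤ → ℝ := fun d => d.1 * t.1 + d.2 * t.2 with hx
  have k1 : HasSum (fun d => μ d * x d) 0 := by
    have := (h.mean1.mul_right t.1).add (h.mean2.mul_right t.2)
    refine hs_congr this (fun d => ?_) ?_
    · simp only [hx]; ring
    · ring
  have k2 : HasSum (fun d => μ d * (x d ^ 2 / 2)) ((s11 * t.1 ^ 2 + 2 * s12 * (t.1 * t.2) + s22 * t.2 ^ 2) / 2) := by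
    have := ((h.var1.mul_right (t.1 ^ 2 / 2)).add (h.cov.mul_right (t.1 * t.2))).add (h.var2.mul_right (t.2 ^ 2 / 2))
    refine hs_congr this (fun d => ?_) ?_
    · simp only [hx]; ring
    · ring
  have k0 := Complex.hasSum_ofReal.2 h.mass
  have k1' := (Complex.hasSum_ofReal.2 k1).mul_right Complex.I
  have k2' := Complex.hasSum_ofReal.2 k2
  have k3 := (((h.ch_sum t).hasSum.sub k0).sub k1').add k2'
  have k4 : ch μ t - 1 + ((s11 * t.1 ^ 2 + 2 * s12 * (t.1 * t.2) + s22 * t.2 ^ 2) / 2 : ℝ)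
      = ∑' d, ((μ d : ℂ) * ee d t - (μ d : ℂ) - ((μ d * x d : ℝ) : ℂ) * Complex.I + ((μ d * (x d ^ 2 / 2) : ℝ) : ℂ)) := by
    rw [k3.tsum_eq]; simp [ch]
  rw [k4]
  have k5 := hM.mul_left (4 * (|t.1| + |t.2|) ^ 3)
  have k6 : 4 * (|t.1| + |t.2|) ^ 3 * M ≤ (4 * M + 1) * (|t.1| + |t.2|) ^ 3 := by
    have : 0 ≤ (|t.1| + |t.2|) ^ 3 := by positivity
    nlinarith
  refine le_trans (tsum_of_norm_bounded k5 fun d => ?_) k6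
  have e : (μ d : ℂ) * ee d t - (μ d : ℂ) - ((μ d * x d : ℝ) : ℂ) * Complex.I + ((μ d * (x d ^ 2 / 2) : ℝ) : ℂ)
      = (μ d : ℂ) * (Complex.exp ((x d : ℂ) * Complex.I) - (1 + x d * Complex.I - x d ^ 2 / 2)) := by
    rw [show ee d t = Complex.exp ((x d : ℂ) * Complex.I) from rfl]
    push_cast; ring
  rw [e, norm_mul, Complex.norm_real, Real.norm_eq_abs, abs_of_nonneg (h.nonneg d)]
  have l1 := taylor_cis (x d)
  have l2 : |x d| ≤ (|t.1| + |t.2|) * (|(d.1 : ℝ)| + |(d.2 : ℝ)|) := by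
    refine (abs_add_le _ _).trans ?_
    rw [abs_mul, abs_mul]
    nlinarith [abs_nonneg t.1, abs_nonneg t.2, abs_nonneg (d.1 : ℝ), abs_nonneg (d.2 : ℝ),
      mul_nonneg (abs_nonneg t.1) (abs_nonneg (d.2 : ℝ)), mul_nonneg (abs_nonneg t.2) (abs_nonneg (d.1 : ℝ))]
  have l3 := pow_le_pow_left₀ (abs_nonneg _) l2 3
  rw [mul_pow] at l3
  calc μ d * _ ≤ μ d * (4 * ((|t.1| + |t.2|) ^ 3 * (|(d.1 : ℝ)| + |(d.2 : ℝ)|) ^ 3)) :=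
        mul_le_mul_of_nonneg_left (by linarith) (h.nonneg d)
    _ = _ := by ring

theorem Law.ch_lim (h : Law μ s11 s12 s22) (t : ℝ × ℝ) :
    Filter.Tendsto (fun n : ℕ => ch μ ((Real.sqrt n)⁻¹ • t) ^ n) Filter.atTop
      (nhds (Complex.exp (((-(s11 * t.1 ^ 2 + 2 * s12 * (t.1 * t.2) + s22 * t.2 ^ 2) / 2 : ℝ)) : ℂ))) := by
  obtain ⟨C, hC, H⟩ := h.ch_taylor
  set q := (s11 * t.1 ^ 2 + 2 * s12 * (t.1 * t.2) + s22 * t.2 ^ 2) / 2 with hq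
  have key : Filter.Tendsto (fun n : ℕ => (n : ℂ) * (ch μ ((Real.sqrt n)⁻¹ • t) - 1)) Filter.atTop (nhds ((-q : ℝ) : ℂ)) := by
    rw [tendsto_iff_norm_sub_tendsto_zero]
    have lim : Filter.Tendsto (fun n : ℕ => C * (|t.1| + |t.2|) ^ 3 * (Real.sqrt n)⁻¹) Filter.atTop (nhds 0) := by
      have : Filter.Tendsto (fun n : ℕ => (Real.sqrt n)⁻¹) Filter.atTop (nhds 0) :=
        (Real.tendsto_sqrt_atTop.comp tendsto_natCast_atTop_atTop).inv_tendsto_atTop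
      simpa using this.const_mul (C * (|t.1| + |t.2|) ^ 3)
    refine squeeze_zero' (Filter.Eventually.of_forall fun n => norm_nonneg _) ?_ lim
    filter_upwards [Filter.eventually_ge_atTop 1] with n hn
    have hn' : (1 : ℝ) ≤ n := by exact_mod_cast hn
    set s := Real.sqrt n with hs
    have s0 : 0 < s := Real.sqrt_pos.2 (by linarith)
    have s2 : s ^ 2 = n := Real.sq_sqrt (by linarith)
    have hh := H (s⁻¹ • t)
    simp only [Prod.smul_fst, Prod.smul_snd, smul_eq_mul, abs_mul, abs_of_pos (inv_pos.2 s0)] at hh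
    have e1 : (s11 * (s⁻¹ * t.1) ^ 2 + 2 * s12 * (s⁻¹ * t.1 * (s⁻¹ * t.2)) + s22 * (s⁻¹ * t.2) ^ 2) / 2 = q / n := by
      rw [hq, ← s2]; field_simp
    rw [e1] at hh
    have n0 : (n : ℂ) ≠ 0 := by exact_mod_cast (by omega : n ≠ 0)
    have e2 : (n : ℂ) * (ch μ (s⁻¹ • t) - 1) - ((-q : ℝ) : ℂ) = (n : ℂ) * (ch μ (s⁻¹ • t) - 1 + ((q / n : ℝ) : ℂ)) := by
      push_cast; field_simp; ring
    rw [e2, norm_mul]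
    have e3 : ‖(n : ℂ)‖ = s ^ 2 := by rw [s2]; simp
    rw [e3]
    refine (mul_le_mul_of_nonneg_left hh (by positivity)).trans (le_of_eq ?_)
    field_simp
  have := Complex.tendsto_one_add_pow_exp_of_tendsto key
  simp only [add_sub_cancel] at this
  convert this using 3
  rw [hq]; push_cast; ring

theorem Law.fr_lower (h : Law μ s11 s12 s22) {m : ℝ} (ha : Atoms μ m) :
    ∃ (c δ : ℝ) (n0 : ℕ), 0 < c ∧ 0 < δ ∧ 1 ≤ n0 ∧ ∀ n : ℕ, n0 ≤ n → ∀ x y : ℤ × ℤ,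
      |((x - y).1 : ℝ)| ≤ δ * Real.sqrt n → |((x - y).2 : ℝ)| ≤ δ * Real.sqrt n → c / n ≤ fr μ n x y := by
  obtain ⟨b, hb, Hb⟩ := h.ch_gauss ha
  have hpi := Real.pi_pos
  set Hn : ℕ → ℝ × ℝ → ℂ := fun n t => Sq.indicator (fun θ => ch μ θ ^ n) ((Real.sqrt n)⁻¹ • t) with hHn
  set g : ℝ × ℝ → ℝ := fun t => Real.exp (-(s11 * t.1 ^ 2 + 2 * s12 * (t.1 * t.2) + s22 * t.2 ^ 2) / 2) with hg
  have bound : ∀ n : ℕ, 1 ≤ n → ∀ t, ‖Hn n t‖ ≤ gb b t := by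
    intro n hn t
    have hn' : (1 : ℝ) ≤ n := by exact_mod_cast hn
    have s0 : 0 < Real.sqrt n := Real.sqrt_pos.2 (by linarith)
    have s2 : Real.sqrt n ^ 2 = n := Real.sq_sqrt (by linarith)
    simp only [hHn]
    by_cases ht : (Real.sqrt n)⁻¹ • t ∈ Sq
    · rw [Set.indicator_of_mem ht]
      refine (pow_gb n (Hb _ ht)).trans (le_of_eq ?_)
      unfold gb
      simp only [Prod.smul_fst, Prod.smul_snd, smul_eq_mul]
      rw [mul_pow, mul_pow, inv_pow, s2]
      congr 2 <;> field_simp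
    · rw [Set.indicator_of_notMem ht, norm_zero]; unfold gb; positivity
  have meas : ∀ n : ℕ, Measurable (Hn n) := by
    intro n
    exact ((h.ch_cont.pow n).measurable.indicator Sq_meas).comp (measurable_const_smul _)
  have lim : ∀ t, Filter.Tendsto (fun n => Hn n t) Filter.atTop (nhds ((g t : ℝ) : ℂ)) := by
    intro t
    have := h.ch_lim t
    rw [← Complex.ofReal_exp] at this
    refine this.congr' ?_
    have z : Filter.Tendsto (fun n : ℕ => (Real.sqrt n)⁻¹ • t) Filter.atTop (nhds 0) := by
      have : Filter.Tendsto (fun n : ℕ => (Real.sqrt n)⁻¹) Filter.atTop (nhds 0) :=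
        (Real.tendsto_sqrt_atTop.comp tendsto_natCast_atTop_atTop).inv_tendsto_atTop
      simpa using this.smul_const t
    have nb : Sq ∈ nhds (0 : ℝ × ℝ) := by
      rw [show (0 : ℝ × ℝ) = (0, 0) from rfl]
      exact prod_mem_nhds (Ioc_mem_nhds (by linarith) hpi) (Ioc_mem_nhds (by linarith) hpi)
    filter_upwards [z nb] with n hn
    simp only [hHn]
    have hn' : (Real.sqrt n)⁻¹ • t ∈ Sq := hn
    rw [Set.indicator_of_mem hn']
  have gle : ∀ t, g t ≤ gb b t := by
    intro t
    have h1 : ‖((g t : ℝ) : ℂ)‖ ≤ gb b t := by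
      refine le_of_tendsto (lim t).norm ?_
      filter_upwards [Filter.eventually_ge_atTop 1] with n hn
      exact bound n hn t
    rw [Complex.norm_real] at h1
    exact (le_abs_self _).trans h1
  have gcont : Continuous g := by simp only [hg]; fun_prop
  have gint : Integrable g := by
    refine (gb_int hb).mono' gcont.aestronglyMeasurable (Filter.Eventually.of_forall fun t => ?_)
    rw [Real.norm_eq_abs, abs_of_pos (Real.exp_pos _)]; exact gle t
  have gpos : 0 < ∫ t, g t := by
    rw [integral_pos_iff_support_of_nonneg (fun t => (Real.exp_pos _).le) gint]
    have : Function.support g = Set.univ := by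
      ext t; simp [hg, Real.exp_ne_zero]
    rw [this]
    exact Measure.measure_univ_pos.2 (NeZero.ne _)
  have dct : Filter.Tendsto (fun n => ∫ t, Hn (n + 1) t) Filter.atTop (nhds (∫ t, ((g t : ℝ) : ℂ))) := by
    refine tendsto_integral_of_dominated_convergence (gb b) (fun n => (meas _).aestronglyMeasurable) (gb_int hb)
      (fun n => Filter.Eventually.of_forall fun t => bound (n + 1) (by omega) t)
      (Filter.Eventually.of_forall fun t => (Filter.tendsto_add_atTop_iff_nat (f := fun n => Hn n t) 1).2 (lim t))
  rw [Filter.tendsto_add_atTop_iff_nat (f := fun n => ∫ t, Hn n t) 1, integral_complex_ofReal] at dct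
  set I0 := ∫ t, g t with hI0
  have dre := (Complex.continuous_re.tendsto _).comp dct
  simp only [Complex.ofReal_re] at dre
  have ev := dre.eventually (lt_mem_nhds (show I0 * (3 / 4) < I0 by linarith))
  obtain ⟨n1, hn1⟩ := Filter.eventually_atTop.1 ev
  have i1 := gb_int1 hb
  set M1 := ∫ t, gb b t * (|t.1| + |t.2|) with hM1
  have M10 : 0 ≤ M1 := integral_nonneg fun t => by unfold gb; positivity
  refine ⟨I0 / 2 / (4 * Real.pi ^ 2), I0 / 4 / (M1 + 1), max n1 1, by positivity, by positivity, le_max_right _ _, ?_⟩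
  intro n hn x y hx hy
  have hn1' : 1 ≤ n := (le_max_right _ _).trans hn
  have hn' : (1 : ℝ) ≤ n := by exact_mod_cast hn1'
  set s := Real.sqrt n with hs
  have s0 : 0 < s := Real.sqrt_pos.2 (by linarith)
  have s2 : s ^ 2 = n := Real.sq_sqrt (by linarith)
  set v := x - y with hv
  set δ := I0 / 4 / (M1 + 1) with hδ
  have sc : ((n * (4 * Real.pi ^ 2 * fr μ n x y) : ℝ) : ℂ) = ∫ t, Hn n t * ee v (s⁻¹ • t) := by
    have h1 := Measure.integral_comp_smul (volume : Measure (ℝ × ℝ))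
      (Sq.indicator (fun θ => ch μ θ ^ n * ee v θ)) s⁻¹
    rw [integral_indicator Sq_meas, ← h.inversion n x y] at h1
    have fr2 : Module.finrank ℝ (ℝ × ℝ) = 2 := by simp
    rw [fr2, inv_pow, inv_inv, s2, abs_of_nonneg (by linarith)] at h1
    have e : ∀ t, Sq.indicator (fun θ => ch μ θ ^ n * ee v θ) (s⁻¹ • t) = Hn n t * ee v (s⁻¹ • t) := by
      intro t
      simp only [hHn]
      by_cases ht : s⁻¹ • t ∈ Sq
      · rw [Set.indicator_of_mem ht, Set.indicator_of_mem ht]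
      · rw [Set.indicator_of_notMem ht, Set.indicator_of_notMem ht, zero_mul]
    simp only [e] at h1
    rw [h1, Complex.real_smul]
    push_cast; ring
  have Hint : Integrable (Hn n) := (gb_int hb).mono' (meas n).aestronglyMeasurable
    (Filter.Eventually.of_forall fun t => bound n hn1' t)
  have eem : Continuous (fun t : ℝ × ℝ => ee v (s⁻¹ • t)) := (ee_cont v).comp (continuous_const_smul _)
  have Hint2 : Integrable (fun t => Hn n t * ee v (s⁻¹ • t)) := (gb_int hb).mono'
    ((meas n).aestronglyMeasurable.mul eem.aestronglyMeasurable)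
    (Filter.Eventually.of_forall fun t => by rw [norm_mul, ee_norm, mul_one]; exact bound n hn1' t)
  have diff : ‖(∫ t, Hn n t * ee v (s⁻¹ • t)) - ∫ t, Hn n t‖ ≤ δ * M1 := by
    rw [← integral_sub Hint2 Hint, hM1, ← integral_const_mul]
    refine norm_integral_le_of_norm_le (i1.const_mul δ) (Filter.Eventually.of_forall fun t => ?_)
    have e : Hn n t * ee v (s⁻¹ • t) - Hn n t = Hn n t * (ee v (s⁻¹ • t) - 1) := by ring
    rw [e, norm_mul]
    have l1 : ‖ee v (s⁻¹ • t) - 1‖ ≤ δ * (|t.1| + |t.2|) := by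
      unfold ee
      rw [mul_comm _ Complex.I]
      refine Real.norm_exp_I_mul_ofReal_sub_one_le.trans ?_
      simp only [Prod.smul_fst, Prod.smul_snd, smul_eq_mul, Real.norm_eq_abs]
      refine (abs_add_le _ _).trans ?_
      rw [abs_mul, abs_mul, abs_mul, abs_mul, abs_of_pos (inv_pos.2 s0)]
      have j1 : |(v.1 : ℝ)| * s⁻¹ ≤ δ := by rw [← div_eq_mul_inv, div_le_iff₀ s0]; exact hx
      have j2 : |(v.2 : ℝ)| * s⁻¹ ≤ δ := by rw [← div_eq_mul_inv, div_le_iff₀ s0]; exact hy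
      have := mul_le_mul_of_nonneg_right j1 (abs_nonneg t.1)
      have := mul_le_mul_of_nonneg_right j2 (abs_nonneg t.2)
      nlinarith
    calc ‖Hn n t‖ * ‖ee v (s⁻¹ • t) - 1‖ ≤ gb b t * (δ * (|t.1| + |t.2|)) :=
          mul_le_mul (bound n hn1' t) l1 (norm_nonneg _) (by unfold gb; positivity)
      _ = _ := by ring
  have dM : δ * M1 ≤ I0 / 4 := by
    rw [hδ, div_mul_eq_mul_div, div_le_iff₀ (by positivity)]
    nlinarith
  have a1 := hn1 n ((le_max_left _ _).trans hn)
  have a2 := (Complex.abs_re_le_norm _).trans diff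
  rw [← sc, Complex.sub_re, Complex.ofReal_re] at a2
  have a3 := (abs_le.1 a2).1
  simp only [Function.comp] at a1
  have a4 : I0 / 2 ≤ n * (4 * Real.pi ^ 2 * fr μ n x y) := by linarith
  rw [div_div, div_le_iff₀ (by positivity)]
  linarith
end
end SB

namespace SB
open ENNReal (ofReal)

/-- squared euclidean length -/
def N2 (v : ℤ × ℤ) : ℝ := (v.1 : ℝ) ^ 2 + (v.2 : ℝ) ^ 2

theorem N2_nonneg (v : ℤ × ℤ) : 0 ≤ N2 v := by unfold N2; positivity

theorem N2_neg (v w : ℤ × ℤ) : N2 (v - w) = N2 (w - v) := by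
  unfold N2; simp only [Prod.fst_sub, Prod.snd_sub]; push_cast; ring

theorem N2_tri (x y z : ℤ × ℤ) : N2 (y - x) ≤ 2 * N2 (z - x) + 2 * N2 (y - z) := by
  unfold N2; simp only [Prod.fst_sub, Prod.snd_sub]; push_cast
  nlinarith [sq_nonneg ((z.1 : ℝ) - x.1 - (y.1 - z.1)), sq_nonneg ((z.2 : ℝ) - x.2 - (y.2 - z.2))]

section
variable {μ : ℤ × ℤ → ℝ} {s11 s12 s22 : ℝ}

theorem Law.s_nonneg (h : Law μ s11 s12 s22) : 0 ≤ s11 + s22 :=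
  add_nonneg (h.var1.nonneg fun d => mul_nonneg (h.nonneg d) (by positivity))
    (h.var2.nonneg fun d => mul_nonneg (h.nonneg d) (by positivity))

theorem Law.sq_step (h : Law μ s11 s12 s22) (w x : ℤ × ℤ) :
    ∑' z, kf μ x z * ofReal (N2 (z - w)) = ofReal (N2 (x - w)) + ofReal (s11 + s22) := by
  have h1 := (((h.mass.mul_right (N2 (x - w))).add (h.mean1.mul_right (2 * ((x - w).1 : ℝ)))).add
    (h.mean2.mul_right (2 * ((x - w).2 : ℝ)))).add (h.var1.add h.var2)
  have h2 : HasSum (fun d => μ d * N2 (x + d - w)) (N2 (x - w) + (s11 + s22)) := by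
    refine hs_congr h1 (fun d => ?_) (by ring)
    unfold N2; simp only [Prod.fst_sub, Prod.snd_sub, Prod.fst_add, Prod.snd_add]; push_cast; ring
  rw [tsum_shift x, ← ENNReal.ofReal_add (N2_nonneg _) h.s_nonneg, ← h2.tsum_eq,
    ENNReal.ofReal_tsum_of_nonneg (fun d => mul_nonneg (h.nonneg d) (N2_nonneg _)) h2.summable]
  refine tsum_congr fun d => ?_
  rw [ENNReal.ofReal_mul (h.nonneg d)]
  simp [kf]

theorem Law.sq_n (h : Law μ s11 s12 s22) (w : ℤ × ℤ) (n : ℕ) (x : ℤ × ℤ) :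
    ex (kf μ) n (fun z => ofReal (N2 (z - w))) x = ofReal (N2 (x - w)) + n * ofReal (s11 + s22) := by
  induction n generalizing x with
  | zero => simp [ex_zero]
  | succ n ih =>
    rw [ex_succ]
    simp only [ih, mul_add]
    rw [ENNReal.tsum_add, h.sq_step, ENNReal.tsum_mul_right, kf_sum h]
    push_cast; ring

theorem Law.sq_l (h : Law μ s11 s12 s22) (n : ℕ) (x : ℤ × ℤ) :
    ∑' z, pw (kf μ) n x z * ofReal (N2 (z - x)) = ofReal (n * (s11 + s22)) := by
  have := h.sq_n x n x
  unfold ex at this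
  rw [this, ENNReal.ofReal_mul (by positivity)]
  simp [N2]

theorem Law.sq_r (h : Law μ s11 s12 s22) (n : ℕ) (y : ℤ × ℤ) :
    ∑' z, pw (kf μ) n z y * ofReal (N2 (y - z)) = ofReal (n * (s11 + s22)) := by
  have := h.neg.sq_l n y
  rw [← this]
  refine tsum_congr fun z => ?_
  rw [kf_tr, pw_tr, N2_neg]

theorem Law.pw_upper (h : Law μ s11 s12 s22) {m : ℝ} (ha : Atoms μ m) :
    ∃ C : ℝ, 0 < C ∧ ∀ n x y, pw (kf μ) n x y ≤ ofReal (C / (n + 1)) := by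
  obtain ⟨C, hC, H⟩ := h.fr_upper ha
  refine ⟨2 * C + 1, by positivity, fun n x y => ?_⟩
  have ht : pw (kf μ) n x y ≠ ⊤ := ((h.pw_le_one n x y).trans_lt ENNReal.one_lt_top).ne
  rw [ENNReal.le_ofReal_iff_toReal_le ht (by positivity)]
  change fr μ n x y ≤ _
  rcases Nat.eq_zero_or_pos n with rfl | hn
  · refine (h.fr_le_one _ _ _).trans ?_
    norm_num; linarith
  · refine (H n hn x y).trans ?_
    have hn' : (1 : ℝ) ≤ n := by exact_mod_cast hn
    rw [div_le_div_iff₀ (by positivity) (by positivity)]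
    nlinarith

theorem Law.pw_dist (h : Law μ s11 s12 s22) {m : ℝ} (ha : Atoms μ m) :
    ∃ C : ℝ, 0 < C ∧ ∀ n x y, ofReal (N2 (y - x)) * pw (kf μ) n x y ≤ ofReal C := by
  obtain ⟨C, hC, H⟩ := h.pw_upper ha
  have s0 := h.s_nonneg
  refine ⟨4 * C * (s11 + s22) + 1, by positivity, fun n x y => ?_⟩
  obtain ⟨a, b, rfl, hab, hba⟩ : ∃ a b : ℕ, n = a + b ∧ a ≤ b ∧ b ≤ a + 1 := ⟨n / 2, n - n / 2, by omega, by omega, by omega⟩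
  rw [pw_add, ← ENNReal.tsum_mul_left]
  have h1 : ∀ z, ofReal (N2 (y - x)) * (pw (kf μ) a x z * pw (kf μ) b z y) ≤
      ofReal (2 * (C / (b + 1))) * (pw (kf μ) a x z * ofReal (N2 (z - x)))
      + ofReal (2 * (C / (a + 1))) * (pw (kf μ) b z y * ofReal (N2 (y - z))) := by
    intro z
    have e1 := H b z y
    have e2 := H a x z
    have e3 : ofReal (N2 (y - x)) ≤ ofReal 2 * ofReal (N2 (z - x)) + ofReal 2 * ofReal (N2 (y - z)) := by
      rw [← ENNReal.ofReal_mul (by norm_num), ← ENNReal.ofReal_mul (by norm_num),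
        ← ENNReal.ofReal_add (by have := N2_nonneg (z - x); positivity) (by have := N2_nonneg (y - z); positivity)]
      exact ENNReal.ofReal_le_ofReal (N2_tri x y z)
    rw [ENNReal.ofReal_mul (by norm_num), ENNReal.ofReal_mul (by norm_num)]
    calc _ ≤ (ofReal 2 * ofReal (N2 (z - x)) + ofReal 2 * ofReal (N2 (y - z))) * (pw (kf μ) a x z * pw (kf μ) b z y) := by gcongr
      _ = ofReal 2 * pw (kf μ) b z y * (pw (kf μ) a x z * ofReal (N2 (z - x)))
          + ofReal 2 * pw (kf μ) a x z * (pw (kf μ) b z y * ofReal (N2 (y - z))) := by ring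
      _ ≤ _ := by gcongr
  refine (ENNReal.tsum_le_tsum h1).trans ?_
  rw [ENNReal.tsum_add, ENNReal.tsum_mul_left, ENNReal.tsum_mul_left, h.sq_l, h.sq_r,
    ← ENNReal.ofReal_mul (by positivity), ← ENNReal.ofReal_mul (by positivity),
    ← ENNReal.ofReal_add (by positivity) (by positivity)]
  refine ENNReal.ofReal_le_ofReal ?_
  have ha' : (a : ℝ) ≤ b := by exact_mod_cast hab
  have hb' : (b : ℝ) ≤ a + 1 := by exact_mod_cast hba
  have t1 : (a : ℝ) / (b + 1) ≤ 1 := by rw [div_le_one (by positivity)]; linarith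
  have t2 : (b : ℝ) / (a + 1) ≤ 1 := by rw [div_le_one (by positivity)]; linarith
  have e : 2 * (C / (b + 1)) * (a * (s11 + s22)) + 2 * (C / (a + 1)) * (b * (s11 + s22))
    = 2 * C * (s11 + s22) * ((a : ℝ) / (b + 1)) + 2 * C * (s11 + s22) * ((b : ℝ) / (a + 1)) := by ring
  rw [e]
  have : 0 ≤ 2 * C * (s11 + s22) := by positivity
  nlinarith

theorem Law.compare (h : Law μ s11 s12 s22) {w : ℤ × ℤ} {B : ENNReal} (hB : ∀ j, ∀ y, y ∉ Q → pw (kf μ) j y w ≤ B)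
    (n : ℕ) : ∀ z ∈ Q, pw (kf μ) n z w ≤ pw (kq μ) n z w + B := by
  induction n with
  | zero => intro z hz; exact le_self_add
  | succ n ih =>
    intro z hz
    have : ∀ y, kf μ z y * pw (kf μ) n y w ≤ kq μ z y * pw (kq μ) n y w + kf μ z y * B := by
      intro y
      by_cases hy : y ∈ Q
      · have e : kq μ z y = kf μ z y := by simp [kq, kf, hz, hy]
        rw [e, ← mul_add]
        gcongr; exact ih y hy
      · refine le_trans ?_ le_add_self
        gcongr; exact hB n y hy
    refine (ENNReal.tsum_le_tsum this).trans ?_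
    rw [ENNReal.tsum_add, ENNReal.tsum_mul_right, kf_sum h, one_mul]
    rfl

theorem Law.q_local (h : Law μ s11 s12 s22) {m : ℝ} (ha : Atoms μ m) :
    ∃ (c δ k : ℝ) (b0 : ℕ), 0 < c ∧ 0 < δ ∧ 0 < k ∧ 1 ≤ b0 ∧ ∀ b : ℕ, b0 ≤ b → ∀ z ∈ Q, ∀ w : ℤ × ℤ,
      k * b ≤ w.1 → k * b ≤ w.2 → |((z - w).1 : ℝ)| ≤ δ * b → |((z - w).2 : ℝ)| ≤ δ * b →
      ofReal (c / b ^ 2) ≤ pw (kq μ) (b ^ 2) z w := by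
  obtain ⟨c, δ, n0, hc, hδ, hn0, H⟩ := h.fr_lower ha
  obtain ⟨C, hC, HC⟩ := h.pw_dist ha
  refine ⟨c / 2, δ, 2 * C / c + 1, n0, by positivity, hδ, by positivity, hn0, fun b hb z hz w h1 h2 h3 h4 => ?_⟩
  set k := 2 * C / c + 1 with hk
  have k0 : 1 ≤ k := by rw [hk]; have : 0 ≤ 2 * C / c := by positivity
                        linarith
  have b1 : 1 ≤ b := hn0.trans hb
  have b1' : (1 : ℝ) ≤ b := by exact_mod_cast b1
  have sq : Real.sqrt ((b ^ 2 : ℕ) : ℝ) = b := by push_cast; exact Real.sqrt_sq (by linarith)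
  have l1 := H (b ^ 2) (hb.trans (by nlinarith)) z w (by rw [sq]; exact h3) (by rw [sq]; exact h4)
  have ht : pw (kf μ) (b ^ 2) z w ≠ ⊤ := ((h.pw_le_one _ z w).trans_lt ENNReal.one_lt_top).ne
  have l2 : ofReal (c / b ^ 2) ≤ pw (kf μ) (b ^ 2) z w := by
    rw [ENNReal.ofReal_le_iff_le_toReal ht]
    push_cast at l1; exact l1
  have hB : ∀ j, ∀ y, y ∉ Q → pw (kf μ) j y w ≤ ofReal (c / 2 / b ^ 2) := by
    intro j y hy
    have d := HC j y w
    have n2 : (k * b) ^ 2 ≤ N2 (w - y) := by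
      unfold N2
      simp only [Prod.fst_sub, Prod.snd_sub]; push_cast
      have kb : 0 ≤ k * b := by positivity
      simp only [Q, Set.mem_setOf_eq, not_and_or, not_le] at hy
      rcases hy with hy | hy
      · have : (y.1 : ℝ) < 0 := by exact_mod_cast hy
        nlinarith [sq_nonneg ((w.2 : ℝ) - y.2)]
      · have : (y.2 : ℝ) < 0 := by exact_mod_cast hy
        nlinarith [sq_nonneg ((w.1 : ℝ) - y.1)]
    have hj : pw (kf μ) j y w ≠ ⊤ := ((h.pw_le_one _ y w).trans_lt ENNReal.one_lt_top).ne
    have kb : 0 < (k * b) ^ 2 := by positivity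
    rw [ENNReal.le_ofReal_iff_toReal_le hj (by positivity)]
    have d2 : ofReal ((k * b) ^ 2) * pw (kf μ) j y w ≤ ofReal C := le_trans (by gcongr) d
    rw [← ENNReal.ofReal_toReal hj, ← ENNReal.ofReal_mul kb.le, ENNReal.ofReal_le_ofReal_iff hC.le] at d2
    set t := (pw (kf μ) j y w).toReal with htt
    have t0 : 0 ≤ t := ENNReal.toReal_nonneg
    rw [le_div_iff₀ (by positivity)]
    have e1 : 2 * C ≤ c * k ^ 2 := by
      have : c * k = 2 * C + c := by rw [hk]; field_simp
      nlinarith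
    have e2 : (k ^ 2 * 2) * (t * b ^ 2) ≤ (k ^ 2 * 2) * (c / 2) := by nlinarith
    exact le_of_mul_le_mul_left e2 (by positivity)
  have l3 := h.compare hB (b ^ 2) z hz
  have l4 := l2.trans l3
  have e : ofReal (c / b ^ 2) = ofReal (c / 2 / b ^ 2) + ofReal (c / 2 / b ^ 2) := by
    rw [← ENNReal.ofReal_add (by positivity) (by positivity)]; congr 1; ring
  rw [e] at l4
  exact (ENNReal.add_le_add_iff_right ENNReal.ofReal_ne_top).1 l4

end
end SB

namespace SB
open ENNReal (ofReal)

theorem mid1 (z w l X : ℤ) (hl : 0 ≤ l) (hX : l ≤ X) (h1 : z - w ≤ X + l) (h2 : w - z ≤ X + l) :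
    ∃ m : ℤ, (z ≤ m ∨ w ≤ m) ∧ ∀ t, m ≤ t → t ≤ m + l →
      (z - t ≤ 2 * l ∧ t - z ≤ 2 * l) ∧ (t - w ≤ X ∧ w - t ≤ X) := by
  rcases le_total z w with h | h
  · rcases le_total (w - z) l with h' | h'
    · exact ⟨z, Or.inl le_rfl, fun t a b => by omega⟩
    · exact ⟨z + l, Or.inl (by omega), fun t a b => by omega⟩
  · rcases le_total (z - w) (2 * l) with h' | h'
    · exact ⟨w, Or.inr le_rfl, fun t a b => by omega⟩
    · exact ⟨z - 2 * l, Or.inr (by omega), fun t a b => by omega⟩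

section
variable {μ : ℤ × ℤ → ℝ} {s11 s12 s22 : ℝ}

theorem Law.q_chain (h : Law μ s11 s12 s22) {m : ℝ} (ha : Atoms μ m) :
    ∃ (δ k : ℝ) (b0 : ℕ), 0 < δ ∧ 0 < k ∧ 1 ≤ b0 ∧ ∀ N : ℕ, ∃ c : ℝ, 0 < c ∧ ∀ b : ℕ, b0 ≤ b → ∀ z w : ℤ × ℤ,
      k * b ≤ z.1 → k * b ≤ z.2 → k * b ≤ w.1 → k * b ≤ w.2 →
      |((z - w).1 : ℝ)| ≤ (N + 1) * (δ * b) → |((z - w).2 : ℝ)| ≤ (N + 1) * (δ * b) →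
      ofReal (c / b ^ 2) ≤ pw (kq μ) ((N + 1) * b ^ 2) z w := by
  obtain ⟨c, δ, k, b0, hc, hδ, hk, hb0, H⟩ := h.q_local ha
  have inQ : ∀ (b : ℕ) (z : ℤ × ℤ), k * b ≤ z.1 → k * b ≤ z.2 → z ∈ Q := by
    intro b z h1 h2
    have : 0 ≤ k * b := by positivity
    constructor
    · exact_mod_cast this.trans h1
    · exact_mod_cast this.trans h2
  have key : ∀ N : ℕ, ∃ c : ℝ, 0 < c ∧ ∀ b : ℕ, b0 ≤ b → ∀ l : ℕ, 2 * (l : ℝ) ≤ δ * b → δ * b ≤ 6 * l → ∀ z w : ℤ × ℤ,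
      k * b ≤ z.1 → k * b ≤ z.2 → k * b ≤ w.1 → k * b ≤ w.2 →
      |(z - w).1| ≤ (N + 1) * l → |(z - w).2| ≤ (N + 1) * l →
      ofReal (c / b ^ 2) ≤ pw (kq μ) ((N + 1) * b ^ 2) z w := by
    intro N
    induction N with
    | zero =>
      refine ⟨c, hc, fun b hb l hl hl' z w z1 z2 w1 w2 e1 e2 => ?_⟩
      have e1' : |((z - w).1 : ℝ)| ≤ (0 + 1) * l := by exact_mod_cast e1
      have e2' : |((z - w).2 : ℝ)| ≤ (0 + 1) * l := by exact_mod_cast e2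
      have l0 : (0 : ℝ) ≤ l := by positivity
      have := H b hb z (inQ b z z1 z2) w w1 w2 (by linarith) (by linarith)
      simpa using this
    | succ N ih =>
      obtain ⟨cN, hcN, ih⟩ := ih
      refine ⟨c * cN * δ ^ 2 / 36, by positivity, fun b hb l hl hl' z w z1 z2 w1 w2 e1 e2 => ?_⟩
      have b1 : 1 ≤ b := hb0.trans hb
      have b1' : (1 : ℝ) ≤ b := by exact_mod_cast b1
      have lX : (l : ℤ) ≤ (N + 1) * l := by nlinarith [Int.natCast_nonneg l, Int.natCast_nonneg N]
      push_cast at e1 e2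
      rw [abs_le] at e1 e2
      simp only [Prod.fst_sub, Prod.snd_sub] at e1 e2
      obtain ⟨m1, hm1, M1⟩ := mid1 z.1 w.1 l ((N + 1) * l) (by positivity) lX (by linarith [e1.2]) (by linarith [e1.1])
      obtain ⟨m2, hm2, M2⟩ := mid1 z.2 w.2 l ((N + 1) * l) (by positivity) lX (by linarith [e2.2]) (by linarith [e2.1])
      have km1 : k * b ≤ m1 := by
        rcases hm1 with hm | hm
        · exact z1.trans (by exact_mod_cast hm)
        · exact w1.trans (by exact_mod_cast hm)
      have km2 : k * b ≤ m2 := by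
        rcases hm2 with hm | hm
        · exact z2.trans (by exact_mod_cast hm)
        · exact w2.trans (by exact_mod_cast hm)
      set F : Finset (ℤ × ℤ) := Finset.Ico m1 (m1 + l) ×ˢ Finset.Ico m2 (m2 + l) with hF
      have card : F.card = l ^ 2 := by simp [hF, sq]
      rw [show (N + 1 + 1) * b ^ 2 = b ^ 2 + (N + 1) * b ^ 2 by ring, pw_add]
      refine le_trans ?_ (ENNReal.sum_le_tsum F)
      have each : ∀ t ∈ F, ofReal (c * cN / b ^ 4) ≤ pw (kq μ) (b ^ 2) z t * pw (kq μ) ((N + 1) * b ^ 2) t w := by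
        intro t ht
        simp only [hF, Finset.mem_product, Finset.mem_Ico] at ht
        obtain ⟨⟨t1, t2⟩, t3, t4⟩ := ht
        have A1 := M1 t.1 t1 t2.le
        have A2 := M2 t.2 t3 t4.le
        have kt1 : k * b ≤ t.1 := km1.trans (by exact_mod_cast t1)
        have kt2 : k * b ≤ t.2 := km2.trans (by exact_mod_cast t3)
        have g1 : |((z - t).1 : ℝ)| ≤ 2 * l := by
          rw [← Int.cast_abs]
          have : |(z - t).1| ≤ 2 * l := by
            rw [abs_le]; simp only [Prod.fst_sub]; exact ⟨by linarith [A1.1.2], A1.1.1⟩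
          exact_mod_cast this
        have g2 : |((z - t).2 : ℝ)| ≤ 2 * l := by
          rw [← Int.cast_abs]
          have : |(z - t).2| ≤ 2 * l := by
            rw [abs_le]; simp only [Prod.snd_sub]; exact ⟨by linarith [A2.1.2], A2.1.1⟩
          exact_mod_cast this
        have p1 := H b hb z (inQ b z z1 z2) t kt1 kt2 (g1.trans hl) (g2.trans hl)
        have p2 := ih b hb l hl hl' t w kt1 kt2 w1 w2
          (by rw [abs_le]; simp only [Prod.fst_sub]; exact ⟨by linarith [A1.2.2], A1.2.1⟩)
          (by rw [abs_le]; simp only [Prod.snd_sub]; exact ⟨by linarith [A2.2.2], A2.2.1⟩)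
        refine le_trans (le_of_eq ?_) (mul_le_mul' p1 p2)
        rw [← ENNReal.ofReal_mul (by positivity)]
        congr 1; field_simp
      refine le_trans ?_ (Finset.sum_le_sum each)
      rw [Finset.sum_const, card, nsmul_eq_mul, ← ENNReal.ofReal_natCast, ← ENNReal.ofReal_mul (by positivity)]
      refine ENNReal.ofReal_le_ofReal ?_
      push_cast
      have db : (δ * b) ^ 2 ≤ (6 * l) ^ 2 := pow_le_pow_left₀ (by positivity) hl' 2
      rw [div_div, mul_div_assoc', div_le_div_iff₀ (by positivity) (by positivity)]
      have : 0 ≤ c * cN * b ^ 2 := by positivity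
      have := mul_le_mul_of_nonneg_left db this
      nlinarith
  obtain ⟨b1, hb1⟩ := exists_nat_ge (6 / δ)
  refine ⟨δ / 6, k, max b0 b1, by positivity, hk, hb0.trans (le_max_left _ _), fun N => ?_⟩
  obtain ⟨cN, hcN, HN⟩ := key N
  refine ⟨cN, hcN, fun b hb z w z1 z2 w1 w2 e1 e2 => ?_⟩
  have hbb : b0 ≤ b := (le_max_left _ _).trans hb
  have hb1' : (b1 : ℝ) ≤ b := by exact_mod_cast (le_max_right _ _).trans hb
  have big : 6 ≤ δ * b := by
    have := hb1.trans hb1'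
    rw [div_le_iff₀ hδ] at this; linarith
  set l := ⌊δ * b / 2⌋₊ with hl
  have l1 : (l : ℝ) ≤ δ * b / 2 := Nat.floor_le (by positivity)
  have l2 : δ * b / 2 < l + 1 := Nat.lt_floor_add_one _
  have l3 : δ * b / 6 ≤ l := by linarith
  refine HN b hbb l (by linarith) (by linarith) z w z1 z2 w1 w2 ?_ ?_
  · have : |((z - w).1 : ℝ)| ≤ (N + 1) * l := e1.trans (by gcongr; linarith)
    exact_mod_cast this
  · have : |((z - w).2 : ℝ)| ≤ (N + 1) * l := e2.trans (by gcongr; linarith)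
    exact_mod_cast this

end
end SB

namespace SB
open ENNReal (ofReal)

section
variable {μ : ℤ × ℤ → ℝ} {s11 s12 s22 : ℝ}

theorem pw_dual (n : ℕ) (x y : ℤ × ℤ) : pw (kq fun d => μ (-d)) n x y = pw (kq μ) n y x := by
  rw [kq_tr]; exact pw_tr _ _ _ _

theorem box_facts {ε A ε' A' s r : ℝ} (hε : ε ≤ ε') (hε0 : 0 < ε) (hA : A' ≤ A) (hA0 : 1 ≤ A') (h1 : s / 3 ≤ r) (h2 : r ≤ s)
    (hs : 6 ≤ ε * s) (s0 : 0 < s) {y : ℤ × ℤ} (hy : y ∈ box ε' A' r) :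
    (0 ≤ (y.1 : ℝ) ∧ 0 ≤ (y.2 : ℝ)) ∧ (ε * s / 6 ≤ y.1 ∧ ε * s / 6 ≤ y.2) ∧ ((y.1 : ℝ) ≤ A * s ∧ (y.2 : ℝ) ≤ A * s) := by
  obtain ⟨⟨q1, q2⟩, b1, b2, b3⟩ := hy
  have q1' : (0 : ℝ) ≤ y.1 := by exact_mod_cast q1
  have q2' : (0 : ℝ) ≤ y.2 := by exact_mod_cast q2
  have r0 : 0 < r := by linarith
  have e1 : ε * s / 3 ≤ ε' * r := by
    calc ε * s / 3 = ε * (s / 3) := by ring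
      _ ≤ ε' * r := mul_le_mul hε h1 (by positivity) (by linarith)
  have e2 : A' * r ≤ A * s := mul_le_mul hA h2 r0.le (by linarith)
  unfold Sx at b3
  exact ⟨⟨q1', q2'⟩, ⟨by linarith, by linarith⟩, by linarith, by linarith⟩

set_option maxHeartbeats 1000000 in
theorem Law.core (h : Law μ s11 s12 s22) {m : ℝ} (ha : Atoms μ m) {p C C' : ℝ} {U V F Lo U' V' F' Lo' : ℤ × ℤ → ℝ} {L L' : ℕ}
    (B : Bar (kq μ) p C U V F Lo L) (B' : Bar (kq fun d => μ (-d)) p C' U' V' F' Lo' L') :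
    ∃ (c : ℝ) (N0 : ℕ), 0 < c ∧ 1 ≤ N0 ∧ ∀ N : ℕ, N0 ≤ N →
      ofReal (c * (N : ℝ) ^ (-p - 1)) ≤ pw (kq μ) N (L, L) (L', L') := by
  obtain ⟨ε1, A1, c1, hε1, hA1, hc1, H1⟩ := B.bulk
  obtain ⟨ε2, A2, c2, hε2, hA2, hc2, H2⟩ := B'.bulk
  obtain ⟨δ, k, b0, hδ, hk, hb0, H⟩ := h.q_chain ha
  have hp := B.hp
  set ε := min ε1 ε2 with hε
  set A := max A1 A2 with hA
  have ε0 : 0 < ε := lt_min hε1 hε2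
  have A0 : 1 ≤ A := hA1.trans (le_max_left _ _)
  set η := min (1 / 2) (min (δ / (8 * A)) (ε / (6 * k))) with hη
  have η0 : 0 < η := lt_min (by norm_num) (lt_min (by positivity) (by positivity))
  have η1 : η ≤ 1 / 2 := min_le_left _ _
  have η2 : η ≤ δ / (8 * A) := (min_le_right _ _).trans (min_le_left _ _)
  have η3 : η ≤ ε / (6 * k) := (min_le_right _ _).trans (min_le_right _ _)
  rw [le_div_iff₀ (by positivity)] at η2 η3
  set N' := ⌊2 * A / (δ * η)⌋₊ with hN'
  have n1 : (N' : ℝ) ≤ 2 * A / (δ * η) := Nat.floor_le (by positivity)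
  have n2 : 2 * A / (δ * η) < N' + 1 := Nat.lt_floor_add_one _
  have n3 : ((N' : ℝ) + 1) * η ^ 2 ≤ 1 / 2 := by
    have : (N' : ℝ) * η ^ 2 ≤ 1 / 4 := by
      rw [le_div_iff₀ (by positivity)] at n1
      have : δ * (N' * η ^ 2) ≤ δ * (1 / 4) := by nlinarith
      exact le_of_mul_le_mul_left this hδ
    nlinarith
  rw [div_lt_iff₀ (by positivity)] at n2
  obtain ⟨cN, hcN, HN⟩ := H N'
  set T := ((b0 : ℝ) + 2) / η + 6 / ε + 2 with hT
  obtain ⟨N0, hN0⟩ := exists_nat_ge (T ^ 2)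
  refine ⟨cN * (c1 * c2), max N0 1, by positivity, le_max_right _ _, fun N hN => ?_⟩
  have hN1 : (N0 : ℝ) ≤ N := by exact_mod_cast (le_max_left _ _).trans hN
  have T2 : T ^ 2 ≤ N := hN0.trans hN1
  set s := Real.sqrt N with hs
  have T0 : 0 < T := by positivity
  have sT : T ≤ s := Real.le_sqrt_of_sq_le T2
  have s0 : 0 < s := by linarith
  have s2 : s ^ 2 = N := Real.sq_sqrt (by positivity)
  have t1 : (b0 : ℝ) + 2 ≤ η * s := by
    have : ((b0 : ℝ) + 2) / η ≤ s := by
      have : 0 < 6 / ε := by positivity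
      linarith
    rw [div_le_iff₀ η0] at this; linarith
  have t2 : 6 ≤ ε * s := by
    have : 6 / ε ≤ s := by
      have : 0 < ((b0 : ℝ) + 2) / η := by positivity
      linarith
    rw [div_le_iff₀ ε0] at this; linarith
  have t3 : 2 ≤ s := by
    have : 0 < ((b0 : ℝ) + 2) / η := by positivity
    have : 0 < 6 / ε := by positivity
    linarith
  have N4 : (4 : ℝ) ≤ N := by nlinarith
  set b := ⌊η * s⌋₊ with hb
  have b1 : (b : ℝ) ≤ η * s := Nat.floor_le (by positivity)
  have b2 : η * s < b + 1 := Nat.lt_floor_add_one _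
  have bb : b0 ≤ b := by
    have : (b0 : ℝ) ≤ b := by linarith
    exact_mod_cast this
  have b3 : η * s / 2 ≤ b := by
    have : (0 : ℝ) ≤ b0 := by positivity
    linarith
  have bp : (1 : ℝ) ≤ b := by exact_mod_cast hb0.trans bb
  have Mle : (((N' + 1) * b ^ 2 : ℕ) : ℝ) ≤ N / 2 := by
    push_cast
    have : (b : ℝ) ^ 2 ≤ (η * s) ^ 2 := pow_le_pow_left₀ (by positivity) b1 2
    rw [mul_pow, s2] at this
    have h1 : ((N' : ℝ) + 1) * b ^ 2 ≤ (N' + 1) * (η ^ 2 * N) := by gcongr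
    nlinarith
  set M := (N' + 1) * b ^ 2 with hM
  obtain ⟨m1, m2, hm, hm12, hm21⟩ : ∃ m1 m2 : ℕ, N = m1 + (M + m2) ∧ m1 ≤ m2 ∧ m2 ≤ m1 + 1 := by
    have : M ≤ N := by
      have : (M : ℝ) ≤ N := by linarith
      exact_mod_cast this
    exact ⟨(N - M) / 2, (N - M) - (N - M) / 2, by omega, by omega, by omega⟩
  have hm' : (N : ℝ) = m1 + (M + m2) := by exact_mod_cast hm
  have hm12' : (m1 : ℝ) ≤ m2 := by exact_mod_cast hm12
  have hm21' : (m2 : ℝ) ≤ m1 + 1 := by exact_mod_cast hm21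
  have M0 : (0 : ℝ) ≤ M := by positivity
  have m1l : (N : ℝ) / 9 ≤ m1 := by linarith
  have m1p : 1 ≤ m1 := by
    have : (0 : ℝ) < m1 := by linarith
    exact_mod_cast this
  have sq9 : ∀ j : ℕ, (N : ℝ) / 9 ≤ j → (j : ℝ) ≤ N → s / 3 ≤ Real.sqrt j ∧ Real.sqrt j ≤ s := by
    intro j h1 h2
    refine ⟨Real.le_sqrt_of_sq_le ?_, Real.sqrt_le_sqrt h2⟩
    rw [div_pow, s2]; linarith
  obtain ⟨u1, u2⟩ := sq9 m1 m1l (by linarith)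
  obtain ⟨u3, u4⟩ := sq9 m2 (by linarith) (by linarith)
  have kb : k * b ≤ ε * s / 6 := by
    have h1 : k * b ≤ k * (η * s) := by gcongr
    have h2 := mul_le_mul_of_nonneg_right η3 s0.le
    linarith
  have mid : ∀ y w, y ∈ box ε1 A1 (Real.sqrt m1) → w ∈ box ε2 A2 (Real.sqrt m2) →
      ofReal (cN / b ^ 2) ≤ pw (kq μ) M y w := by
    intro y w hy hw
    obtain ⟨⟨f1, f2⟩, ⟨f3, f4⟩, f5, f6⟩ := box_facts (min_le_left _ _) ε0 (le_max_left _ _) hA1 u1 u2 t2 s0 hy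
    obtain ⟨⟨g1, g2⟩, ⟨g3, g4⟩, g5, g6⟩ := box_facts (min_le_right _ _) ε0 (le_max_right _ _) hA2 u3 u4 t2 s0 hw
    have As : A * s ≤ (N' + 1) * (δ * b) := by
      have h1 : ((N' : ℝ) + 1) * (δ * (η * s / 2)) ≤ (N' + 1) * (δ * b) := by gcongr
      refine le_trans ?_ h1
      have h2 := mul_le_mul_of_nonneg_right n2.le s0.le
      linarith
    refine HN b bb y w (kb.trans f3) (kb.trans f4) (kb.trans g3) (kb.trans g4) (le_trans ?_ As) (le_trans ?_ As)
    · simp only [Prod.fst_sub]; push_cast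
      rw [abs_le]; constructor <;> linarith
    · simp only [Prod.snd_sub]; push_cast
      rw [abs_le]; constructor <;> linarith
  have G1 := H1 m1 m1p
  have G2 := H2 m2 (m1p.trans hm12)
  have low : ofReal (cN / b ^ 2) * (ofReal (c1 * (m1 : ℝ) ^ (-(p / 2))) * ofReal (c2 * (m2 : ℝ) ^ (-(p / 2))))
      ≤ pw (kq μ) N (L, L) (L', L') := by
    refine (mul_le_mul' le_rfl (mul_le_mul' G1 G2)).trans ?_
    rw [hm, pw_add]
    simp only [pw_add (kq μ) M m2]
    unfold ex
    simp only [← ENNReal.tsum_mul_right, ← ENNReal.tsum_mul_left]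
    rw [ENNReal.tsum_comm]
    refine ENNReal.tsum_le_tsum fun y => ENNReal.tsum_le_tsum fun w => ?_
    rw [pw_dual]
    by_cases hy : y ∈ box ε1 A1 (Real.sqrt m1)
    · by_cases hw : w ∈ box ε2 A2 (Real.sqrt m2)
      · rw [if_pos hy, if_pos hw]
        have := mid y w hy hw
        calc _ = pw (kq μ) m1 (L, L) y * (ofReal (cN / b ^ 2) * pw (kq μ) m2 w (L', L')) := by ring
          _ ≤ _ := by gcongr
      · rw [if_neg hw]; simp
    · rw [if_neg hy]; simp
  refine le_trans ?_ low
  rw [← ENNReal.ofReal_mul (by positivity), ← ENNReal.ofReal_mul (by positivity)]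
  refine ENNReal.ofReal_le_ofReal ?_
  have N0' : (0 : ℝ) < N := by linarith
  have v1 : (N : ℝ) ^ (-(p / 2)) ≤ (m1 : ℝ) ^ (-(p / 2)) :=
    Real.rpow_le_rpow_of_nonpos (by linarith) (by linarith) (by linarith)
  have v2 : (N : ℝ) ^ (-(p / 2)) ≤ (m2 : ℝ) ^ (-(p / 2)) :=
    Real.rpow_le_rpow_of_nonpos (by linarith) (by linarith) (by linarith)
  have v3 : (N : ℝ)⁻¹ ≤ 1 / (b : ℝ) ^ 2 := by
    rw [one_div]
    refine inv_anti₀ (by positivity) ?_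
    have : (b : ℝ) ≤ s := by
      have := mul_le_mul_of_nonneg_right η1 s0.le
      linarith
    rw [← s2]
    exact pow_le_pow_left₀ (by positivity) this 2
  have v4 : (N : ℝ) ^ (-p - 1) = (N : ℝ)⁻¹ * ((N : ℝ) ^ (-(p / 2)) * (N : ℝ) ^ (-(p / 2))) := by
    rw [← Real.rpow_neg_one, ← Real.rpow_add N0', ← Real.rpow_add N0']
    congr 1; ring
  rw [v4]
  calc cN * (c1 * c2) * ((N : ℝ)⁻¹ * ((N : ℝ) ^ (-(p / 2)) * (N : ℝ) ^ (-(p / 2))))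
      ≤ cN * (c1 * c2) * ((1 / (b : ℝ) ^ 2) * ((m1 : ℝ) ^ (-(p / 2)) * (m2 : ℝ) ^ (-(p / 2)))) := by gcongr
    _ = _ := by ring

theorem Law.upper (h : Law μ s11 s12 s22) {m : ℝ} (ha : Atoms μ m) {p C C' : ℝ} {U V F Lo U' V' F' Lo' : ℤ × ℤ → ℝ} {L L' : ℕ}
    (B : Bar (kq μ) p C U V F Lo L) (B' : Bar (kq fun d => μ (-d)) p C' U' V' F' Lo' L') :
    ∃ D : ℝ, 0 < D ∧ ∀ n : ℕ, 1 ≤ n → ∀ x ∈ Q,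
      pw (kq μ) (n - 1) x (0, 0) ≤ ofReal (D * Sx x ^ p * (n : ℝ) ^ (-p - 1)) := by
  obtain ⟨M, hM, HM⟩ := B.tail
  obtain ⟨M', hM', HM'⟩ := B'.tail
  obtain ⟨G, hG, HG⟩ := h.pw_upper ha
  have hp := B.hp
  have hC := B.hC
  have z0 : ((0, 0) : ℤ × ℤ) ∈ Q := ⟨le_rfl, le_rfl⟩
  have u0 := (B'.U_n z0).1
  set u := U' (0, 0) with hu
  set D := (M * C) * G * (M' * u) * 6 ^ (p + 1) + 6 ^ (p + 1) with hD
  refine ⟨D, by positivity, fun n hn x hx => ?_⟩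
  have s1 := Sx_ge hx
  have sp : 1 ≤ Sx x ^ p := Real.one_le_rpow (by linarith) (by linarith)
  have n1 : (1 : ℝ) ≤ n := by exact_mod_cast hn
  have n0 : (0 : ℝ) < n := by linarith
  rcases lt_or_ge n 4 with h4 | h4
  · have l1 : pw (kq μ) (n - 1) x (0, 0) ≤ 1 := (pw_le_sv _ _ _ _).trans (sv_le_one _ B.one _ _)
    refine l1.trans ?_
    rw [← ENNReal.ofReal_one]
    refine ENNReal.ofReal_le_ofReal ?_
    have l2 : (6 : ℝ) ^ (-p - 1) ≤ (n : ℝ) ^ (-p - 1) :=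
      Real.rpow_le_rpow_of_nonpos n0 (by have : (n : ℝ) < 4 := by exact_mod_cast h4
                                         linarith) (by linarith)
    have l3 : (6 : ℝ) ^ (p + 1) * 6 ^ (-p - 1) = 1 := by
      rw [← Real.rpow_add (by norm_num)]; norm_num
    have l4 : (6 : ℝ) ^ (p + 1) ≤ D := by rw [hD]; have : 0 ≤ (M * C) * G * (M' * u) * 6 ^ (p + 1) := by positivity
                                          linarith
    calc (1 : ℝ) = 6 ^ (p + 1) * 1 * 6 ^ (-p - 1) := by rw [mul_one, l3]
      _ ≤ D * Sx x ^ p * (n : ℝ) ^ (-p - 1) := by gcongr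
  · set a := (n - 1) / 3 with haa
    obtain ⟨b, hb, hab⟩ : ∃ b, n - 1 = a + (b + a) ∧ a ≤ b := ⟨n - 1 - 2 * a, by omega, by omega⟩
    have a1 : 1 ≤ a := by omega
    have an : n ≤ 6 * a := by omega
    have an' : (n : ℝ) ≤ 6 * a := by exact_mod_cast an
    have a1' : (1 : ℝ) ≤ a := by exact_mod_cast a1
    have hab' : (a : ℝ) ≤ b := by exact_mod_cast hab
    have l1 : pw (kq μ) (n - 1) x (0, 0) ≤ sv (kq μ) a x * (ofReal (G / (b + 1)) * sv (kq fun d => μ (-d)) a (0, 0)) := by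
      rw [hb, pw_add, sv_def, sv_def, ← ENNReal.tsum_mul_right]
      refine ENNReal.tsum_le_tsum fun y => ?_
      gcongr
      rw [pw_add, ← ENNReal.tsum_mul_left]
      refine ENNReal.tsum_le_tsum fun w => ?_
      rw [pw_dual]
      gcongr
      exact (pw_mono _ (kq_le μ) _ _ _).trans (HG b y w)
    refine l1.trans ?_
    refine (mul_le_mul' (HM a a1 x) (mul_le_mul' le_rfl (HM' a a1 (0, 0)))).trans ?_
    have Ux := (B.U_n hx).1
    have Uu := B.U_u x hx
    rw [← ENNReal.ofReal_mul (by positivity), ← ENNReal.ofReal_mul (by positivity), ← ENNReal.ofReal_mul (by positivity),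
      ← ENNReal.ofReal_mul (by positivity)]
    refine ENNReal.ofReal_le_ofReal ?_
    have v1 : (a : ℝ) ^ (-(p / 2)) ≤ ((n : ℝ) / 6) ^ (-(p / 2)) :=
      Real.rpow_le_rpow_of_nonpos (by linarith) (by linarith) (by linarith)
    have v2 : G / ((b : ℝ) + 1) ≤ G * ((n : ℝ) / 6)⁻¹ := by
      rw [div_eq_mul_inv]
      gcongr; linarith
    have v4 : ((n : ℝ) / 6)⁻¹ * (((n : ℝ) / 6) ^ (-(p / 2)) * ((n : ℝ) / 6) ^ (-(p / 2))) = 6 ^ (p + 1) * (n : ℝ) ^ (-p - 1) := by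
      have n6 : 0 < (n : ℝ) / 6 := by positivity
      rw [← Real.rpow_neg_one, ← Real.rpow_add n6, ← Real.rpow_add n6, Real.div_rpow n0.le (by norm_num),
        div_eq_mul_inv, ← Real.rpow_neg (by norm_num), mul_comm]
      congr 2 <;> ring
    rw [← hu]
    calc M * (a : ℝ) ^ (-(p / 2)) * U x * (G / (b + 1) * (M' * (a : ℝ) ^ (-(p / 2)) * u))
        ≤ M * ((n : ℝ) / 6) ^ (-(p / 2)) * (C * Sx x ^ p) * (G * ((n : ℝ) / 6)⁻¹ * (M' * ((n : ℝ) / 6) ^ (-(p / 2)) * u)) := by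
          gcongr
      _ = (M * C) * G * (M' * u) * Sx x ^ p * (((n : ℝ) / 6)⁻¹ * (((n : ℝ) / 6) ^ (-(p / 2)) * ((n : ℝ) / 6) ^ (-(p / 2)))) := by ring
      _ = (M * C * G * (M' * u) * 6 ^ (p + 1)) * Sx x ^ p * (n : ℝ) ^ (-p - 1) := by rw [v4]; ring
      _ ≤ D * Sx x ^ p * (n : ℝ) ^ (-p - 1) := by
          gcongr; rw [hD]
          have : (0 : ℝ) ≤ 6 ^ (p + 1) := by positivity
          linarith

end
end SB

namespace SB
open ENNReal (ofReal)

section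
variable {γ : ℝ}

theorem atoms_rev (hγ : γ^3 - γ^2 + 2*γ - 1 = 0) : ∃ m, Atoms (revWSb γ) m := by
  obtain ⟨g1, g2⟩ := gam_bounds hγ
  have hα := alpha_pos hγ
  have hθ := theta_eq hγ
  have g0 : 0 < γ := by linarith
  have t0 : 0 < sbθ γ := by rw [hθ]; linarith
  have e1 : revWSb γ (1, 0) = sbα γ * γ := by simpa using rev1 (γ := γ) 0
  have e2 : revWSb γ (2, 0) = sbα γ * γ ^ 2 := by simpa using rev1 (γ := γ) 1
  have e3 : revWSb γ (-1, 0) = sbα γ * γ⁻¹ := by simpa using rev3 (γ := γ) 0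
  have e4 : revWSb γ (-1, 1) = sbα γ * γ⁻¹ * sbθ γ := by simpa using rev3 (γ := γ) 1
  have p1 : 0 < sbα γ * γ := by positivity
  have p2 : 0 < sbα γ * γ ^ 2 := by positivity
  have p3 : 0 < sbα γ * γ⁻¹ := by positivity
  have p4 : 0 < sbα γ * γ⁻¹ * sbθ γ := by positivity
  refine ⟨min (min (sbα γ * γ) (sbα γ * γ ^ 2)) (min (sbα γ * γ⁻¹) (sbα γ * γ⁻¹ * sbθ γ)), ?_, ?_, ?_, ?_, ?_⟩
  · exact lt_min (lt_min p1 p2) (lt_min p3 p4)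
  · rw [e1]; exact (min_le_left _ _).trans (min_le_left _ _)
  · rw [e2]; exact (min_le_left _ _).trans (min_le_right _ _)
  · rw [e3]; exact (min_le_right _ _).trans (min_le_left _ _)
  · rw [e4]; exact (min_le_right _ _).trans (min_le_right _ _)

/-- reachability inside the quadrant -/
def Re (μ : ℤ × ℤ → ℝ) (x y : ℤ × ℤ) : Prop := ∃ j, pw (kq μ) j x y ≠ 0

theorem Re.refl (μ : ℤ × ℤ → ℝ) (x : ℤ × ℤ) : Re μ x x := ⟨0, by simp [pw]⟩

theorem Re.trans {μ : ℤ × ℤ → ℝ} {x y z : ℤ × ℤ} (h1 : Re μ x y) (h2 : Re μ y z) : Re μ x z := by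
  obtain ⟨i, hi⟩ := h1
  obtain ⟨j, hj⟩ := h2
  refine ⟨i + j, fun h => ?_⟩
  have := pw_mul_le (kq μ) i j x y z
  rw [h] at this
  exact mul_ne_zero hi hj (le_antisymm this zero_le)

theorem Re.step {μ : ℤ × ℤ → ℝ} {x : ℤ × ℤ} (d y : ℤ × ℤ) (hx : x ∈ Q) (hy : y ∈ Q) (hd : y - x = d) (h : 0 < μ d) :
    Re μ x y := by
  refine ⟨1, ?_⟩
  rw [pw_one, kq, if_pos ⟨hx, hy⟩, hd]
  simpa using h

theorem rev_p1 (hγ : γ^3 - γ^2 + 2*γ - 1 = 0) (i : ℕ) : 0 < revWSb γ ((i : ℤ) + 1, 0) := by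
  have := gam_bounds hγ
  have g0 : 0 < γ := by linarith
  have hα := alpha_pos hγ
  rw [rev1]; positivity

theorem rev_p2 (hγ : γ^3 - γ^2 + 2*γ - 1 = 0) : 0 < revWSb γ (0, -1) := by
  have := gam_bounds hγ
  have hα := alpha_pos hγ
  have t0 : 0 < sbθ γ := by rw [theta_eq hγ]; linarith
  rw [rev2]; positivity

theorem rev_p3 (hγ : γ^3 - γ^2 + 2*γ - 1 = 0) (i : ℕ) : 0 < revWSb γ (-1, (i : ℤ)) := by
  have := gam_bounds hγ
  have g0 : 0 < γ := by linarith
  have hα := alpha_pos hγ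
  have t0 : 0 < sbθ γ := by rw [theta_eq hγ]; linarith
  rw [rev3]; positivity

theorem re_left (hγ : γ^3 - γ^2 + 2*γ - 1 = 0) (i a b : ℕ) : Re (revWSb γ) ((a : ℤ) + i, (b : ℤ)) ((a : ℤ), (b : ℤ)) := by
  induction i with
  | zero => simpa using Re.refl _ _
  | succ i ih =>
    refine Re.trans (Re.step (-1, ((0 : ℕ) : ℤ)) _ ?_ ?_ ?_ (rev_p3 hγ 0)) ih
    · constructor <;> positivity
    · constructor <;> positivity
    · ext <;> simp

theorem re_down (hγ : γ^3 - γ^2 + 2*γ - 1 = 0) (i a b : ℕ) : Re (revWSb γ) ((a : ℤ), (b : ℤ) + i) ((a : ℤ), (b : ℤ)) := by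
  induction i with
  | zero => simpa using Re.refl _ _
  | succ i ih =>
    refine Re.trans (Re.step (0, -1) _ ?_ ?_ ?_ (rev_p2 hγ)) ih
    · constructor <;> positivity
    · constructor <;> positivity
    · ext <;> simp

theorem re_to (hγ : γ^3 - γ^2 + 2*γ - 1 = 0) (h l L : ℕ) : Re (revWSb γ) ((h : ℤ), (l : ℤ)) ((L : ℤ), (L : ℤ)) := by
  have s1 : Re (revWSb γ) ((h : ℤ), (l : ℤ)) ((h : ℤ) + 1, (l : ℤ)) := by
    refine Re.step (((0 : ℕ) : ℤ) + 1, 0) _ ?_ ?_ ?_ (rev_p1 hγ 0)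
    · constructor <;> positivity
    · constructor <;> positivity
    · ext <;> simp
  have s2 : Re (revWSb γ) ((h : ℤ) + 1, (l : ℤ)) ((h : ℤ), (L : ℤ) + l) := by
    refine Re.step (-1, (L : ℤ)) _ ?_ ?_ ?_ (rev_p3 hγ L)
    · constructor <;> positivity
    · constructor <;> positivity
    · ext <;> simp
  have s3 := re_down hγ l h L
  have s4 : Re (revWSb γ) ((h : ℤ), (L : ℤ)) ((L : ℤ) + (h + 1 : ℕ), (L : ℤ)) := by
    refine Re.step ((L : ℤ) + 1, 0) _ ?_ ?_ ?_ (rev_p1 hγ L)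
    · constructor <;> positivity
    · constructor <;> positivity
    · ext
      · simp; ring
      · simp
  have s5 := re_left hγ (h + 1) L L
  exact s1.trans (s2.trans (s3.trans (s4.trans s5)))

theorem re_home (hγ : γ^3 - γ^2 + 2*γ - 1 = 0) (L : ℕ) : Re (revWSb γ) ((L : ℤ), (L : ℤ)) (0, 0) := by
  have s1 := re_left hγ L 0 L
  have s2 := re_down hγ L 0 0
  simp only [Nat.cast_zero, zero_add] at s1 s2
  exact s1.trans s2

theorem Sx_bound {p : ℝ} (hp : 2 < p) (h l : ℕ) :
    Sx ((h : ℤ), (l : ℤ)) ^ p ≤ 4 ^ p * (1 + Real.sqrt ((h : ℝ) ^ 2 + (l : ℝ) ^ 2) ^ p) := by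
  set r := Real.sqrt ((h : ℝ) ^ 2 + (l : ℝ) ^ 2) with hr
  have r0 : 0 ≤ r := Real.sqrt_nonneg _
  have h1 : (h : ℝ) ≤ r := Real.le_sqrt_of_sq_le (by nlinarith [sq_nonneg (l : ℝ)])
  have h2 : (l : ℝ) ≤ r := Real.le_sqrt_of_sq_le (by nlinarith [sq_nonneg (h : ℝ)])
  have e : Sx ((h : ℤ), (l : ℤ)) = (h : ℝ) + 1 + (l + 1) := by simp [Sx]
  have m0 : 0 ≤ max 1 r := by positivity
  have h3 : Sx ((h : ℤ), (l : ℤ)) ≤ 4 * max 1 r := by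
    rw [e]; have := le_max_left 1 r; have := le_max_right 1 r; linarith
  have h4 : Sx ((h : ℤ), (l : ℤ)) ^ p ≤ (4 * max 1 r) ^ p :=
    Real.rpow_le_rpow (by rw [e]; positivity) h3 (by linarith)
  rw [Real.mul_rpow (by norm_num) m0] at h4
  refine h4.trans ?_
  have rp : 0 ≤ r ^ p := by positivity
  gcongr
  rcases le_total 1 r with hh | hh
  · rw [max_eq_right hh]; linarith
  · rw [max_eq_left hh, Real.one_rpow]; linarith

theorem main (hγ : γ^3 - γ^2 + 2*γ - 1 = 0) :
    ∃ C : ℝ, 0 < C ∧ ∃ p : ℝ, 0 < p ∧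
      (∀ n : ℕ, 1 ≤ n → ∀ h ℓ : ℕ,
        quadProbSb γ ((h : ℤ), (ℓ : ℤ)) n
          ≤ C * (1 + Real.sqrt ((h : ℝ)^2 + (ℓ : ℝ)^2) ^ p) * (n : ℝ) ^ (-p - 1)) ∧
      (∀ h ℓ : ℕ, ∃ c : ℝ, 0 < c ∧ ∀ᶠ n : ℕ in Filter.atTop,
        c * (n : ℝ) ^ (-p - 1) ≤ quadProbSb γ ((h : ℤ), (ℓ : ℤ)) n) := by
  obtain ⟨s11, s12, s22, hl, h11, h22, h12, hd⟩ := law_rev hγ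
  obtain ⟨P, e1, e2, e3⟩ := exists_par h11 h22 h12 hd
  obtain ⟨m, ha⟩ := atoms_rev hγ
  obtain ⟨C, U, V, F, Lo, L, B⟩ := bar_exists hl h12 (hl.geo e1 e2 e3) (outGood_fwd hγ)
  obtain ⟨C', U', V', F', Lo', L', B'⟩ := bar_exists hl.neg h12 (hl.neg.geo e1 e2 e3) (outGood_dual hγ)
  have hp := B.hp
  set p := P.p
  obtain ⟨D, hD, HD⟩ := hl.upper ha B B'
  obtain ⟨c, N0, hc, hN0, Hc⟩ := hl.core ha B B'
  have hq : ∀ h l : ℕ, ((h : ℤ), (l : ℤ)) ∈ Q := fun h l => by constructor <;> positivity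
  refine ⟨D * 4 ^ p, by positivity, p, by linarith, ?_, ?_⟩
  · intro n hn h l
    rw [link hγ _ (hq h l)]
    have s0 := Sx_ge (hq h l)
    have := ENNReal.toReal_le_of_le_ofReal (by positivity) (HD n hn _ (hq h l))
    refine this.trans ?_
    have hb := Sx_bound hp h l
    calc D * Sx ((h : ℤ), (l : ℤ)) ^ p * (n : ℝ) ^ (-p - 1)
        ≤ D * (4 ^ p * (1 + Real.sqrt ((h : ℝ) ^ 2 + (l : ℝ) ^ 2) ^ p)) * (n : ℝ) ^ (-p - 1) := by gcongr
      _ = _ := by ring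
  · intro h l
    obtain ⟨i, hi⟩ := re_to hγ h l L
    obtain ⟨j, hj⟩ := re_home hγ L'
    have le1 : ∀ n x y, pw (kq (revWSb γ)) n x y ≤ 1 := fun n x y => (pw_le_sv _ _ _ _).trans (sv_le_one _ B.one _ _)
    have nt : ∀ n x y, pw (kq (revWSb γ)) n x y ≠ ⊤ := fun n x y => ((le1 n x y).trans_lt ENNReal.one_lt_top).ne
    set a := (pw (kq (revWSb γ)) i ((h : ℤ), (l : ℤ)) ((L : ℤ), (L : ℤ))).toReal with haa
    set b := (pw (kq (revWSb γ)) j ((L' : ℤ), (L' : ℤ)) (0, 0)).toReal with hbb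
    have a0 : 0 < a := ENNReal.toReal_pos hi (nt _ _ _)
    have b0 : 0 < b := ENNReal.toReal_pos hj (nt _ _ _)
    refine ⟨a * c * b, by positivity, ?_⟩
    filter_upwards [Filter.eventually_ge_atTop (N0 + i + j + 1)] with n hn
    rw [link hγ _ (hq h l)]
    obtain ⟨N, hN⟩ : ∃ N, n - 1 = i + (N + j) := ⟨n - 1 - i - j, by omega⟩
    have NN : N0 ≤ N := by omega
    have Nn : N ≤ n := by omega
    have N1 : (1 : ℝ) ≤ N := by exact_mod_cast hN0.trans NN
    have Nn' : (N : ℝ) ≤ n := by exact_mod_cast Nn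
    rw [← ENNReal.ofReal_le_iff_le_toReal (nt _ _ _), hN]
    refine le_trans ?_ (pw_mul_le _ i (N + j) _ ((L : ℤ), (L : ℤ)) _)
    refine le_trans ?_ (mul_le_mul' le_rfl (pw_mul_le _ N j _ ((L' : ℤ), (L' : ℤ)) _))
    rw [← ENNReal.ofReal_toReal (nt i _ _), ← ENNReal.ofReal_toReal (nt j _ _), ← haa, ← hbb]
    refine le_trans ?_ (mul_le_mul' le_rfl (mul_le_mul' (Hc N NN) le_rfl))
    rw [← ENNReal.ofReal_mul (by positivity), ← ENNReal.ofReal_mul (by positivity)]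
    refine ENNReal.ofReal_le_ofReal ?_
    have : (n : ℝ) ^ (-p - 1) ≤ (N : ℝ) ^ (-p - 1) :=
      Real.rpow_le_rpow_of_nonpos (by linarith) Nn' (by linarith)
    calc a * c * b * (n : ℝ) ^ (-p - 1) ≤ a * c * b * (N : ℝ) ^ (-p - 1) := by gcongr
      _ = _ := by ring

end
end SB

/-- upper bound `C(1+|(h,ℓ)|^p) n^{-p-1}`, uniformly in `(h,ℓ)` and
`n`, for the probability that the walk stays in the quadrant and ends at the origin;
and, for the same exponent `p`, a matching lower bound `c·n^{-p-1}` for each fixed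
starting point. -/
theorem strong_baxter_cone_estimates (γ : ℝ) (hγ : γ^3 - γ^2 + 2*γ - 1 = 0) :
    ∃ C : ℝ, 0 < C ∧ ∃ p : ℝ, 0 < p ∧
      (∀ n : ℕ, 1 ≤ n → ∀ h ℓ : ℕ,
        quadProbSb γ ((h : ℤ), (ℓ : ℤ)) n
          ≤ C * (1 + Real.sqrt ((h : ℝ)^2 + (ℓ : ℝ)^2) ^ p) * (n : ℝ) ^ (-p - 1)) ∧
      (∀ h ℓ : ℕ, ∃ c : ℝ, 0 < c ∧ ∀ᶠ n : ℕ in Filter.atTop,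
        c * (n : ℝ) ^ (-p - 1) ≤ quadProbSb γ ((h : ℤ), (ℓ : ℤ)) n) := by
  exact SB.main hγ
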